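/- arXiv:2412.00788 — 3 statements merged into one kernel-verified Lean document; each statement's English description precedes it below -/
import Mathlib

section
/- Let n ≥ 1, ρ > 0 and let Ω_ρ = {x ∈ ℝⁿ : |x| > ρ}. Let q be a bounded measurable (possibly complex-valued) function on Ω_ρ and let u ∈ H²_loc(Ω_ρ) satisfy Δu − q·u = 0 almost everywhere in Ω_ρ. If for every τ > 0 one has ∫_{Ω_ρ} |u(x)|² · exp(2τ|x|^{4/3}) dx < ∞, then u ≡ 0 in Ω_ρ. -/
open MeasureTheory Real

/-- The Laplacian of a complex-valued function on `ℝⁿ`, as the sum of the second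
partial derivatives along coordinate directions. -/
noncomputable def laplacian {n : ℕ} (u : EuclideanSpace ℝ (Fin n) → ℂ)
    (x : EuclideanSpace ℝ (Fin n)) : ℂ :=
  ∑ i : Fin n, fderiv ℝ (fun y => fderiv ℝ u y (EuclideanSpace.single i 1)) x
    (EuclideanSpace.single i 1)

namespace CarlemanInfinity

open scoped ContDiff Topology ENNReal

section

variable {n : ℕ}

/-- The partial derivative of a real function on `ℝⁿ` in the `i`-th coordinate direction. -/
noncomputable def pderiv (i : Fin n) (f : EuclideanSpace ℝ (Fin n) → ℝ)
    (x : EuclideanSpace ℝ (Fin n)) : ℝ :=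
  fderiv ℝ f x (EuclideanSpace.single i 1)

/-- The Laplacian of a real function on `ℝⁿ`. -/
noncomputable def lap (f : EuclideanSpace ℝ (Fin n) → ℝ) (x : EuclideanSpace ℝ (Fin n)) : ℝ :=
  ∑ i, pderiv i (pderiv i f) x

/-- The squared length of the gradient of a real function on `ℝⁿ`. -/
noncomputable def gradSq (f : EuclideanSpace ℝ (Fin n) → ℝ) (x : EuclideanSpace ℝ (Fin n)) : ℝ :=
  ∑ i, pderiv i f x ^ 2

variable {f g : EuclideanSpace ℝ (Fin n) → ℝ} {x : EuclideanSpace ℝ (Fin n)} {i : Fin n}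

@[fun_prop]
theorem contDiff_pderiv (hf : ContDiff ℝ ∞ f) (i : Fin n) : ContDiff ℝ ∞ (pderiv i f) :=
  (hf.fderiv_right (m := ∞) le_rfl).clm_apply contDiff_const

@[fun_prop]
theorem contDiff_lap (hf : ContDiff ℝ ∞ f) : ContDiff ℝ ∞ (lap f) := by
  unfold lap; fun_prop

@[fun_prop]
theorem contDiff_gradSq (hf : ContDiff ℝ ∞ f) : ContDiff ℝ ∞ (gradSq f) := by
  unfold gradSq; fun_prop

@[fun_prop]
theorem continuous_pderiv (hf : ContDiff ℝ ∞ f) (i : Fin n) : Continuous (pderiv i f) :=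
  (contDiff_pderiv hf i).continuous

@[fun_prop]
theorem continuous_lap (hf : ContDiff ℝ ∞ f) : Continuous (lap f) :=
  (contDiff_lap hf).continuous

@[fun_prop]
theorem continuous_gradSq (hf : ContDiff ℝ ∞ f) : Continuous (gradSq f) :=
  (contDiff_gradSq hf).continuous

theorem gradSq_nonneg : 0 ≤ gradSq f x := Finset.sum_nonneg fun _ _ => sq_nonneg _

theorem hasDerivAt_pderiv (hf : ContDiff ℝ ∞ f) (i : Fin n) (x : EuclideanSpace ℝ (Fin n)) :
    HasDerivAt (fun t : ℝ => f (x + t • EuclideanSpace.single i 1)) (pderiv i f x) 0 :=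
  ((hf.differentiable (by simp)) x).hasFDerivAt.hasLineDerivAt _

theorem pderiv_eq_of_hasDerivAt (hf : ContDiff ℝ ∞ f) {c : ℝ}
    (h : HasDerivAt (fun t : ℝ => f (x + t • EuclideanSpace.single i 1)) c 0) :
    pderiv i f x = c :=
  (hasDerivAt_pderiv hf i x).unique h

theorem pderiv_congr (h : f =ᶠ[𝓝 x] g) (i : Fin n) : pderiv i f x = pderiv i g x := by
  simp only [pderiv, h.fderiv_eq]

theorem pderiv_eventuallyEq (h : f =ᶠ[𝓝 x] g) (i : Fin n) :
    pderiv i f =ᶠ[𝓝 x] pderiv i g := by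
  filter_upwards [h.eventuallyEq_nhds] with y hy using pderiv_congr hy i

theorem lap_congr (h : f =ᶠ[𝓝 x] g) : lap f x = lap g x :=
  Finset.sum_congr rfl fun i _ => pderiv_congr (pderiv_eventuallyEq h i) i

theorem gradSq_congr (h : f =ᶠ[𝓝 x] g) : gradSq f x = gradSq g x :=
  Finset.sum_congr rfl fun i _ => by rw [pderiv_congr h i]

theorem pderiv_mul (hf : ContDiff ℝ ∞ f) (hg : ContDiff ℝ ∞ g) (i : Fin n) :
    pderiv i (fun y => f y * g y) = fun y => pderiv i f y * g y + f y * pderiv i g y := by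
  funext x
  refine pderiv_eq_of_hasDerivAt (hf.mul hg) ?_
  simpa using (hasDerivAt_pderiv hf i x).fun_mul (hasDerivAt_pderiv hg i x)

theorem pderiv_add (hf : ContDiff ℝ ∞ f) (hg : ContDiff ℝ ∞ g) (i : Fin n) :
    pderiv i (fun y => f y + g y) = fun y => pderiv i f y + pderiv i g y := by
  funext x
  refine pderiv_eq_of_hasDerivAt (hf.add hg) ?_
  simpa using (hasDerivAt_pderiv hf i x).fun_add (hasDerivAt_pderiv hg i x)

theorem lap_mul (hf : ContDiff ℝ ∞ f) (hg : ContDiff ℝ ∞ g) (x : EuclideanSpace ℝ (Fin n)) :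
    lap (fun y => f y * g y) x =
      lap f x * g x + 2 * ∑ i, pderiv i f x * pderiv i g x + f x * lap g x := by
  simp only [lap, Finset.sum_mul, Finset.mul_sum, ← Finset.sum_add_distrib]
  refine Finset.sum_congr rfl fun i _ => ?_
  rw [pderiv_mul hf hg, pderiv_add (by fun_prop) (by fun_prop),
    pderiv_mul (by fun_prop) (by fun_prop), pderiv_mul (by fun_prop) (by fun_prop)]
  ring

theorem pderiv_comm (hf : ContDiff ℝ ∞ f) (i j : Fin n) (x : EuclideanSpace ℝ (Fin n)) :
    pderiv i (pderiv j f) x = pderiv j (pderiv i f) x := by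
  have hd : Differentiable ℝ (fderiv ℝ f) :=
    (hf.fderiv_right (m := ∞) le_rfl).differentiable (by simp)
  have key : ∀ i j : Fin n, pderiv i (pderiv j f) x =
      fderiv ℝ (fderiv ℝ f) x (EuclideanSpace.single i 1) (EuclideanSpace.single j 1) := by
    intro i j
    unfold pderiv
    rw [fderiv_clm_apply (hd x) (by fun_prop)]
    simp
  rw [key, key]
  exact (hf.contDiffAt.isSymmSndFDerivAt (by simp; exact WithTop.coe_le_coe.2 le_top)) _ _

theorem tsupport_pderiv_subset (f : EuclideanSpace ℝ (Fin n) → ℝ) (i : Fin n) :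
    tsupport (pderiv i f) ⊆ tsupport f := tsupport_fderiv_apply_subset ℝ _

theorem hasCompactSupport_pderiv (hf : HasCompactSupport f) (i : Fin n) :
    HasCompactSupport (pderiv i f) := hf.mono' (subset_closure.trans (tsupport_pderiv_subset f i))

theorem pderiv_eq_zero (hx : x ∉ tsupport f) (i : Fin n) : pderiv i f x = 0 :=
  image_eq_zero_of_notMem_tsupport fun h => hx (tsupport_pderiv_subset f i h)

theorem lap_eq_zero (hx : x ∉ tsupport f) : lap f x = 0 :=
  Finset.sum_eq_zero fun i _ => pderiv_eq_zero (fun h => hx (tsupport_pderiv_subset f i h)) i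

theorem gradSq_eq_zero (hx : x ∉ tsupport f) : gradSq f x = 0 :=
  Finset.sum_eq_zero fun i _ => by rw [pderiv_eq_zero hx]; simp

theorem integral_pderiv_eq_zero (hf : ContDiff ℝ ∞ f) (hc : HasCompactSupport f) (i : Fin n) :
    ∫ x, pderiv i f x = 0 := by
  have hi : Integrable (pderiv i f) := (contDiff_pderiv hf i).continuous.integrable_of_hasCompactSupport
    (hasCompactSupport_pderiv hc i)
  have h := integral_mul_fderiv_eq_neg_fderiv_mul_of_integrable (μ := volume)
    (f := fun _ => (1 : ℝ)) (g := f) (v := EuclideanSpace.single i (1 : ℝ)) (by simp)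
    (by simp only [one_mul]; exact hi)
    (by simpa using hf.continuous.integrable_of_hasCompactSupport hc)
    (fun _ _ => by fun_prop) (fun x _ => hf.differentiable (by simp) x)
  simpa [pderiv] using h

/-- The divergence theorem for smooth compactly supported vector fields. -/
theorem integral_div_eq_zero {F : Fin n → EuclideanSpace ℝ (Fin n) → ℝ}
    (hF : ∀ i, ContDiff ℝ ∞ (F i)) (hc : ∀ i, HasCompactSupport (F i)) :
    ∫ x, ∑ i, pderiv i (F i) x = 0 := by
  rw [integral_finsetSum]
  · exact Finset.sum_eq_zero fun i _ => integral_pderiv_eq_zero (hF i) (hc i) i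
  · exact fun i _ => (contDiff_pderiv (hF i) i).continuous.integrable_of_hasCompactSupport
      (hasCompactSupport_pderiv (hc i) i)

/-- A function vanishing off the support of a compactly supported function is integrable
if it is continuous. -/
theorem integrable_of_eq_zero (hf : Continuous f) (hg : HasCompactSupport g)
    (h : ∀ x, x ∉ tsupport g → f x = 0) : Integrable f :=
  hf.integrable_of_hasCompactSupport (HasCompactSupport.intro hg h)

end

section

variable {n : ℕ}

/-- The vector field whose divergence accounts for the integrations by parts in the
Carleman inequality with weight `exp (τ φ)`. -/
noncomputable def carlemanField (τ : ℝ) (φ w : EuclideanSpace ℝ (Fin n) → ℝ) (i : Fin n)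
    (x : EuclideanSpace ℝ (Fin n)) : ℝ :=
  -4 * τ * (pderiv i w x * ∑ j, pderiv j φ x * pderiv j w x)
    + 2 * τ * (pderiv i φ x * ∑ j, pderiv j w x * pderiv j w x)
    - 2 * τ * (lap φ x * w x * pderiv i w x) + τ * (w x * w x * pderiv i (lap φ) x)
    - 2 * τ ^ 3 * ((∑ j, pderiv j φ x * pderiv j φ x) * pderiv i φ x * (w x * w x))

/-- The quadratic form produced by commuting the symmetric and antisymmetric parts of the
conjugated Laplacian. -/
noncomputable def carlemanForm (τ : ℝ) (φ w : EuclideanSpace ℝ (Fin n) → ℝ)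
    (x : EuclideanSpace ℝ (Fin n)) : ℝ :=
  4 * τ * (∑ i, ∑ j, pderiv i (pderiv j φ) x * pderiv i w x * pderiv j w x)
    - τ * (lap (lap φ) x * w x ^ 2)
    + 4 * τ ^ 3 * ((∑ i, ∑ j, pderiv i (pderiv j φ) x * pderiv i φ x * pderiv j φ x) * w x ^ 2)

variable {φ w v : EuclideanSpace ℝ (Fin n) → ℝ}

theorem contDiff_carlemanField (τ : ℝ) (hφ : ContDiff ℝ ∞ φ) (hw : ContDiff ℝ ∞ w) (i : Fin n) :
    ContDiff ℝ ∞ (carlemanField τ φ w i) := by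
  unfold carlemanField; fun_prop

theorem continuous_carlemanForm (τ : ℝ) (hφ : ContDiff ℝ ∞ φ) (hw : ContDiff ℝ ∞ w) :
    Continuous (carlemanForm τ φ w) := by
  have h1 := hw.continuous
  unfold carlemanForm
  fun_prop (disch := fun_prop)

theorem pderiv_carlemanField (τ : ℝ) (hφ : ContDiff ℝ ∞ φ) (hw : ContDiff ℝ ∞ w) (i : Fin n)
    (x : EuclideanSpace ℝ (Fin n)) :
    pderiv i (carlemanField τ φ w i) x =
      -4 * τ * (pderiv i (pderiv i w) x * (∑ j, pderiv j φ x * pderiv j w x) + pderiv i w x *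
          ∑ j, (pderiv i (pderiv j φ) x * pderiv j w x + pderiv j φ x * pderiv i (pderiv j w) x))
      + 2 * τ * (pderiv i (pderiv i φ) x * (∑ j, pderiv j w x * pderiv j w x) + pderiv i φ x *
          ∑ j, (pderiv i (pderiv j w) x * pderiv j w x + pderiv j w x * pderiv i (pderiv j w) x))
      - 2 * τ * ((pderiv i (lap φ) x * w x + lap φ x * pderiv i w x) * pderiv i w x
          + lap φ x * w x * pderiv i (pderiv i w) x)
      + τ * ((pderiv i w x * w x + w x * pderiv i w x) * pderiv i (lap φ) x
          + w x * w x * pderiv i (pderiv i (lap φ)) x)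
      - 2 * τ ^ 3 * (((∑ j, (pderiv i (pderiv j φ) x * pderiv j φ x
            + pderiv j φ x * pderiv i (pderiv j φ) x)) * pderiv i φ x
          + (∑ j, pderiv j φ x * pderiv j φ x) * pderiv i (pderiv i φ) x) * (w x * w x)
          + (∑ j, pderiv j φ x * pderiv j φ x) * pderiv i φ x
            * (pderiv i w x * w x + w x * pderiv i w x)) := by
  refine pderiv_eq_of_hasDerivAt (contDiff_carlemanField τ hφ hw i) ?_
  have d0 := hasDerivAt_pderiv hw i x
  have d1 := fun j => hasDerivAt_pderiv (contDiff_pderiv hw j) i x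
  have dφ := fun j => hasDerivAt_pderiv (contDiff_pderiv hφ j) i x
  have dL := hasDerivAt_pderiv (contDiff_lap hφ) i x
  have dL1 := hasDerivAt_pderiv (contDiff_pderiv (contDiff_lap hφ) i) i x
  have h := (((((d1 i).fun_mul (HasDerivAt.fun_sum (u := Finset.univ)
      fun j _ => (dφ j).fun_mul (d1 j))).const_mul (-4 * τ)).fun_add
      (((dφ i).fun_mul (HasDerivAt.fun_sum (u := Finset.univ)
      fun j _ => (d1 j).fun_mul (d1 j))).const_mul (2 * τ))).fun_sub
      (((dL.fun_mul d0).fun_mul (d1 i)).const_mul (2 * τ))).fun_add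
      (((d0.fun_mul d0).fun_mul dL1).const_mul τ) |>.fun_sub
      ((((HasDerivAt.fun_sum (u := Finset.univ) fun j _ => (dφ j).fun_mul (dφ j)).fun_mul
        (dφ i)).fun_mul (d0.fun_mul d0)).const_mul (2 * τ ^ 3))
  simp only [zero_smul, add_zero] at h
  exact h

theorem sum_pderiv_carlemanField (τ : ℝ) (hφ : ContDiff ℝ ∞ φ) (hw : ContDiff ℝ ∞ w)
    (x : EuclideanSpace ℝ (Fin n)) :
    ∑ i, pderiv i (carlemanField τ φ w i) x + carlemanForm τ φ w x =
      2 * (lap w x + τ ^ 2 * gradSq φ x * w x) *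
        (-2 * τ * (∑ j, pderiv j φ x * pderiv j w x) - τ * lap φ x * w x) := by
  have hcross : ∑ i, pderiv i φ x * ∑ j, pderiv i (pderiv j w) x * pderiv j w x =
      ∑ i, pderiv i w x * ∑ j, pderiv j φ x * pderiv i (pderiv j w) x := by
    simp only [Finset.mul_sum]
    rw [Finset.sum_comm]
    refine Finset.sum_congr rfl fun i _ => Finset.sum_congr rfl fun j _ => ?_
    rw [pderiv_comm hw]; ring
  have hll : lap (lap φ) x = ∑ i, pderiv i (pderiv i (lap φ)) x := rfl
  have hlw : lap w x = ∑ i, pderiv i (pderiv i w) x := rfl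
  have hlφ : lap φ x = ∑ i, pderiv i (pderiv i φ) x := rfl
  have hH (a : Fin n → ℝ) : ∑ i, ∑ j, pderiv i (pderiv j φ) x * a i * a j =
      ∑ i, a i * ∑ j, pderiv i (pderiv j φ) x * a j := by
    simp only [Finset.mul_sum]
    exact Finset.sum_congr rfl fun i _ => Finset.sum_congr rfl fun j _ => by ring
  unfold carlemanForm
  rw [hH, hH, hll, show gradSq φ x = ∑ j, pderiv j φ x * pderiv j φ x from
    Finset.sum_congr rfl fun j _ => by ring]
  have hi : ∀ i, pderiv i (carlemanField τ φ w i) x =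
      -4 * τ * (∑ j, pderiv j φ x * pderiv j w x) * pderiv i (pderiv i w) x
      - 4 * τ * (pderiv i w x * ∑ j, pderiv i (pderiv j φ) x * pderiv j w x)
      - 4 * τ * (pderiv i w x * ∑ j, pderiv j φ x * pderiv i (pderiv j w) x)
      + 2 * τ * (∑ j, pderiv j w x * pderiv j w x) * pderiv i (pderiv i φ) x
      + 4 * τ * (pderiv i φ x * ∑ j, pderiv i (pderiv j w) x * pderiv j w x)
      - 2 * τ * lap φ x * (pderiv i w x * pderiv i w x)
      - 2 * τ * lap φ x * w x * pderiv i (pderiv i w) x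
      + τ * w x ^ 2 * pderiv i (pderiv i (lap φ)) x
      - 4 * τ ^ 3 * w x ^ 2 * (pderiv i φ x * ∑ j, pderiv i (pderiv j φ) x * pderiv j φ x)
      - 2 * τ ^ 3 * (∑ j, pderiv j φ x * pderiv j φ x) * w x ^ 2 * pderiv i (pderiv i φ) x
      - 4 * τ ^ 3 * (∑ j, pderiv j φ x * pderiv j φ x) * w x * (pderiv i φ x * pderiv i w x) := by
    intro i
    have e1 : ∑ j, (pderiv i (pderiv j w) x * pderiv j w x + pderiv j w x * pderiv i (pderiv j w) x)
        = 2 * ∑ j, pderiv i (pderiv j w) x * pderiv j w x := by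
      rw [Finset.mul_sum]; exact Finset.sum_congr rfl fun j _ => by ring
    have e2 : ∑ j, (pderiv i (pderiv j φ) x * pderiv j φ x + pderiv j φ x * pderiv i (pderiv j φ) x)
        = 2 * ∑ j, pderiv i (pderiv j φ) x * pderiv j φ x := by
      rw [Finset.mul_sum]; exact Finset.sum_congr rfl fun j _ => by ring
    rw [pderiv_carlemanField τ hφ hw, e1, e2, Finset.sum_add_distrib]
    ring
  simp only [hi, Finset.sum_add_distrib, Finset.sum_sub_distrib, ← Finset.mul_sum]
  rw [hcross, ← hlw, ← hlφ]
  ring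

theorem integral_carlemanForm_le (τ : ℝ) (hφ : ContDiff ℝ ∞ φ) (hw : ContDiff ℝ ∞ w)
    (hc : HasCompactSupport w) :
    ∫ x, carlemanForm τ φ w x ≤ ∫ x, (lap w x + τ ^ 2 * gradSq φ x * w x
      - 2 * τ * (∑ j, pderiv j φ x * pderiv j w x) - τ * lap φ x * w x) ^ 2 := by
  have hw0 := hw.continuous
  have hFc (i) : HasCompactSupport (carlemanField τ φ w i) :=
    HasCompactSupport.intro hc fun x hx => by
      simp [carlemanField, pderiv_eq_zero hx, image_eq_zero_of_notMem_tsupport hx]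
  have hdiv := integral_div_eq_zero (contDiff_carlemanField τ hφ hw) hFc
  have hi1 : Integrable fun x => ∑ i, pderiv i (carlemanField τ φ w i) x :=
    integrable_finsetSum _ fun i _ =>
      (continuous_pderiv (contDiff_carlemanField τ hφ hw i) i).integrable_of_hasCompactSupport
        (hasCompactSupport_pderiv (hFc i) i)
  have hi2 : Integrable (carlemanForm τ φ w) :=
    integrable_of_eq_zero (continuous_carlemanForm τ hφ hw) hc fun x hx => by
      simp [carlemanForm, pderiv_eq_zero hx, image_eq_zero_of_notMem_tsupport hx]
  rw [← zero_add (∫ x, carlemanForm τ φ w x), ← hdiv, ← integral_add hi1 hi2]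
  refine integral_mono (hi1.add hi2) (integrable_of_eq_zero (by fun_prop) hc fun x hx => ?_)
    fun x => ?_
  · simp [lap_eq_zero hx, pderiv_eq_zero hx, image_eq_zero_of_notMem_tsupport hx]
  · simp only [sum_pderiv_carlemanField τ hφ hw]
    nlinarith [sq_nonneg (lap w x + τ ^ 2 * gradSq φ x * w x),
      sq_nonneg (-2 * τ * (∑ j, pderiv j φ x * pderiv j w x) - τ * lap φ x * w x)]

theorem pderiv_exp_mul (τ : ℝ) (hφ : ContDiff ℝ ∞ φ) (i : Fin n) :
    pderiv i (fun y => exp (τ * φ y)) = fun y => τ * pderiv i φ y * exp (τ * φ y) := by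
  funext x
  refine pderiv_eq_of_hasDerivAt (by fun_prop) ?_
  have := ((hasDerivAt_pderiv hφ i x).const_mul τ).exp
  simp only [zero_smul, add_zero] at this
  exact this.congr_deriv (by ring)

theorem conjugated_lap (τ : ℝ) (hφ : ContDiff ℝ ∞ φ) (hv : ContDiff ℝ ∞ v)
    (x : EuclideanSpace ℝ (Fin n)) :
    lap (fun y => exp (τ * φ y) * v y) x + τ ^ 2 * gradSq φ x * (exp (τ * φ x) * v x)
      - 2 * τ * (∑ j, pderiv j φ x * pderiv j (fun y => exp (τ * φ y) * v y) x)
      - τ * lap φ x * (exp (τ * φ x) * v x) = exp (τ * φ x) * lap v x := by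
  have hE : ContDiff ℝ ∞ fun y => exp (τ * φ y) := by fun_prop
  rw [lap_mul hE hv]
  simp only [lap, gradSq, Finset.mul_sum, Finset.sum_mul, ← Finset.sum_add_distrib,
    ← Finset.sum_sub_distrib]
  refine Finset.sum_congr rfl fun i _ => ?_
  have h2 : pderiv i (fun y => τ * pderiv i φ y * exp (τ * φ y)) x =
      τ * pderiv i (pderiv i φ) x * exp (τ * φ x)
        + τ * pderiv i φ x * (τ * pderiv i φ x * exp (τ * φ x)) := by
    refine pderiv_eq_of_hasDerivAt (by fun_prop) ?_
    have := ((hasDerivAt_pderiv (contDiff_pderiv hφ i) i x).const_mul τ).fun_mul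
      (hasDerivAt_pderiv hE i x)
    simpa only [zero_smul, add_zero, pderiv_exp_mul τ hφ i] using this
  rw [pderiv_mul hE hv, pderiv_exp_mul τ hφ, h2]
  ring

/-- The Carleman inequality for an arbitrary smooth weight, before any convexity is used. -/
theorem integral_carlemanForm_exp_le (τ : ℝ) (hφ : ContDiff ℝ ∞ φ) (hv : ContDiff ℝ ∞ v)
    (hc : HasCompactSupport v) :
    ∫ x, carlemanForm τ φ (fun y => exp (τ * φ y) * v y) x ≤
      ∫ x, lap v x ^ 2 * exp (2 * τ * φ x) := by
  have hw : ContDiff ℝ ∞ fun y => exp (τ * φ y) * v y := by fun_prop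
  refine (integral_carlemanForm_le τ hφ hw hc.mul_left).trans_eq ?_
  refine integral_congr_ae (.of_forall fun x => ?_)
  simp only [conjugated_lap τ hφ hv]
  rw [mul_pow, ← exp_nat_mul, mul_comm]
  congr 2; push_cast; ring

end

section

variable {n : ℕ} {h : ℝ → ℝ}

theorem contDiff_radial (hh : ContDiff ℝ ∞ h) :
    ContDiff ℝ ∞ fun x : EuclideanSpace ℝ (Fin n) => h (‖x‖ ^ 2) :=
  hh.comp (contDiff_norm_sq ℝ)

theorem contDiff_deriv (hh : ContDiff ℝ ∞ h) : ContDiff ℝ ∞ (deriv h) :=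
  ((contDiff_succ_iff_deriv (n := ∞)).1 hh).2.2

theorem hasDerivAt_radial (hh : ContDiff ℝ ∞ h) (i : Fin n) (x : EuclideanSpace ℝ (Fin n)) :
    HasDerivAt (fun t : ℝ => h (‖x + t • EuclideanSpace.single i 1‖ ^ 2))
      (2 * x i * deriv h (‖x‖ ^ 2)) 0 := by
  have h1 : HasDerivAt (fun t : ℝ => ‖x + t • EuclideanSpace.single i (1 : ℝ)‖ ^ 2) (2 * x i) 0 := by
    have := (hasStrictFDerivAt_norm_sq x).hasFDerivAt.hasLineDerivAt (EuclideanSpace.single i (1 : ℝ))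
    refine HasDerivAt.congr_deriv this ?_
    simp [EuclideanSpace.inner_single_right]
  have h2 : HasDerivAt h (deriv h (‖x‖ ^ 2)) (‖x + (0 : ℝ) • EuclideanSpace.single i (1 : ℝ)‖ ^ 2) := by
    simpa using (hh.differentiable (by simp) (‖x‖ ^ 2)).hasDerivAt
  exact (h2.comp 0 h1).congr_deriv (by ring)

theorem pderiv_radial (hh : ContDiff ℝ ∞ h) (i : Fin n) :
    pderiv i (fun x => h (‖x‖ ^ 2)) = fun x => 2 * x i * deriv h (‖x‖ ^ 2) := by
  funext x
  exact pderiv_eq_of_hasDerivAt (contDiff_radial hh) (hasDerivAt_radial hh i x)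

theorem pderiv_pderiv_radial (hh : ContDiff ℝ ∞ h) (i j : Fin n) (x : EuclideanSpace ℝ (Fin n)) :
    pderiv i (pderiv j (fun x => h (‖x‖ ^ 2))) x =
      2 * (if i = j then 1 else 0) * deriv h (‖x‖ ^ 2)
        + 4 * x i * x j * deriv (deriv h) (‖x‖ ^ 2) := by
  rw [pderiv_radial hh]
  have hr := contDiff_radial (n := n) (contDiff_deriv hh)
  refine pderiv_eq_of_hasDerivAt (by fun_prop) ?_
  have h1 : HasDerivAt (fun t : ℝ => 2 * (x + t • EuclideanSpace.single i (1 : ℝ)) j)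
      (2 * (if i = j then 1 else 0)) 0 := by
    have : HasDerivAt (fun t : ℝ => 2 * (x j + t * (if i = j then 1 else 0)))
      (2 * (1 * (if i = j then (1 : ℝ) else 0))) 0 :=
      (((hasDerivAt_id (0 : ℝ)).mul_const _).const_add _).const_mul _
    simpa [eq_comm] using this
  have := h1.fun_mul (hasDerivAt_radial (contDiff_deriv hh) i x)
  refine this.congr_deriv ?_
  simp only [zero_smul, add_zero]
  ring

theorem lap_radial (hh : ContDiff ℝ ∞ h) :
    lap (fun x : EuclideanSpace ℝ (Fin n) => h (‖x‖ ^ 2)) =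
      fun x => (fun s => 2 * n * deriv h s + 4 * s * deriv (deriv h) s) (‖x‖ ^ 2) := by
  funext x
  have hx : ‖x‖ ^ 2 = ∑ i, x i ^ 2 := by simp [EuclideanSpace.norm_sq_eq]
  have h1 : ∀ i, pderiv i (pderiv i (fun x => h (‖x‖ ^ 2))) x =
      2 * deriv h (‖x‖ ^ 2) + 4 * deriv (deriv h) (‖x‖ ^ 2) * x i ^ 2 := fun i => by
    rw [pderiv_pderiv_radial hh, if_pos rfl]; ring
  simp only [lap, h1, Finset.sum_add_distrib, ← Finset.mul_sum, ← hx, Finset.sum_const,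
    Finset.card_univ, Fintype.card_fin, nsmul_eq_mul]
  ring

theorem hessian_radial (hh : ContDiff ℝ ∞ h) (a : Fin n → ℝ) (x : EuclideanSpace ℝ (Fin n)) :
    ∑ i, ∑ j, pderiv i (pderiv j (fun x => h (‖x‖ ^ 2))) x * a i * a j =
      2 * deriv h (‖x‖ ^ 2) * ∑ i, a i ^ 2 + 4 * deriv (deriv h) (‖x‖ ^ 2) * (∑ i, x i * a i) ^ 2 := by
  have h1 : ∀ i, ∑ j, pderiv i (pderiv j (fun x => h (‖x‖ ^ 2))) x * a i * a j =
      2 * deriv h (‖x‖ ^ 2) * a i ^ 2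
        + 4 * deriv (deriv h) (‖x‖ ^ 2) * ((x i * a i) * ∑ j, x j * a j) := by
    intro i
    simp only [pderiv_pderiv_radial hh, add_mul, Finset.sum_add_distrib, Finset.mul_sum]
    congr 1
    · simp; ring
    · exact Finset.sum_congr rfl fun j _ => by ring
  simp only [h1, Finset.sum_add_distrib, ← Finset.mul_sum, ← Finset.sum_mul]
  ring

/-- `2 n h' + 4 s h''` is the radial profile of the Laplacian; it maps powers to powers. -/
theorem radialLap_rpow {b : ℝ} (hb : 0 < b) {c a : ℝ}
    (hpow : ∀ s, b < s → h s = c * s ^ a) {s : ℝ} (hs : b < s) :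
    2 * n * deriv h s + 4 * s * deriv (deriv h) s =
      c * (2 * n * a + 4 * a * (a - 1)) * s ^ (a - 1) := by
  have d1 : ∀ {h : ℝ → ℝ} {c a : ℝ}, (∀ s, b < s → h s = c * s ^ a) → ∀ s, b < s →
      deriv h s = (c * a) * s ^ (a - 1) := by
    intro h c a hp s hs
    have : h =ᶠ[𝓝 s] fun s => c * s ^ a := by
      filter_upwards [lt_mem_nhds hs] with t ht using hp t ht
    rw [this.deriv_eq]
    exact (((hasDerivAt_rpow_const (p := a) (Or.inl (hb.trans hs).ne')).const_mul c).deriv).trans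
      (by ring)
  rw [d1 hpow s hs, d1 (d1 hpow) s hs, rpow_sub_one (hb.trans hs).ne' (a - 1)]
  field_simp [(hb.trans hs).ne']

/-- A smooth function on the line that agrees with `s ^ (2/3)` for large `s`. -/
theorem exists_contDiff_eq_rpow {b : ℝ} (hb : 0 < b) :
    ∃ h : ℝ → ℝ, ContDiff ℝ ∞ h ∧ ∀ s, b < s → h s = s ^ ((2 : ℝ) / 3) := by
  refine ⟨fun s => smoothTransition (2 * s / b - 1) * s ^ ((2 : ℝ) / 3), ?_, fun s hs => ?_⟩
  · rw [contDiff_iff_contDiffAt]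
    intro s
    rcases lt_or_ge 0 s with hs | hs
    · exact ((smoothTransition.contDiff.comp (by fun_prop)).contDiffAt).mul
        (contDiffAt_rpow_const_of_ne hs.ne')
    · refine (contDiffAt_const (c := (0 : ℝ))).congr_of_eventuallyEq ?_
      filter_upwards [gt_mem_nhds (show s < b / 2 by linarith)] with t ht
      rw [smoothTransition.zero_of_nonpos, zero_mul]
      rw [sub_nonpos, div_le_one hb]; linarith
  · simp only
    rw [smoothTransition.one_of_one_le, one_mul]
    rw [le_sub_iff_add_le, le_div_iff₀ hb]; linarith

/-- The Carleman inequality with weight `exp (2 τ |x| ^ (4/3))` for smooth functions with compact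
support outside a ball centred at the origin. -/
theorem carleman_inequality (n : ℕ) {ρ : ℝ} (hρ : 0 < ρ) :
    ∃ τ₀ : ℝ, 1 ≤ τ₀ ∧ ∀ τ, τ₀ ≤ τ → ∀ v : EuclideanSpace ℝ (Fin n) → ℝ, ContDiff ℝ ∞ v →
      HasCompactSupport v → tsupport v ⊆ {x | ρ < ‖x‖} →
      τ ^ 3 * ∫ x, v x ^ 2 * exp (2 * τ * ‖x‖ ^ ((4 : ℝ) / 3)) ≤
        ∫ x, lap v x ^ 2 * exp (2 * τ * ‖x‖ ^ ((4 : ℝ) / 3)) := by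
  have hρ2 : 0 < ρ ^ 2 := by positivity
  obtain ⟨h, hh, hpow⟩ := exists_contDiff_eq_rpow hρ2
  set φ : EuclideanSpace ℝ (Fin n) → ℝ := fun x => h (‖x‖ ^ 2) with hφdef
  have hφ : ContDiff ℝ ∞ φ := contDiff_radial hh
  have hφeq : ∀ x, ρ < ‖x‖ → φ x = ‖x‖ ^ ((4 : ℝ) / 3) := by
    intro x hx
    rw [hφdef]; simp only
    rw [hpow _ (by gcongr), ← rpow_natCast, ← rpow_mul (norm_nonneg x)]
    norm_num
  have hd1 : ∀ s, ρ ^ 2 < s → deriv h s = 2 / 3 * s ^ (-(1 : ℝ) / 3) := by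
    intro s hs
    have : h =ᶠ[𝓝 s] fun s => s ^ ((2 : ℝ) / 3) := by
      filter_upwards [lt_mem_nhds hs] with t ht using hpow t ht
    rw [this.deriv_eq, (hasDerivAt_rpow_const (Or.inl (hρ2.trans hs).ne')).deriv]
    norm_num
  have hd2 : ∀ s, ρ ^ 2 < s → deriv (deriv h) s = -(2 / 9) * s ^ (-(4 : ℝ) / 3) := by
    intro s hs
    have : deriv h =ᶠ[𝓝 s] fun s => 2 / 3 * s ^ (-(1 : ℝ) / 3) := by
      filter_upwards [lt_mem_nhds hs] with t ht using hd1 t ht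
    rw [this.deriv_eq,
      ((hasDerivAt_rpow_const (Or.inl (hρ2.trans hs).ne')).const_mul (2 / 3 : ℝ)).deriv]
    norm_num
    ring
  obtain ⟨B, hB⟩ : ∃ B : ℝ, ∀ x : EuclideanSpace ℝ (Fin n), ρ < ‖x‖ → lap (lap φ) x ≤ B := by
    have hT : ContDiff ℝ ∞ fun s => 2 * n * deriv h s + 4 * s * deriv (deriv h) s := by
      have := contDiff_deriv hh
      have := contDiff_deriv this
      fun_prop
    have e1 : ∀ s, ρ ^ 2 < s → 2 * n * deriv h s + 4 * s * deriv (deriv h) s = _ := fun s hs =>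
      radialLap_rpow (n := n) hρ2 (c := 1) (a := 2 / 3) (fun s hs => by rw [one_mul, hpow s hs]) hs
    have e2 := fun s hs => radialLap_rpow (n := n) (s := s) hρ2 e1 hs
    set C := 1 * (2 * n * ((2 : ℝ) / 3) + 4 * (2 / 3) * (2 / 3 - 1)) *
      (2 * n * (2 / 3 - 1) + 4 * (2 / 3 - 1) * (2 / 3 - 1 - 1))
    refine ⟨|C| * (ρ ^ 2) ^ ((2 : ℝ) / 3 - 1 - 1), fun x hx => ?_⟩
    have hs : ρ ^ 2 < ‖x‖ ^ 2 := by gcongr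
    rw [lap_radial hh, lap_radial hT]
    simp only
    rw [e2 _ hs]
    refine mul_le_mul (le_abs_self C) ?_ (by positivity) (abs_nonneg _)
    exact rpow_le_rpow_of_nonpos hρ2 hs.le (by norm_num)
  refine ⟨max 1 B, le_max_left _ _, fun τ hτ v hv hc hsupp => ?_⟩
  have hτ1 : 1 ≤ τ := (le_max_left _ _).trans hτ
  have hτB : B ≤ τ ^ 2 := ((le_max_right _ _).trans hτ).trans (by nlinarith)
  have hW : ∀ x, x ∈ tsupport v → exp (2 * τ * ‖x‖ ^ ((4 : ℝ) / 3)) = exp (2 * τ * φ x) :=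
    fun x hx => by rw [hφeq x (hsupp hx)]
  have hl : ∫ x, v x ^ 2 * exp (2 * τ * ‖x‖ ^ ((4 : ℝ) / 3)) =
      ∫ x, (exp (τ * φ x) * v x) ^ 2 := by
    refine integral_congr_ae (.of_forall fun x => ?_)
    by_cases hx : x ∈ tsupport v
    · simp only [hW x hx]
      rw [mul_pow, ← exp_nat_mul, mul_comm]
      congr 2; push_cast; ring
    · simp [image_eq_zero_of_notMem_tsupport hx]
  have hr : ∫ x, lap v x ^ 2 * exp (2 * τ * ‖x‖ ^ ((4 : ℝ) / 3)) =
      ∫ x, lap v x ^ 2 * exp (2 * τ * φ x) := by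
    refine integral_congr_ae (.of_forall fun x => ?_)
    by_cases hx : x ∈ tsupport v
    · simp only [hW x hx]
    · simp [lap_eq_zero hx]
  rw [hl, hr, ← integral_const_mul]
  refine le_trans ?_ (integral_carlemanForm_exp_le τ hφ hv hc)
  have hw : ContDiff ℝ ∞ fun y => exp (τ * φ y) * v y := by fun_prop
  have hwc : HasCompactSupport fun y => exp (τ * φ y) * v y := hc.mul_left
  have hwsub : tsupport (fun y => exp (τ * φ y) * v y) ⊆ tsupport v := tsupport_mul_subset_right
  have hw0 := hw.continuous
  refine integral_mono (integrable_of_eq_zero (by fun_prop) hwc fun x hx => ?_)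
    (integrable_of_eq_zero (continuous_carlemanForm τ hφ hw) hwc fun x hx => ?_) fun x => ?_
  · have h0 : exp (τ * φ x) * v x = 0 :=
      image_eq_zero_of_notMem_tsupport (f := fun y => exp (τ * φ y) * v y) hx
    simp [h0]
  · have h0 : exp (τ * φ x) * v x = 0 :=
      image_eq_zero_of_notMem_tsupport (f := fun y => exp (τ * φ y) * v y) hx
    simp only [carlemanForm, pderiv_eq_zero hx, h0]
    simp
  · simp only
    generalize hwdef : (fun y => exp (τ * φ y) * v y) = w at *
    have hwx : exp (τ * φ x) * v x = w x := by rw [← hwdef]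
    rw [hwx]
    by_cases hx : x ∈ tsupport w
    · have hxρ : ρ < ‖x‖ := hsupp (hwsub hx)
      have hs : ρ ^ 2 < ‖x‖ ^ 2 := by gcongr
      set s := ‖x‖ ^ 2 with hsdef
      have hs0 : 0 < s := hρ2.trans hs
      have hss : ∑ i, x i ^ 2 = s := by simp [hsdef, EuclideanSpace.norm_sq_eq]
      have hp : s ^ (-(1 : ℝ) / 3) = s * s ^ (-(4 : ℝ) / 3) := by
        rw [← rpow_one_add' hs0.le (by norm_num)]; norm_num
      have hp3 : s * (s ^ (-(1 : ℝ) / 3)) ^ 3 = 1 := by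
        rw [← rpow_natCast, ← rpow_mul hs0.le]
        norm_num [rpow_neg_one]
        exact mul_inv_cancel₀ hs0.ne'
      have hq : 0 < s ^ (-(4 : ℝ) / 3) := rpow_pos_of_pos hs0 _
      have hH1 : 0 ≤ ∑ i, ∑ j, pderiv i (pderiv j φ) x * pderiv i w x * pderiv j w x := by
        have hcs := Finset.sum_mul_sq_le_sq_mul_sq Finset.univ (fun i => x i) fun i => pderiv i w x
        rw [hss] at hcs
        have hN : 0 ≤ ∑ i, pderiv i w x ^ 2 := Finset.sum_nonneg fun _ _ => sq_nonneg _
        rw [hessian_radial hh (fun i => pderiv i w x), ← hsdef, hd1 s hs, hd2 s hs, hp]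
        have := mul_le_mul_of_nonneg_left hcs hq.le
        have h3 : 0 ≤ s ^ (-(4 : ℝ) / 3) * (s * ∑ i, pderiv i w x ^ 2) := by positivity
        nlinarith
      have hH2 : ∑ i, ∑ j, pderiv i (pderiv j φ) x * pderiv i φ x * pderiv j φ x = 64 / 81 := by
        have hg : ∀ i, pderiv i φ x = 2 * deriv h s * x i := fun i => by
          rw [pderiv_radial hh]; ring
        have e1 : ∑ i, pderiv i φ x ^ 2 = 4 * deriv h s ^ 2 * s := by
          rw [← hss, Finset.mul_sum]
          exact Finset.sum_congr rfl fun i _ => by rw [hg, hss]; ring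
        have e2 : ∑ i, x i * pderiv i φ x = 2 * deriv h s * s := by
          rw [← hss, Finset.mul_sum]
          exact Finset.sum_congr rfl fun i _ => by rw [hg, hss]; ring
        rw [hessian_radial hh (fun i => pderiv i φ x), ← hsdef, e1, e2, hd1 s hs, hd2 s hs]
        rw [hp] at hp3 ⊢
        linear_combination 64 / 81 * hp3
      unfold carlemanForm
      rw [hH2]
      have hw2 : 0 ≤ w x ^ 2 := sq_nonneg _
      have hb : lap (lap φ) x ≤ τ ^ 2 := (hB x hxρ).trans hτB
      have h1 : τ * (lap (lap φ) x * w x ^ 2) ≤ τ * (τ ^ 2 * w x ^ 2) := by gcongr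
      have h2 : 0 ≤ τ ^ 3 * w x ^ 2 := by positivity
      have h3 : 0 ≤ 4 * τ * ∑ i, ∑ j, pderiv i (pderiv j φ) x * pderiv i w x * pderiv j w x := by
        positivity
      nlinarith
    · simp [carlemanForm, pderiv_eq_zero hx, image_eq_zero_of_notMem_tsupport hx]

end

section

variable {n : ℕ} {f g η v : EuclideanSpace ℝ (Fin n) → ℝ} {x : EuclideanSpace ℝ (Fin n)}

/-- Interior energy estimate (Caccioppoli inequality). -/
theorem integral_mul_gradSq_le (hf : ContDiff ℝ ∞ f) (hη : ContDiff ℝ ∞ η)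
    (hc : HasCompactSupport η) (hη0 : ∀ x, 0 ≤ η x) :
    ∫ x, η x * gradSq f x ≤ ∫ x, (|lap η x| * f x ^ 2 + η x * (f x ^ 2 + lap f x ^ 2)) := by
  have hf0 := hf.continuous
  have hη1 := hη.continuous
  set F : Fin n → EuclideanSpace ℝ (Fin n) → ℝ :=
    fun i x => η x * (f x * pderiv i f x) - f x * f x * (1 / 2 * pderiv i η x) with hFdef
  have hF : ∀ i, ContDiff ℝ ∞ (F i) := fun i => by fun_prop
  have hFc : ∀ i, HasCompactSupport (F i) := fun i => HasCompactSupport.intro hc fun x hx => by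
    simp [hFdef, pderiv_eq_zero hx, image_eq_zero_of_notMem_tsupport hx]
  have hdiv := integral_div_eq_zero hF hFc
  have hi1 : Integrable fun x => ∑ i, pderiv i (F i) x :=
    integrable_finsetSum _ fun i _ =>
      (continuous_pderiv (hF i) i).integrable_of_hasCompactSupport
        (hasCompactSupport_pderiv (hFc i) i)
  have hpt : ∀ x, ∑ i, pderiv i (F i) x =
      η x * gradSq f x + η x * (f x * lap f x) - 1 / 2 * (f x ^ 2 * lap η x) := by
    intro x
    simp only [gradSq, lap, Finset.mul_sum, ← Finset.sum_add_distrib, ← Finset.sum_sub_distrib]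
    refine Finset.sum_congr rfl fun i _ => ?_
    refine pderiv_eq_of_hasDerivAt (hF i) ?_
    have d0 := hasDerivAt_pderiv hf i x
    have d1 := hasDerivAt_pderiv (contDiff_pderiv hf i) i x
    have e0 := hasDerivAt_pderiv hη i x
    have e1 := hasDerivAt_pderiv (contDiff_pderiv hη i) i x
    have := (e0.fun_mul (d0.fun_mul d1)).fun_sub ((d0.fun_mul d0).fun_mul (e1.const_mul (1 / 2)))
    refine this.congr_deriv ?_
    simp only [zero_smul, add_zero]
    ring
  rw [← sub_zero (∫ x, η x * gradSq f x), ← hdiv, ← integral_sub _ hi1]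
  · refine integral_mono (Integrable.sub ?_ hi1) ?_ fun x => ?_
    · exact integrable_of_eq_zero (by fun_prop) hc fun x hx => by
        simp [image_eq_zero_of_notMem_tsupport hx]
    · exact integrable_of_eq_zero (by fun_prop) hc fun x hx => by
        simp [image_eq_zero_of_notMem_tsupport hx, lap_eq_zero hx]
    · simp only [hpt]
      have h1 := neg_abs_le (lap η x)
      have h1' := le_abs_self (lap η x)
      have h2 : 0 ≤ f x ^ 2 := sq_nonneg _
      have h3 : f x ^ 2 * lap η x ≤ |lap η x| * f x ^ 2 := by nlinarith
      have h4 : 0 ≤ |lap η x| * f x ^ 2 := by positivity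
      have h5 : -(f x * lap f x) ≤ f x ^ 2 + lap f x ^ 2 := by nlinarith [sq_nonneg (f x + lap f x)]
      nlinarith [mul_le_mul_of_nonneg_left h5 (hη0 x)]
  · exact integrable_of_eq_zero (by fun_prop) hc fun x hx => by
      simp [image_eq_zero_of_notMem_tsupport hx]

theorem pderiv_comp_smul (hf : ContDiff ℝ ∞ f) (c : ℝ) (i : Fin n) :
    pderiv i (fun x => f (c • x)) = fun x => c * pderiv i f (c • x) := by
  funext x
  simp only [pderiv]
  have h : HasFDerivAt (fun x => f (c • x))
      ((fderiv ℝ f (c • x)).comp (c • ContinuousLinearMap.id ℝ (EuclideanSpace ℝ (Fin n)))) x :=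
    ((hf.differentiable (by simp)) (c • x)).hasFDerivAt.comp x ((hasFDerivAt_id x).const_smul c)
  rw [h.fderiv]
  simp

theorem pderiv_const_mul (hf : ContDiff ℝ ∞ f) (c : ℝ) (i : Fin n) :
    pderiv i (fun x => c * f x) = fun x => c * pderiv i f x := by
  funext x
  exact pderiv_eq_of_hasDerivAt (by fun_prop) ((hasDerivAt_pderiv hf i x).const_mul c)

theorem lap_comp_smul (hf : ContDiff ℝ ∞ f) (c : ℝ) (x : EuclideanSpace ℝ (Fin n)) :
    lap (fun x => f (c • x)) x = c ^ 2 * lap f (c • x) := by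
  simp only [lap, Finset.mul_sum]
  refine Finset.sum_congr rfl fun i _ => ?_
  have h1 : ContDiff ℝ ∞ fun x => pderiv i f (c • x) :=
    (contDiff_pderiv hf i).comp (contDiff_const_smul c)
  rw [pderiv_comp_smul hf, pderiv_const_mul h1, pderiv_comp_smul (contDiff_pderiv hf i)]
  ring

theorem gradSq_comp_smul (hf : ContDiff ℝ ∞ f) (c : ℝ) (x : EuclideanSpace ℝ (Fin n)) :
    gradSq (fun x => f (c • x)) x = c ^ 2 * gradSq f (c • x) := by
  simp only [gradSq, Finset.mul_sum, pderiv_comp_smul hf]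
  exact Finset.sum_congr rfl fun i _ => by ring

theorem lap_mul_sq_le (hf : ContDiff ℝ ∞ f) (hg : ContDiff ℝ ∞ g) (x : EuclideanSpace ℝ (Fin n)) :
    lap (fun y => f y * g y) x ^ 2 ≤
      3 * (f x ^ 2 * lap g x ^ 2) + 12 * (gradSq f x * gradSq g x) + 3 * (lap f x ^ 2 * g x ^ 2) := by
  rw [lap_mul hf hg]
  have hcs := Finset.sum_mul_sq_le_sq_mul_sq Finset.univ (fun i => pderiv i f x) fun i => pderiv i g x
  change _ ≤ gradSq f x * gradSq g x at hcs
  set P := ∑ i, pderiv i f x * pderiv i g x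
  nlinarith [sq_nonneg (lap f x * g x - 2 * P), sq_nonneg (f x * lap g x - 2 * P),
    sq_nonneg (lap f x * g x - f x * lap g x)]

theorem gradSq_eq_zero_of_eventually_const {c : ℝ} (h : ∀ᶠ y in 𝓝 x, f y = c) :
    gradSq f x = 0 := by
  rw [gradSq_congr (g := fun _ => c) h]
  simp [gradSq, pderiv]

theorem lap_eq_zero_of_eventually_const {c : ℝ} (h : ∀ᶠ y in 𝓝 x, f y = c) :
    lap f x = 0 := by
  rw [lap_congr (g := fun _ => c) h]
  have : ∀ i : Fin n, pderiv i (fun _ : EuclideanSpace ℝ (Fin n) => c) = fun _ => 0 := fun i => by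
    funext y; simp [pderiv]
  simp only [lap, this]
  simp [pderiv]

/-- A smooth cutoff that is `1` on the annulus `b ≤ |x| ≤ c` and `0` off `a < |x| < d`. -/
theorem exists_annular_cutoff (n : ℕ) {a b c d : ℝ} (ha : 0 < a) (hab : a < b) (hbc : b ≤ c)
    (hcd : c < d) :
    ∃ η : EuclideanSpace ℝ (Fin n) → ℝ, ContDiff ℝ ∞ η ∧ HasCompactSupport η ∧
      (∀ x, 0 ≤ η x ∧ η x ≤ 1) ∧ (∀ x, b ≤ ‖x‖ → ‖x‖ ≤ c → η x = 1) ∧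
      ∀ x, ‖x‖ < a → η x = 0 ∧ lap η x = 0 := by
  let p : ContDiffBump (0 : EuclideanSpace ℝ (Fin n)) := ⟨a, b, ha, hab⟩
  let q : ContDiffBump (0 : EuclideanSpace ℝ (Fin n)) :=
    ⟨c, d, ha.trans (hab.trans_le hbc), hcd⟩
  have hq1 : ∀ x, ‖x‖ ≤ c → q x = 1 := fun x hx => q.one_of_mem_closedBall (by simpa using hx)
  have hp1 : ∀ x, ‖x‖ ≤ a → p x = 1 := fun x hx => p.one_of_mem_closedBall (by simpa using hx)
  have hp0 : ∀ x, b ≤ ‖x‖ → p x = 0 := fun x hx => p.zero_of_le_dist (by simpa using hx)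
  have hin : ∀ x, ‖x‖ < a → q x - p x = 0 := fun x hx => by
    rw [hq1 x (hx.le.trans (hab.le.trans hbc)), hp1 x hx.le, sub_self]
  refine ⟨fun x => q x - p x, q.contDiff.sub p.contDiff,
    q.hasCompactSupport.sub p.hasCompactSupport, fun x => ⟨?_, ?_⟩, fun x hx hx' => ?_,
    fun x hx => ⟨hin x hx, ?_⟩⟩
  · change 0 ≤ q x - p x
    rcases le_total ‖x‖ c with h | h
    · rw [hq1 x h]; linarith [p.le_one (x := x)]
    · rw [hp0 x (hbc.trans h)]; linarith [q.nonneg (x := x)]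
  · change q x - p x ≤ 1
    linarith [p.nonneg (x := x), q.le_one (x := x)]
  · change q x - p x = 1
    rw [hq1 x hx', hp0 x hx, sub_zero]
  · refine lap_eq_zero_of_eventually_const (c := 0) ?_
    filter_upwards [(continuous_norm.tendsto x).eventually (gt_mem_nhds hx)] with y hy using hin y hy

/-- The exponential weight `exp (2 τ |x| ^ (4/3))`. -/
noncomputable def weight (τ : ℝ) (x : EuclideanSpace ℝ (Fin n)) : ℝ :=
  exp (2 * τ * ‖x‖ ^ ((4 : ℝ) / 3))

theorem weight_pos (τ : ℝ) (x : EuclideanSpace ℝ (Fin n)) : 0 < weight τ x := exp_pos _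

@[fun_prop]
theorem continuous_weight (τ : ℝ) : Continuous (weight τ : EuclideanSpace ℝ (Fin n) → ℝ) := by
  unfold weight
  have : Continuous fun x : EuclideanSpace ℝ (Fin n) => ‖x‖ ^ ((4 : ℝ) / 3) :=
    continuous_norm.rpow_const fun _ => Or.inr (by norm_num)
  fun_prop

theorem exists_bound_of_hasCompactSupport (hf : Continuous f) (hg : HasCompactSupport g)
    (h : ∀ x, x ∉ tsupport g → f x = 0) : ∃ C, 0 ≤ C ∧ ∀ x, |f x| ≤ C := by
  obtain ⟨C, hC⟩ := (HasCompactSupport.intro hg h).exists_bound_of_continuous hf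
  exact ⟨C, (norm_nonneg _).trans (hC 0), hC⟩

/-- The Carleman inequality for smooth functions that decay, together with their Laplacians,
faster than every exponential weight. -/
theorem carleman_inequality_of_integrable (n : ℕ) {ρ : ℝ} (hρ : 0 < ρ) :
    ∃ τ₀ : ℝ, 1 ≤ τ₀ ∧ ∀ τ, τ₀ ≤ τ → ∀ v : EuclideanSpace ℝ (Fin n) → ℝ, ContDiff ℝ ∞ v →
      tsupport v ⊆ {x | ρ < ‖x‖} →
      (∀ σ, 0 < σ → Integrable fun x => v x ^ 2 * weight σ x) →
      (∀ σ, 0 < σ → Integrable fun x => lap v x ^ 2 * weight σ x) →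
      τ ^ 3 * ∫ x, v x ^ 2 * weight τ x ≤ 3 * ∫ x, lap v x ^ 2 * weight τ x := by
  obtain ⟨τ₀, hτ₀, hcarl⟩ := carleman_inequality n hρ
  refine ⟨τ₀, hτ₀, fun τ hτ v hv hsupp hiv hil => ?_⟩
  have hτ0 : 0 < τ := by linarith
  have hv0 := hv.continuous
  let β : ContDiffBump (0 : EuclideanSpace ℝ (Fin n)) := ⟨1, 2, one_pos, one_lt_two⟩
  have hβ : ContDiff ℝ ∞ β := β.contDiff
  obtain ⟨η, hη, hηc, hη01, hη1, hη0⟩ :=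
    exists_annular_cutoff n (a := 1 / 2) (b := 1) (c := 2) (d := 3)
      (by norm_num) (by norm_num) (by norm_num) (by norm_num)
  obtain ⟨C₁, hC₁, hgβ⟩ := exists_bound_of_hasCompactSupport (f := gradSq β) (by fun_prop)
    β.hasCompactSupport fun x hx => gradSq_eq_zero hx
  obtain ⟨C₂, hC₂, hlβ⟩ := exists_bound_of_hasCompactSupport (f := lap β) (by fun_prop)
    β.hasCompactSupport fun x hx => lap_eq_zero hx
  obtain ⟨C₃, hC₃, hlη⟩ := exists_bound_of_hasCompactSupport (f := lap η) (by fun_prop)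
    hηc fun x hx => lap_eq_zero hx
  have hgβsupp : ∀ x, gradSq β x ≠ 0 → 1 ≤ ‖x‖ ∧ ‖x‖ ≤ 2 := by
    intro x hx
    constructor
    · by_contra! h
      refine hx (gradSq_eq_zero_of_eventually_const (c := 1) ?_)
      filter_upwards [(continuous_norm.tendsto x).eventually (gt_mem_nhds h)] with y hy
      exact β.one_of_mem_closedBall (by simpa using hy.le)
    · by_contra! h
      refine hx (gradSq_eq_zero_of_eventually_const (c := 0) ?_)
      filter_upwards [(continuous_norm.tendsto x).eventually (lt_mem_nhds h)] with y hy
      exact β.zero_of_le_dist (by simpa using hy.le)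
  set D : ℝ := 12 * C₁ * ((C₃ + 1) * ∫ x, (v x ^ 2 + lap v x ^ 2) * weight (16 * τ) x)
    + 3 * C₂ ^ 2 * ∫ x, v x ^ 2 * weight τ x with hD
  have hD16 : Integrable fun x => (v x ^ 2 + lap v x ^ 2) * weight (16 * τ) x := by
    simp only [add_mul]
    exact (hiv _ (by positivity)).add (hil _ (by positivity))
  have hmain : ∀ R : ℝ, 1 ≤ R → τ ^ 3 * ∫ x, (β (R⁻¹ • x) * v x) ^ 2 * weight τ x ≤
      3 * (∫ x, lap v x ^ 2 * weight τ x) + R⁻¹ ^ 2 * D := by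
    intro R hR
    have hR0 : 0 < R := by linarith
    have hRi : R⁻¹ ≤ 1 := inv_le_one_of_one_le₀ hR
    have hRi0 : 0 < R⁻¹ := inv_pos.2 hR0
    have hRi2 : R⁻¹ ^ 2 ≤ 1 := pow_le_one₀ hRi0.le hRi
    have hnorm : ∀ x : EuclideanSpace ℝ (Fin n), ‖R⁻¹ • x‖ = ‖x‖ / R := fun x => by
      rw [norm_smul, norm_inv, Real.norm_of_nonneg hR0.le]; ring
    set βR : EuclideanSpace ℝ (Fin n) → ℝ := fun x => β (R⁻¹ • x) with hβRdef
    set ηR : EuclideanSpace ℝ (Fin n) → ℝ := fun x => η (R⁻¹ • x) with hηRdef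
    have hβR : ContDiff ℝ ∞ βR := hβ.comp (contDiff_const_smul _)
    have hηR : ContDiff ℝ ∞ ηR := hη.comp (contDiff_const_smul _)
    have hβRc : HasCompactSupport βR := β.hasCompactSupport.comp_smul hRi0.ne'
    have hηRc : HasCompactSupport ηR := hηc.comp_smul hRi0.ne'
    have hβR0 := hβR.continuous
    have hηR0 := hηR.continuous
    set K := exp (2 * τ * (2 * R) ^ ((4 : ℝ) / 3)) with hK
    have hgr : ∀ x, gradSq βR x * weight τ x ≤ R⁻¹ ^ 2 * C₁ * (K * ηR x) := by
      intro x
      rw [gradSq_comp_smul hβ]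
      by_cases h0 : gradSq β (R⁻¹ • x) = 0
      · rw [h0, mul_zero, zero_mul]
        have := (hη01 (R⁻¹ • x)).1
        positivity
      · obtain ⟨h1, h2⟩ := hgβsupp _ h0
        rw [hηRdef]; simp only
        rw [hη1 _ h1 h2, mul_one]
        rw [hnorm, div_le_iff₀ hR0] at h2
        refine mul_le_mul ?_ ?_ (weight_pos _ _).le (by positivity)
        · exact mul_le_mul_of_nonneg_left ((le_abs_self _).trans (hgβ _)) (by positivity)
        · unfold weight
          rw [hK]; gcongr
    have hKw : ∀ x : EuclideanSpace ℝ (Fin n), R / 2 ≤ ‖x‖ → K ≤ weight (16 * τ) x := by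
      intro x hx
      rw [hK]; unfold weight
      rw [exp_le_exp]
      have h4 : (4 : ℝ) ^ ((4 : ℝ) / 3) ≤ 16 := by
        calc (4 : ℝ) ^ ((4 : ℝ) / 3) ≤ (4 : ℝ) ^ (2 : ℝ) :=
              rpow_le_rpow_of_exponent_le (by norm_num) (by norm_num)
          _ = 16 := by norm_num
      have h2 : 2 * R ≤ 4 * ‖x‖ := by linarith
      calc 2 * τ * (2 * R) ^ ((4 : ℝ) / 3) ≤ 2 * τ * (4 * ‖x‖) ^ ((4 : ℝ) / 3) :=
            mul_le_mul_of_nonneg_left (rpow_le_rpow (by positivity) h2 (by norm_num))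
              (by positivity)
        _ = 2 * τ * ((4 : ℝ) ^ ((4 : ℝ) / 3) * ‖x‖ ^ ((4 : ℝ) / 3)) := by
            rw [mul_rpow (by norm_num) (norm_nonneg _)]
        _ ≤ 2 * τ * (16 * ‖x‖ ^ ((4 : ℝ) / 3)) := by gcongr
        _ = 2 * (16 * τ) * ‖x‖ ^ ((4 : ℝ) / 3) := by ring
    have hcac : K * ∫ x, ηR x * gradSq v x ≤
        (C₃ + 1) * ∫ x, (v x ^ 2 + lap v x ^ 2) * weight (16 * τ) x := by
      refine (mul_le_mul_of_nonneg_left (integral_mul_gradSq_le hv hηR hηRc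
        fun x => (hη01 _).1) (exp_pos _).le).trans ?_
      rw [← integral_const_mul, ← integral_const_mul]
      refine integral_mono (Integrable.const_mul (integrable_of_eq_zero (by fun_prop) hηRc
        fun x hx => ?_) _) (hD16.const_mul _) fun x => ?_
      · simp [image_eq_zero_of_notMem_tsupport hx, lap_eq_zero hx]
      · simp only
        have hs : 0 ≤ v x ^ 2 + lap v x ^ 2 := by positivity
        have hlapη : lap ηR x = R⁻¹ ^ 2 * lap η (R⁻¹ • x) := lap_comp_smul hη _ _
        have hW := weight_pos (16 * τ) x
        rcases lt_or_ge ‖x‖ (R / 2) with hx | hx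
        · obtain ⟨e1, e2⟩ := hη0 (R⁻¹ • x) (by rw [hnorm, div_lt_iff₀ hR0]; linarith)
          rw [hlapη, e2, hηRdef]; simp only [e1]
          simp
          positivity
        · have h1 : |lap ηR x| ≤ C₃ := by
            rw [hlapη, abs_mul, abs_of_nonneg (by positivity)]
            calc R⁻¹ ^ 2 * |lap η (R⁻¹ • x)| ≤ 1 * C₃ := by gcongr; exact hlη _
              _ = C₃ := one_mul _
          have h2 : ηR x ≤ 1 := (hη01 _).2
          have h3 := hKw x hx
          have hK0 : 0 ≤ K := (exp_pos _).le
          calc K * (|lap ηR x| * v x ^ 2 + ηR x * (v x ^ 2 + lap v x ^ 2))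
              ≤ K * (C₃ * (v x ^ 2 + lap v x ^ 2) + 1 * (v x ^ 2 + lap v x ^ 2)) := by
                gcongr
                nlinarith [sq_nonneg (lap v x)]
            _ = (C₃ + 1) * ((v x ^ 2 + lap v x ^ 2) * K) := by ring
            _ ≤ _ := by gcongr
    have hiη : Integrable fun x => ηR x * gradSq v x :=
      integrable_of_eq_zero (by fun_prop) hηRc fun x hx => by
        simp [image_eq_zero_of_notMem_tsupport hx]
    have hprod : ContDiff ℝ ∞ fun x => βR x * v x := hβR.mul hv
    refine (hcarl τ hτ (fun x => βR x * v x) hprod hβRc.mul_right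
      ((tsupport_mul_subset_right).trans hsupp)).trans ?_
    have hb : ∀ x, lap (fun x => βR x * v x) x ^ 2 * weight τ x ≤
        3 * (lap v x ^ 2 * weight τ x) + 12 * R⁻¹ ^ 2 * C₁ * K * (ηR x * gradSq v x)
          + 3 * R⁻¹ ^ 2 * C₂ ^ 2 * (v x ^ 2 * weight τ x) := by
      intro x
      have hW := weight_pos τ x
      have h1 := mul_le_mul_of_nonneg_right (lap_mul_sq_le hβR hv x) hW.le
      have h2 : βR x ^ 2 ≤ 1 := pow_le_one₀ β.nonneg β.le_one
      have h3 : lap βR x ^ 2 ≤ R⁻¹ ^ 2 * C₂ ^ 2 := by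
        have e : lap βR x = R⁻¹ ^ 2 * lap β (R⁻¹ • x) := lap_comp_smul hβ _ _
        have e2 : lap β (R⁻¹ • x) ^ 2 ≤ C₂ ^ 2 := sq_le_sq' (abs_le.1 (hlβ _)).1 (abs_le.1 (hlβ _)).2
        rw [e, mul_pow]
        calc (R⁻¹ ^ 2) ^ 2 * lap β (R⁻¹ • x) ^ 2 ≤ R⁻¹ ^ 2 * C₂ ^ 2 := by
              gcongr
              nlinarith [sq_nonneg R⁻¹]
          _ = _ := rfl
      have h4 := mul_le_mul_of_nonneg_right (hgr x) (gradSq_nonneg (f := v) (x := x))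
      have h5 := mul_le_mul_of_nonneg_right h2 (mul_nonneg (sq_nonneg (lap v x)) hW.le)
      have h6 := mul_le_mul_of_nonneg_right h3 (mul_nonneg (sq_nonneg (v x)) hW.le)
      nlinarith
    have hint := ((hil τ hτ0).const_mul 3).add (hiη.const_mul (12 * R⁻¹ ^ 2 * C₁ * K))
    refine (integral_mono_of_nonneg (.of_forall fun x => ?_) (hint.add
      ((hiv τ hτ0).const_mul (3 * R⁻¹ ^ 2 * C₂ ^ 2))) (.of_forall hb)).trans ?_
    · exact mul_nonneg (sq_nonneg _) (weight_pos _ _).le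
    · rw [integral_add' hint ((hiv τ hτ0).const_mul _), integral_add' ((hil τ hτ0).const_mul 3)
        (hiη.const_mul _), integral_const_mul, integral_const_mul, integral_const_mul, hD]
      have := mul_le_mul_of_nonneg_left hcac (show 0 ≤ 12 * R⁻¹ ^ 2 * C₁ by positivity)
      nlinarith
  have hR : Filter.Tendsto (fun k : ℕ => ((k : ℝ) + 1)⁻¹) Filter.atTop (𝓝 0) := by
    simpa using tendsto_one_div_add_atTop_nhds_zero_nat (𝕜 := ℝ)
  have hlhs : Filter.Tendsto (fun k : ℕ => ∫ x, (β (((k : ℝ) + 1)⁻¹ • x) * v x) ^ 2 * weight τ x)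
      Filter.atTop (𝓝 (∫ x, v x ^ 2 * weight τ x)) := by
    refine tendsto_integral_of_dominated_convergence (fun x => v x ^ 2 * weight τ x)
      (fun k => ?_) (hiv τ hτ0) (fun k => .of_forall fun x => ?_) (.of_forall fun x => ?_)
    · have hc : Continuous β := β.continuous
      exact Continuous.aestronglyMeasurable (by fun_prop)
    · have h2 : β (((k : ℝ) + 1)⁻¹ • x) ^ 2 ≤ 1 := pow_le_one₀ β.nonneg β.le_one
      have hW := weight_pos τ x
      rw [Real.norm_of_nonneg (by positivity), mul_pow, mul_assoc]
      exact mul_le_of_le_one_left (by positivity) h2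
    · have h1 : Filter.Tendsto (fun k : ℕ => β (((k : ℝ) + 1)⁻¹ • x)) Filter.atTop (𝓝 1) := by
        have h0 : β (0 : EuclideanSpace ℝ (Fin n)) = 1 := β.one_of_mem_closedBall (by simp [β])
        have hc : Continuous β := β.continuous
        have := (hc.tendsto _).comp (hR.smul_const x)
        rw [zero_smul, h0] at this
        exact this
      simpa using ((h1.mul_const (v x)).pow 2).mul_const (weight τ x)
  have hrhs : Filter.Tendsto (fun k : ℕ => 3 * (∫ x, lap v x ^ 2 * weight τ x)
      + ((k : ℝ) + 1)⁻¹ ^ 2 * D) Filter.atTop (𝓝 (3 * ∫ x, lap v x ^ 2 * weight τ x)) := by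
    simpa using ((hR.pow 2).mul_const D).const_add (3 * ∫ x, lap v x ^ 2 * weight τ x)
  exact le_of_tendsto_of_tendsto' (hlhs.const_mul _) hrhs fun k => hmain _ (by
    have := k.cast_nonneg (α := ℝ); linarith)

end

section

variable {n : ℕ} {f g η v : EuclideanSpace ℝ (Fin n) → ℝ} {x : EuclideanSpace ℝ (Fin n)}

theorem one_le_weight {σ : ℝ} (hσ : 0 ≤ σ) (x : EuclideanSpace ℝ (Fin n)) : 1 ≤ weight σ x :=
  one_le_exp (by positivity)

theorem integrable_sq_of_weight (hf : AEStronglyMeasurable f)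
    (h : Integrable fun x => f x ^ 2 * weight 1 x) : Integrable fun x => f x ^ 2 :=
  h.mono' (hf.pow 2) <| .of_forall fun x => by
    rw [Real.norm_of_nonneg (sq_nonneg _)]
    exact le_mul_of_one_le_right (sq_nonneg _) (one_le_weight zero_le_one x)

theorem weight_le {τ r : ℝ} (hτ : 0 ≤ τ) (hx : ‖x‖ ≤ r) :
    weight τ x ≤ exp (2 * τ * r ^ ((4 : ℝ) / 3)) := by
  unfold weight
  gcongr

/-- Carleman estimate outside a ball, with the inner boundary terms absorbed into a constant
independent of the function and of the parameter. -/
theorem exterior_carleman_inequality (n : ℕ) {ρ₁ ρ₂ : ℝ} (hρ : 0 < ρ₁) (h12 : ρ₁ < ρ₂) :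
    ∃ τ₀ C : ℝ, 1 ≤ τ₀ ∧ 0 ≤ C ∧ ∀ τ, τ₀ ≤ τ → ∀ f G : EuclideanSpace ℝ (Fin n) → ℝ,
      ContDiff ℝ ∞ f → Continuous G → (∀ x, ρ₁ < ‖x‖ → lap f x = G x) →
      (∀ σ, 0 < σ → Integrable fun x => f x ^ 2 * weight σ x) →
      (∀ σ, 0 < σ → Integrable fun x => G x ^ 2 * weight σ x) →
      τ ^ 3 * ∫ x in {x | ρ₂ ≤ ‖x‖}, f x ^ 2 * weight τ x ≤
        9 * (∫ x in {x | ρ₂ ≤ ‖x‖}, G x ^ 2 * weight τ x)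
          + C * exp (2 * τ * ρ₂ ^ ((4 : ℝ) / 3)) * ((∫ x, f x ^ 2) + ∫ x, G x ^ 2) := by
  obtain ⟨τ₀, hτ₀, hcarl⟩ := carleman_inequality_of_integrable n hρ
  obtain ⟨a, ha1, ha2⟩ := exists_between h12
  obtain ⟨b, hab, hb2⟩ := exists_between ha2
  have ha0 : 0 < a := hρ.trans ha1
  have hb0 : 0 < b := ha0.trans hab
  let β : ContDiffBump (0 : EuclideanSpace ℝ (Fin n)) := ⟨b, ρ₂, hb0, hb2⟩
  have hβ : ContDiff ℝ ∞ β := β.contDiff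
  have hβin : ∀ x, ‖x‖ ≤ b → β x = 1 := fun x hx => β.one_of_mem_closedBall (by simpa using hx)
  have hβout : ∀ x, ρ₂ ≤ ‖x‖ → β x = 0 := fun x hx => β.zero_of_le_dist (by simpa using hx)
  set α : EuclideanSpace ℝ (Fin n) → ℝ := fun x => 1 - β x with hαdef
  have hα : ContDiff ℝ ∞ α := contDiff_const.sub hβ
  have hα0 : ∀ x, ‖x‖ ≤ b → α x = 0 := fun x hx => by simp [hαdef, hβin x hx]
  have hα1 : ∀ x, ρ₂ ≤ ‖x‖ → α x = 1 := fun x hx => by simp [hαdef, hβout x hx]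
  have hαI : ∀ x, 0 ≤ α x ∧ α x ≤ 1 := fun x =>
    ⟨sub_nonneg.2 β.le_one, sub_le_self _ β.nonneg⟩
  have hαsq : ∀ x, α x ^ 2 ≤ 1 := fun x => pow_le_one₀ (hαI x).1 (hαI x).2
  have hαconst : ∀ x, x ∉ tsupport β → ∀ᶠ y in 𝓝 x, α y = 1 := fun x hx => by
    filter_upwards [(isClosed_tsupport β).isOpen_compl.mem_nhds hx] with y hy
    simp [hαdef, image_eq_zero_of_notMem_tsupport hy]
  have hβts : tsupport β = Metric.closedBall 0 ρ₂ := β.tsupport_eq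
  obtain ⟨C₁, hC₁, hgα⟩ := exists_bound_of_hasCompactSupport (f := gradSq α) (by fun_prop)
    β.hasCompactSupport fun x hx => gradSq_eq_zero_of_eventually_const (hαconst x hx)
  obtain ⟨C₂, hC₂, hlα⟩ := exists_bound_of_hasCompactSupport (f := lap α) (by fun_prop)
    β.hasCompactSupport fun x hx => lap_eq_zero_of_eventually_const (hαconst x hx)
  obtain ⟨η, hη, hηc, hη01, hη1, hη0⟩ :=
    exists_annular_cutoff n (a := a) (b := b) (c := ρ₂) (d := ρ₂ + 1) ha0 hab hb2.le (by linarith)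
  obtain ⟨C₃, hC₃, hlη⟩ := exists_bound_of_hasCompactSupport (f := lap η) (by fun_prop)
    hηc fun x hx => lap_eq_zero hx
  have hgα0 : ∀ x, ‖x‖ < b → gradSq α x = 0 := fun x hx => by
    refine gradSq_eq_zero_of_eventually_const (c := 0) ?_
    filter_upwards [(continuous_norm.tendsto x).eventually (gt_mem_nhds hx)] with y hy
    exact hα0 y hy.le
  refine ⟨τ₀, 3 * (3 + 12 * C₁ * (C₃ + 1) + 3 * C₂ ^ 2), hτ₀, by positivity,
    fun τ hτ f G hf hG hfG hif hiG => ?_⟩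
  have hf0 := hf.continuous
  have hα0' := hα.continuous
  have hη0' := hη.continuous
  have hτ0 : 0 < τ := by linarith
  have hif2 := integrable_sq_of_weight hf0.aestronglyMeasurable (hif 1 one_pos)
  have hiG2 := integrable_sq_of_weight hG.aestronglyMeasurable (hiG 1 one_pos)
  have hS : MeasurableSet {x : EuclideanSpace ℝ (Fin n) | ρ₂ ≤ ‖x‖} :=
    (isClosed_le continuous_const continuous_norm).measurableSet
  have hiη : Integrable fun x => η x * gradSq f x :=
    integrable_of_eq_zero (by fun_prop) hηc fun x hx => by
      simp [image_eq_zero_of_notMem_tsupport hx]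
  have hcac : ∫ x, η x * gradSq f x ≤ (C₃ + 1) * ((∫ x, f x ^ 2) + ∫ x, G x ^ 2) := by
    refine (integral_mul_gradSq_le hf hη hηc fun x => (hη01 x).1).trans ?_
    rw [← integral_add hif2 hiG2, ← integral_const_mul]
    refine integral_mono (integrable_of_eq_zero (by fun_prop) hηc fun x hx => ?_)
      ((hif2.add hiG2).const_mul _) fun x => ?_
    · simp [image_eq_zero_of_notMem_tsupport hx, lap_eq_zero hx]
    · simp only
      rcases lt_or_ge ‖x‖ a with hx | hx
      · obtain ⟨e1, e2⟩ := hη0 x hx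
        rw [e1, e2, abs_zero, zero_mul, zero_mul, add_zero]
        positivity
      · rw [hfG x (ha1.trans_le hx)]
        have h1 := mul_le_mul_of_nonneg_right (hlη x) (sq_nonneg (f x))
        have h2 := mul_le_mul_of_nonneg_right (hη01 x).2
          (add_nonneg (sq_nonneg (f x)) (sq_nonneg (G x)))
        nlinarith [mul_nonneg hC₃ (sq_nonneg (G x))]
  have hv : ContDiff ℝ ∞ fun x => α x * f x := hα.mul hf
  have hsupp : tsupport (fun x => α x * f x) ⊆ {x | ρ₁ < ‖x‖} := by
    refine (closure_minimal (t := {x | b ≤ ‖x‖}) (fun x hx => ?_)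
      (isClosed_le continuous_const continuous_norm)).trans
      fun x (hx : b ≤ ‖x‖) => (ha1.trans hab).trans_le hx
    by_contra! h
    simp only [Set.mem_ofPred_eq, not_le] at h
    exact hx (by simp [hα0 x h.le])
  have hvle : ∀ σ, ∀ x, (α x * f x) ^ 2 * weight σ x ≤ f x ^ 2 * weight σ x := fun σ x => by
    rw [mul_pow]
    exact mul_le_mul_of_nonneg_right (mul_le_of_le_one_left (sq_nonneg _) (hαsq x))
      (weight_pos _ _).le
  have hiv : ∀ σ, 0 < σ → Integrable fun x => (α x * f x) ^ 2 * weight σ x := fun σ hσ =>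
    (hif σ hσ).mono' (Continuous.aestronglyMeasurable (by fun_prop)) <| .of_forall fun x => by
      rw [Real.norm_of_nonneg (mul_nonneg (sq_nonneg _) (weight_pos _ _).le)]
      exact hvle σ x
  let B : ℝ → EuclideanSpace ℝ (Fin n) → ℝ := fun σ x =>
    3 * {x | ρ₂ ≤ ‖x‖}.indicator (fun x => G x ^ 2 * weight σ x) x
      + exp (2 * σ * ρ₂ ^ ((4 : ℝ) / 3)) *
        (3 * G x ^ 2 + 12 * C₁ * (η x * gradSq f x) + 3 * C₂ ^ 2 * f x ^ 2)
  have hi3 : Integrable fun x => 3 * G x ^ 2 + 12 * C₁ * (η x * gradSq f x) :=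
    (hiG2.const_mul _).add (hiη.const_mul _)
  have hi2 : Integrable fun x =>
      3 * G x ^ 2 + 12 * C₁ * (η x * gradSq f x) + 3 * C₂ ^ 2 * f x ^ 2 :=
    hi3.add (hif2.const_mul _)
  have hi1 : ∀ σ, 0 < σ → Integrable
      ({x | ρ₂ ≤ ‖x‖}.indicator fun x => G x ^ 2 * weight σ x) := fun σ hσ =>
    (hiG σ hσ).indicator hS
  have hB : ∀ σ, 0 < σ → Integrable (B σ) := fun σ hσ =>
    ((hi1 σ hσ).const_mul 3).add (hi2.const_mul _)
  have hle : ∀ σ, 0 < σ → ∀ x, lap (fun x => α x * f x) x ^ 2 * weight σ x ≤ B σ x := by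
    intro σ hσ x
    have hW := weight_pos σ x
    set K := exp (2 * σ * ρ₂ ^ ((4 : ℝ) / 3)) with hK
    have hK0 : 0 < K := exp_pos _
    have hg0 := gradSq_nonneg (f := f) (x := x)
    have h0 := mul_le_mul_of_nonneg_right (lap_mul_sq_le hα hf x) hW.le
    have hlf : α x ^ 2 * lap f x ^ 2 = α x ^ 2 * G x ^ 2 := by
      rcases le_or_gt ‖x‖ b with h | h
      · rw [hα0 x h]; ring
      · rw [hfG x ((ha1.trans hab).trans h)]
    rw [hlf] at h0
    have t1 : α x ^ 2 * G x ^ 2 * weight σ x ≤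
        {x | ρ₂ ≤ ‖x‖}.indicator (fun x => G x ^ 2 * weight σ x) x + K * G x ^ 2 := by
      rcases le_or_gt ρ₂ ‖x‖ with h | h
      · rw [Set.indicator_of_mem (show x ∈ {x | ρ₂ ≤ ‖x‖} from h), hα1 x h]
        have : 0 ≤ K * G x ^ 2 := by positivity
        linarith
      · rw [Set.indicator_of_notMem (show x ∉ {x | ρ₂ ≤ ‖x‖} from not_le.2 h), zero_add]
        calc α x ^ 2 * G x ^ 2 * weight σ x ≤ 1 * G x ^ 2 * K := by
              gcongr
              · exact hαsq x
              · exact weight_le hσ.le h.le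
          _ = K * G x ^ 2 := by ring
    have t2 : gradSq α x * gradSq f x * weight σ x ≤ K * (C₁ * (η x * gradSq f x)) := by
      by_cases h : gradSq α x = 0
      · rw [h, zero_mul, zero_mul]
        have := (hη01 x).1
        positivity
      · have hb : b ≤ ‖x‖ := by by_contra! hb; exact h (hgα0 x hb)
        have hr : ‖x‖ ≤ ρ₂ := by
          by_contra! hr
          refine h (gradSq_eq_zero_of_eventually_const (hαconst x ?_))
          rw [hβts]
          simpa using hr
        rw [hη1 x hb hr, one_mul]
        calc gradSq α x * gradSq f x * weight σ x ≤ C₁ * gradSq f x * K := by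
              gcongr
              · exact (le_abs_self _).trans (hgα x)
              · exact weight_le hσ.le hr
          _ = _ := by ring
    have t3 : lap α x ^ 2 * f x ^ 2 * weight σ x ≤ K * (C₂ ^ 2 * f x ^ 2) := by
      by_cases h : lap α x = 0
      · rw [h]; simp; positivity
      · have hr : ‖x‖ ≤ ρ₂ := by
          by_contra! hr
          refine h (lap_eq_zero_of_eventually_const (hαconst x ?_))
          rw [hβts]
          simpa using hr
        have e2 : lap α x ^ 2 ≤ C₂ ^ 2 := sq_le_sq' (abs_le.1 (hlα _)).1 (abs_le.1 (hlα _)).2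
        calc lap α x ^ 2 * f x ^ 2 * weight σ x ≤ C₂ ^ 2 * f x ^ 2 * K := by
              gcongr
              exact weight_le hσ.le hr
          _ = _ := by ring
    simp only [B]
    nlinarith
  have hil : ∀ σ, 0 < σ → Integrable fun x => lap (fun x => α x * f x) x ^ 2 * weight σ x :=
    fun σ hσ => (hB σ hσ).mono' (Continuous.aestronglyMeasurable (by fun_prop)) <|
      .of_forall fun x => by
        rw [Real.norm_of_nonneg (mul_nonneg (sq_nonneg _) (weight_pos _ _).le)]
        exact hle σ hσ x
  have hmain := hcarl τ hτ _ hv hsupp hiv hil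
  have hl : ∫ x in {x | ρ₂ ≤ ‖x‖}, f x ^ 2 * weight τ x ≤ ∫ x, (α x * f x) ^ 2 * weight τ x := by
    rw [← integral_indicator hS]
    refine integral_mono ((hif τ hτ0).indicator hS) (hiv τ hτ0) fun x => ?_
    refine Set.indicator_apply_le' (fun hx => ?_) fun _ =>
      mul_nonneg (sq_nonneg _) (weight_pos _ _).le
    rw [hα1 x hx, one_mul]
  have hr : ∫ x, lap (fun x => α x * f x) x ^ 2 * weight τ x ≤ ∫ x, B τ x :=
    integral_mono (hil τ hτ0) (hB τ hτ0) (hle τ hτ0)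
  have hBint : ∫ x, B τ x = 3 * (∫ x in {x | ρ₂ ≤ ‖x‖}, G x ^ 2 * weight τ x)
      + exp (2 * τ * ρ₂ ^ ((4 : ℝ) / 3)) * (3 * (∫ x, G x ^ 2)
        + 12 * C₁ * (∫ x, η x * gradSq f x) + 3 * C₂ ^ 2 * ∫ x, f x ^ 2) := by
    simp only [B]
    rw [integral_add ((hi1 τ hτ0).const_mul 3) (hi2.const_mul _), integral_const_mul,
      integral_const_mul, integral_indicator hS,
      integral_add hi3 (hif2.const_mul _),
      integral_add (hiG2.const_mul _) (hiη.const_mul _),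
      integral_const_mul, integral_const_mul, integral_const_mul]
  have hτ3 := mul_le_mul_of_nonneg_left hl (show 0 ≤ τ ^ 3 by positivity)
  have hFint : 0 ≤ ∫ x, f x ^ 2 := integral_nonneg fun x => sq_nonneg _
  have hGint : 0 ≤ ∫ x, G x ^ 2 := integral_nonneg fun x => sq_nonneg _
  refine hτ3.trans (hmain.trans ((mul_le_mul_of_nonneg_left hr (by norm_num)).trans ?_))
  rw [hBint]
  have hcac' := mul_le_mul_of_nonneg_left hcac (show 0 ≤ 12 * C₁ by positivity)
  have hC22 : 0 ≤ C₂ ^ 2 := sq_nonneg _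
  have hin : 3 * (∫ x, G x ^ 2) + 12 * C₁ * (∫ x, η x * gradSq f x) + 3 * C₂ ^ 2 * ∫ x, f x ^ 2 ≤
      (3 + 12 * C₁ * (C₃ + 1) + 3 * C₂ ^ 2) * ((∫ x, f x ^ 2) + ∫ x, G x ^ 2) := by
    nlinarith [mul_nonneg hC22 hGint]
  have := mul_le_mul_of_nonneg_left hin (exp_pos (2 * τ * ρ₂ ^ ((4 : ℝ) / 3))).le
  linarith

end

section

variable {n : ℕ} {a g f η v : EuclideanSpace ℝ (Fin n) → ℝ} {x : EuclideanSpace ℝ (Fin n)}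

section
open scoped Convolution
open ContinuousLinearMap

/-- The convolution of two real functions on `ℝⁿ`. -/
noncomputable def mollify (a η : EuclideanSpace ℝ (Fin n) → ℝ) (x : EuclideanSpace ℝ (Fin n)) : ℝ :=
  ∫ t, a t * η (x - t)

theorem mollify_eq_convolution : mollify a η = a ⋆[lsmul ℝ ℝ, volume] η := rfl

theorem contDiff_mollify (ha : LocallyIntegrable a) (hη : ContDiff ℝ ∞ η)
    (hc : HasCompactSupport η) : ContDiff ℝ ∞ (mollify a η) :=
  hc.contDiff_convolution_right (lsmul ℝ ℝ) ha hη

theorem pderiv_mollify (ha : LocallyIntegrable a) (hη : ContDiff ℝ ∞ η)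
    (hc : HasCompactSupport η) (i : Fin n) :
    pderiv i (mollify a η) = mollify a (pderiv i η) := by
  funext x
  have h := hc.hasFDerivAt_convolution_right (lsmul ℝ ℝ) ha (hη.of_le (by simp)) x
  rw [pderiv, mollify_eq_convolution, h.fderiv, convolution_precompR_apply _ ha (hc.fderiv ℝ)
    (hη.continuous_fderiv (by simp))]
  rfl

theorem lap_mollify (ha : LocallyIntegrable a) (hη : ContDiff ℝ ∞ η)
    (hc : HasCompactSupport η) (x : EuclideanSpace ℝ (Fin n)) :
    lap (mollify a η) x = ∫ t, a t * lap η (x - t) := by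
  simp only [lap, Finset.mul_sum]
  have hcd : ∀ i, HasCompactSupport (pderiv i (pderiv i η)) := fun i =>
    hasCompactSupport_pderiv (hasCompactSupport_pderiv hc i) i
  have hint : ∀ i, Integrable fun t => a t * pderiv i (pderiv i η) (x - t) := fun i =>
    (hcd i).convolutionExists_right (lsmul ℝ ℝ) ha (by fun_prop) x
  rw [integral_finsetSum _ fun i _ => hint i]
  refine Finset.sum_congr rfl fun i _ => ?_
  rw [pderiv_mollify ha hη hc, pderiv_mollify ha (contDiff_pderiv hη i)
    (hasCompactSupport_pderiv hc i)]
  rfl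

theorem pderiv_comp_sub (hf : ContDiff ℝ ∞ f) (x : EuclideanSpace ℝ (Fin n)) (i : Fin n) :
    pderiv i (fun t => f (x - t)) = fun t => -pderiv i f (x - t) := by
  funext t
  have h : HasFDerivAt (fun t => f (x - t))
      ((fderiv ℝ f (x - t)).comp (-ContinuousLinearMap.id ℝ (EuclideanSpace ℝ (Fin n)))) t :=
    ((hf.differentiable (by simp)) (x - t)).hasFDerivAt.comp t ((hasFDerivAt_id t).const_sub x)
  simp only [pderiv]
  rw [h.fderiv]
  simp

theorem lap_comp_sub (hf : ContDiff ℝ ∞ f) (x t : EuclideanSpace ℝ (Fin n)) :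
    lap (fun t => f (x - t)) t = lap f (x - t) := by
  simp only [lap]
  refine Finset.sum_congr rfl fun i _ => ?_
  have h1 : ContDiff ℝ ∞ fun t => pderiv i f (x - t) :=
    (contDiff_pderiv hf i).comp (contDiff_const.sub contDiff_id)
  have h2 : (fun t => -pderiv i f (x - t)) = fun t => (-1) * pderiv i f (x - t) := by
    funext t; ring
  rw [pderiv_comp_sub hf, h2, pderiv_const_mul h1, pderiv_comp_sub (contDiff_pderiv hf i)]
  ring

end

/-- Weighted `L²` bound for a convolution with a probability density supported in the ball of
radius `ε`. -/
theorem lintegral_mollify_sq_le {ε : ℝ} (ha : Measurable a) (hη : Continuous η)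
    (hη0 : ∀ x, 0 ≤ η x) (hηi : Integrable η) (hη1 : ∫ x, η x = 1)
    (hηs : ∀ x, η x ≠ 0 → ‖x‖ < ε) {W W' : EuclideanSpace ℝ (Fin n) → ℝ≥0∞} (hW : Measurable W)
    (hWW : ∀ x y, ‖x - y‖ < ε → W x ≤ W' y) :
    ∫⁻ x, ‖mollify a η x‖ₑ ^ 2 * W x ≤ ∫⁻ y, ‖a y‖ₑ ^ 2 * W' y := by
  have hηm : Measurable fun x => ‖η x‖ₑ := hη.measurable.enorm
  have ham : Measurable fun x => ‖a x‖ₑ := ha.enorm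
  have hη1' : ∫⁻ x, ‖η x‖ₑ = 1 := by
    have := ofReal_integral_norm_eq_lintegral_enorm hηi
    rw [← this]
    simp [Real.norm_of_nonneg (hη0 _), hη1]
  have hjensen : ∀ x, ‖mollify a η x‖ₑ ^ 2 ≤ ∫⁻ t, ‖a t‖ₑ ^ 2 * ‖η (x - t)‖ₑ := by
    intro x
    have hηx : Measurable fun t => ‖η (x - t)‖ₑ := hηm.comp (measurable_const.sub measurable_id)
    have h1 : ‖mollify a η x‖ₑ ≤ ∫⁻ t, ‖a t‖ₑ * ‖η (x - t)‖ₑ := by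
      refine (enorm_integral_le_lintegral_enorm _).trans_eq ?_
      simp only [enorm_mul]
    have h2 : ∫⁻ t, ‖a t‖ₑ * ‖η (x - t)‖ₑ ≤
        (∫⁻ t, ‖a t‖ₑ ^ 2 * ‖η (x - t)‖ₑ) ^ (1 / 2 : ℝ) * (∫⁻ t, ‖η (x - t)‖ₑ) ^ (1 / 2 : ℝ) := by
      refine le_trans (le_of_eq ?_) (ENNReal.lintegral_mul_norm_pow_le
        ((ham.pow_const 2).mul hηx).aemeasurable hηx.aemeasurable (p := 1 / 2) (q := 1 / 2)
        (by norm_num) (by norm_num) (by norm_num))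
      refine lintegral_congr fun t => ?_
      rw [Pi.mul_apply, ENNReal.mul_rpow_of_nonneg _ _ (by norm_num), mul_assoc,
        ← ENNReal.rpow_add_of_nonneg _ _ (by norm_num) (by norm_num), ← ENNReal.rpow_natCast,
        ← ENNReal.rpow_mul]
      norm_num
    have h3 : ∫⁻ t, ‖η (x - t)‖ₑ = 1 := by
      rw [lintegral_sub_left_eq_self (fun t => ‖η t‖ₑ) x, hη1']
    rw [h3, ENNReal.one_rpow, mul_one] at h2
    calc ‖mollify a η x‖ₑ ^ 2 ≤ ((∫⁻ t, ‖a t‖ₑ ^ 2 * ‖η (x - t)‖ₑ) ^ (1 / 2 : ℝ)) ^ 2 := by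
          gcongr; exact h1.trans h2
      _ = _ := by
          rw [← ENNReal.rpow_natCast, ← ENNReal.rpow_mul]
          norm_num
  calc ∫⁻ x, ‖mollify a η x‖ₑ ^ 2 * W x
      ≤ ∫⁻ x, ∫⁻ t, ‖a t‖ₑ ^ 2 * ‖η (x - t)‖ₑ * W x := by
        refine lintegral_mono fun x => ?_
        rw [lintegral_mul_const]
        · gcongr; exact hjensen x
        · exact (ham.pow_const 2).mul (hηm.comp (measurable_const.sub measurable_id))
    _ = ∫⁻ t, ∫⁻ x, ‖a t‖ₑ ^ 2 * ‖η (x - t)‖ₑ * W x := by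
        refine lintegral_lintegral_swap (Measurable.aemeasurable ?_)
        exact (((ham.comp measurable_snd).pow_const 2).mul
          (hηm.comp (measurable_fst.sub measurable_snd))).mul (hW.comp measurable_fst)
    _ ≤ ∫⁻ t, ∫⁻ x, ‖a t‖ₑ ^ 2 * W' t * ‖η (x - t)‖ₑ := by
        refine lintegral_mono fun t => lintegral_mono fun x => ?_
        by_cases h : η (x - t) = 0
        · simp [h]
        · rw [mul_right_comm]
          gcongr
          exact hWW x t (hηs _ h)
    _ = ∫⁻ t, ‖a t‖ₑ ^ 2 * W' t := by
        refine lintegral_congr fun t => ?_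
        have hηt : Measurable fun x => ‖η (x - t)‖ₑ := hηm.comp (measurable_id.sub_const t)
        rw [lintegral_const_mul _ hηt,
          lintegral_sub_right_eq_self (fun x => ‖η x‖ₑ) t, hη1', mul_one]

theorem integral_mollify_sq_le {ε : ℝ} (ha : Measurable a) (hη : Continuous η)
    (hη0 : ∀ x, 0 ≤ η x) (hηi : Integrable η) (hη1 : ∫ x, η x = 1)
    (hηs : ∀ x, η x ≠ 0 → ‖x‖ < ε) (hm : Continuous (mollify a η))
    {W W' : EuclideanSpace ℝ (Fin n) → ℝ} (hW : Measurable W) (hW0 : ∀ x, 0 ≤ W x)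
    (hW0' : ∀ x, 0 ≤ W' x) (hWW : ∀ x y, ‖x - y‖ < ε → W x ≤ W' y)
    (hi : Integrable fun x => a x ^ 2 * W' x) :
    Integrable (fun x => mollify a η x ^ 2 * W x) ∧
      ∫ x, mollify a η x ^ 2 * W x ≤ ∫ x, a x ^ 2 * W' x := by
  have hconv : ∀ {b V : EuclideanSpace ℝ (Fin n) → ℝ}, (∀ x, 0 ≤ V x) → ∀ x,
      ENNReal.ofReal (b x ^ 2 * V x) = ‖b x‖ₑ ^ 2 * ENNReal.ofReal (V x) := by
    intro b V hV x
    rw [ENNReal.ofReal_mul (sq_nonneg _), ← Real.norm_of_nonneg (sq_nonneg (b x)),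
      ofReal_norm, enorm_pow]
  have hle := lintegral_mollify_sq_le ha hη hη0 hηi hη1 hηs
    (W := fun x => ENNReal.ofReal (W x)) (W' := fun x => ENNReal.ofReal (W' x)) hW.ennreal_ofReal
    fun x y h => ENNReal.ofReal_le_ofReal (hWW x y h)
  simp only [← hconv hW0, ← hconv hW0'] at hle
  have hnn : ∀ x, 0 ≤ mollify a η x ^ 2 * W x := fun x => mul_nonneg (sq_nonneg _) (hW0 x)
  have hms : AEStronglyMeasurable fun x => mollify a η x ^ 2 * W x :=
    ((hm.measurable.pow_const 2).mul hW).aestronglyMeasurable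
  have hfin := (hasFiniteIntegral_iff_ofReal
    (.of_forall fun x => mul_nonneg (sq_nonneg (a x)) (hW0' x))).1 hi.2
  refine ⟨⟨hms, (hasFiniteIntegral_iff_ofReal (.of_forall hnn)).2 (hle.trans_lt hfin)⟩, ?_⟩
  rw [integral_eq_lintegral_of_nonneg_ae (.of_forall hnn) hms, integral_eq_lintegral_of_nonneg_ae
    (.of_forall fun x => mul_nonneg (sq_nonneg (a x)) (hW0' x)) hi.1]
  exact ENNReal.toReal_mono hfin.ne hle

/-- A form of Fatou's lemma for real integrals. -/
theorem integral_le_of_tendsto_ae {α : Type*} [MeasurableSpace α] {μ : Measure α} {F : ℕ → α → ℝ}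
    {F₀ : α → ℝ} {B : ℕ → ℝ} {b : ℝ} (hF0 : ∀ k x, 0 ≤ F k x) (hF : ∀ k, Integrable (F k) μ)
    (hF₀ : Integrable F₀ μ) (hlim : ∀ᵐ x ∂μ, Filter.Tendsto (fun k => F k x) Filter.atTop (𝓝 (F₀ x)))
    (hB : ∀ k, ∫ x, F k x ∂μ ≤ B k) (hb : Filter.Tendsto B Filter.atTop (𝓝 b)) :
    ∫ x, F₀ x ∂μ ≤ b := by
  have hF₀0 : 0 ≤ᵐ[μ] F₀ := by
    filter_upwards [hlim] with x hx using ge_of_tendsto' hx fun k => hF0 k x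
  have hb0 : 0 ≤ b := ge_of_tendsto' hb fun k => (integral_nonneg (hF0 k)).trans (hB k)
  rw [← ENNReal.ofReal_le_ofReal_iff hb0, ofReal_integral_eq_lintegral_ofReal hF₀ hF₀0]
  calc ∫⁻ x, ENNReal.ofReal (F₀ x) ∂μ
      = ∫⁻ x, Filter.liminf (fun k => ENNReal.ofReal (F k x)) Filter.atTop ∂μ := by
        refine lintegral_congr_ae ?_
        filter_upwards [hlim] with x hx
        exact ((ENNReal.continuous_ofReal.tendsto _).comp hx).liminf_eq.symm
    _ ≤ Filter.liminf (fun k => ∫⁻ x, ENNReal.ofReal (F k x) ∂μ) Filter.atTop :=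
        lintegral_liminf_le' fun k => (hF k).1.aemeasurable.ennreal_ofReal
    _ ≤ Filter.liminf (fun k => ENNReal.ofReal (B k)) Filter.atTop := by
        refine Filter.liminf_le_liminf (.of_forall fun k => ?_)
        rw [← ofReal_integral_eq_lintegral_ofReal (hF k) (.of_forall (hF0 k))]
        exact ENNReal.ofReal_le_ofReal (hB k)
    _ = ENNReal.ofReal b := ((ENNReal.continuous_ofReal.tendsto _).comp hb).liminf_eq

end

section

variable {n : ℕ} {a g f η v : EuclideanSpace ℝ (Fin n) → ℝ} {x : EuclideanSpace ℝ (Fin n)}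

theorem rpow_add_le {r ε : ℝ} (hr : 0 ≤ r) (hε0 : 0 ≤ ε) (hε : ε ≤ 1) :
    (r + ε) ^ ((4 : ℝ) / 3) ≤ 4 * r ^ ((4 : ℝ) / 3) + 4 := by
  have h2 : (2 : ℝ) ^ ((4 : ℝ) / 3) ≤ 4 := by
    calc (2 : ℝ) ^ ((4 : ℝ) / 3) ≤ (2 : ℝ) ^ (2 : ℝ) :=
          rpow_le_rpow_of_exponent_le (by norm_num) (by norm_num)
      _ = 4 := by norm_num
  have hr' : 0 ≤ r ^ ((4 : ℝ) / 3) := rpow_nonneg hr _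
  rcases le_total r 1 with h | h
  · calc (r + ε) ^ ((4 : ℝ) / 3) ≤ (2 : ℝ) ^ ((4 : ℝ) / 3) :=
          rpow_le_rpow (by positivity) (by linarith) (by norm_num)
      _ ≤ _ := by linarith
  · calc (r + ε) ^ ((4 : ℝ) / 3) ≤ (2 * r) ^ ((4 : ℝ) / 3) :=
          rpow_le_rpow (by positivity) (by linarith) (by norm_num)
      _ = 2 ^ ((4 : ℝ) / 3) * r ^ ((4 : ℝ) / 3) := mul_rpow (by norm_num) hr
      _ ≤ 4 * r ^ ((4 : ℝ) / 3) := by gcongr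
      _ ≤ _ := by linarith

/-- The upper envelope of `weight σ` at scale `ε`. -/
noncomputable def shiftedWeight (σ ε : ℝ) (x : EuclideanSpace ℝ (Fin n)) : ℝ :=
  exp (2 * σ * (‖x‖ + ε) ^ ((4 : ℝ) / 3))

theorem shiftedWeight_pos (σ ε : ℝ) (x : EuclideanSpace ℝ (Fin n)) : 0 < shiftedWeight σ ε x :=
  exp_pos _

@[fun_prop]
theorem continuous_shiftedWeight (σ ε : ℝ) :
    Continuous (shiftedWeight σ ε : EuclideanSpace ℝ (Fin n) → ℝ) := by
  unfold shiftedWeight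
  have : Continuous fun x : EuclideanSpace ℝ (Fin n) => (‖x‖ + ε) ^ ((4 : ℝ) / 3) :=
    (continuous_norm.add continuous_const).rpow_const fun _ => Or.inr (by norm_num)
  fun_prop

theorem shiftedWeight_le {σ ε : ℝ} (hσ : 0 ≤ σ) (hε0 : 0 ≤ ε) (hε : ε ≤ 1)
    (x : EuclideanSpace ℝ (Fin n)) :
    shiftedWeight σ ε x ≤ exp (8 * σ) * weight (4 * σ) x := by
  unfold shiftedWeight weight
  rw [← exp_add, exp_le_exp]
  nlinarith [rpow_add_le (norm_nonneg x) hε0 hε]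

theorem weight_le_shiftedWeight {σ ε : ℝ} (hσ : 0 ≤ σ) {x y : EuclideanSpace ℝ (Fin n)}
    (h : ‖x - y‖ < ε) : weight σ x ≤ shiftedWeight σ ε y := by
  unfold shiftedWeight weight
  have : ‖x‖ ≤ ‖y‖ + ε := by
    have := norm_sub_norm_le x y
    linarith
  gcongr

theorem integrable_shiftedWeight {σ ε : ℝ} (hσ : 0 < σ) (hε0 : 0 ≤ ε) (hε : ε ≤ 1)
    (ha : Measurable a) (hi : ∀ σ, 0 < σ → Integrable fun x => a x ^ 2 * weight σ x) :
    Integrable fun x => a x ^ 2 * shiftedWeight σ ε x := by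
  refine ((hi (4 * σ) (by positivity)).const_mul (exp (8 * σ))).mono'
    ((ha.pow_const 2).mul (continuous_shiftedWeight σ ε).measurable).aestronglyMeasurable
    (.of_forall fun x => ?_)
  rw [Real.norm_of_nonneg (mul_nonneg (sq_nonneg _) (shiftedWeight_pos _ _ _).le)]
  have := mul_le_mul_of_nonneg_left (shiftedWeight_le hσ.le hε0 hε x) (sq_nonneg (a x))
  linarith

/-- The exterior Carleman estimate for distributional solutions of `Δ a = g`. -/
theorem weak_exterior_carleman_inequality (n : ℕ) {ρ ρ₂ : ℝ} (hρ : 0 < ρ) (h02 : ρ < ρ₂) :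
    ∃ τ₀ C : ℝ, 1 ≤ τ₀ ∧ 0 ≤ C ∧ ∀ τ, τ₀ ≤ τ → ∀ a g : EuclideanSpace ℝ (Fin n) → ℝ,
      Measurable a → Measurable g →
      (∀ σ, 0 < σ → Integrable fun x => a x ^ 2 * weight σ x) →
      (∀ σ, 0 < σ → Integrable fun x => g x ^ 2 * weight σ x) →
      (∀ φ : EuclideanSpace ℝ (Fin n) → ℝ, ContDiff ℝ ∞ φ → HasCompactSupport φ →
        tsupport φ ⊆ {x | ρ < ‖x‖} → ∫ x, a x * lap φ x = ∫ x, g x * φ x) →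
      τ ^ 3 * ∫ x in {x | ρ₂ ≤ ‖x‖}, a x ^ 2 * weight τ x ≤
        9 * (∫ x in {x | ρ₂ ≤ ‖x‖}, g x ^ 2 * weight τ x)
          + C * exp (2 * τ * ρ₂ ^ ((4 : ℝ) / 3)) * ((∫ x, a x ^ 2) + ∫ x, g x ^ 2) := by
  obtain ⟨ρ₁, h01, h12⟩ := exists_between h02
  obtain ⟨τ₀, C, hτ₀, hC, hext⟩ := exterior_carleman_inequality n (hρ.trans h01) h12
  refine ⟨τ₀, C, hτ₀, hC, fun τ hτ a g ha hg hia hig heq => ?_⟩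
  have hτ0 : 0 < τ := by linarith
  have hia2 := integrable_sq_of_weight ha.aestronglyMeasurable (hia 1 one_pos)
  have hig2 := integrable_sq_of_weight hg.aestronglyMeasurable (hig 1 one_pos)
  have hal : LocallyIntegrable a :=
    ((memLp_two_iff_integrable_sq ha.aestronglyMeasurable).2 hia2).locallyIntegrable one_le_two
  have hgl : LocallyIntegrable g :=
    ((memLp_two_iff_integrable_sq hg.aestronglyMeasurable).2 hig2).locallyIntegrable one_le_two
  have hS : MeasurableSet {x : EuclideanSpace ℝ (Fin n) | ρ₂ ≤ ‖x‖} :=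
    (isClosed_le continuous_const continuous_norm).measurableSet
  set δ := min 1 (ρ₁ - ρ) / 2 with hδ
  have hδ0 : 0 < δ := by
    have : 0 < min 1 (ρ₁ - ρ) := lt_min one_pos (by linarith)
    positivity
  have hδ1 : δ ≤ 1 := by linarith [min_le_left 1 (ρ₁ - ρ)]
  have hδρ : δ < ρ₁ - ρ := by linarith [min_le_right 1 (ρ₁ - ρ)]
  let ε : ℕ → ℝ := fun k => δ * ((k : ℝ) + 1)⁻¹
  have hε0 : ∀ k, 0 < ε k := fun k => by positivity
  have hεδ : ∀ k, ε k ≤ δ := fun k => mul_le_of_le_one_right hδ0.le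
    (inv_le_one_of_one_le₀ (by linarith [k.cast_nonneg (α := ℝ)]))
  have hεlim : Filter.Tendsto ε Filter.atTop (𝓝 0) := by
    have := (tendsto_one_div_add_atTop_nhds_zero_nat (𝕜 := ℝ)).const_mul δ
    simpa [ε] using this
  let β : ℕ → ContDiffBump (0 : EuclideanSpace ℝ (Fin n)) := fun k =>
    ⟨ε k / 2, ε k, by linarith [hε0 k], by linarith [hε0 k]⟩
  let η : ℕ → EuclideanSpace ℝ (Fin n) → ℝ := fun k => (β k).normed volume
  have hη : ∀ k, ContDiff ℝ ∞ (η k) := fun k => (β k).contDiff_normed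
  have hηc : ∀ k, HasCompactSupport (η k) := fun k => (β k).hasCompactSupport_normed
  have hη0 : ∀ k x, 0 ≤ η k x := fun k x => (β k).nonneg_normed x
  have hηi : ∀ k, Integrable (η k) := fun k => (β k).integrable_normed
  have hη1 : ∀ k, ∫ x, η k x = 1 := fun k => (β k).integral_normed
  have hηs : ∀ k x, η k x ≠ 0 → ‖x‖ < ε k := fun k x hx => by
    have : x ∈ Function.support ((β k).normed volume) := hx
    rw [(β k).support_normed_eq] at this
    simpa using this
  have hfs : ∀ k, ContDiff ℝ ∞ (mollify a (η k)) := fun k => contDiff_mollify hal (hη k) (hηc k)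
  have hgs : ∀ k, ContDiff ℝ ∞ (mollify g (η k)) := fun k => contDiff_mollify hgl (hη k) (hηc k)
  have hlap : ∀ k x, ρ₁ < ‖x‖ → lap (mollify a (η k)) x = mollify g (η k) x := by
    intro k x hx
    rw [lap_mollify hal (hη k) (hηc k)]
    have := heq (fun t => η k (x - t)) ((hη k).comp (contDiff_const.sub contDiff_id))
      ((hηc k).comp_homeomorph (Homeomorph.subLeft x)) ?_
    · simp only [lap_comp_sub (hη k)] at this
      exact this
    · refine (closure_minimal (t := {t | ‖x - t‖ ≤ ε k}) (fun t ht => (hηs k _ ht).le)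
        (isClosed_le (continuous_const.sub continuous_id).norm continuous_const)).trans
        fun t (ht : ‖x - t‖ ≤ ε k) => ?_
      have h1 := norm_sub_norm_le x t
      have h2 := hεδ k
      change ρ < ‖t‖
      linarith
  have hwint : ∀ {b : EuclideanSpace ℝ (Fin n) → ℝ}, Measurable b → LocallyIntegrable b →
      (∀ σ, 0 < σ → Integrable fun x => b x ^ 2 * weight σ x) → ∀ k σ, 0 < σ →
      Integrable fun x => mollify b (η k) x ^ 2 * weight σ x := fun hb hbl hib k σ hσ =>
    (integral_mollify_sq_le hb (hη k).continuous (hη0 k) (hηi k) (hη1 k) (hηs k)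
      (contDiff_mollify hbl (hη k) (hηc k)).continuous (continuous_weight σ).measurable
      (fun x => (weight_pos σ x).le) (fun x => (shiftedWeight_pos σ (ε k) x).le)
      (fun x y h => weight_le_shiftedWeight hσ.le h)
      (integrable_shiftedWeight hσ (hε0 k).le ((hεδ k).trans hδ1) hb hib)).1
  have hsq : ∀ {b : EuclideanSpace ℝ (Fin n) → ℝ}, Measurable b → LocallyIntegrable b →
      (Integrable fun x => b x ^ 2) → ∀ k, ∫ x, mollify b (η k) x ^ 2 ≤ ∫ x, b x ^ 2 :=
    fun hb hbl hib k => by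
      have := (integral_mollify_sq_le hb (hη k).continuous (hη0 k) (hηi k) (hη1 k) (hηs k)
        (contDiff_mollify hbl (hη k) (hηc k)).continuous (W := fun _ => 1) (W' := fun _ => 1)
        measurable_const (fun x => zero_le_one) (fun x => zero_le_one)
        (fun x y h => le_rfl) (by simpa using hib)).2
      simpa using this
  let V : ℕ → EuclideanSpace ℝ (Fin n) → ℝ := fun k =>
    {x | ρ₂ - ε k ≤ ‖x‖}.indicator (shiftedWeight τ (ε k))
  have hVS : ∀ k, MeasurableSet {x : EuclideanSpace ℝ (Fin n) | ρ₂ - ε k ≤ ‖x‖} := fun k =>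
    (isClosed_le continuous_const continuous_norm).measurableSet
  have hV0 : ∀ k x, 0 ≤ V k x := fun k x =>
    Set.indicator_nonneg (fun y _ => (shiftedWeight_pos _ _ y).le) x
  have hVle : ∀ k x, V k x ≤ shiftedWeight τ (ε k) x := fun k x =>
    Set.indicator_le_self' (fun y _ => (shiftedWeight_pos _ _ y).le) x
  have hVm : ∀ k, Measurable (V k) := fun k =>
    (continuous_shiftedWeight τ (ε k)).measurable.indicator (hVS k)
  have hgV : ∀ k, Integrable fun x => g x ^ 2 * V k x := fun k =>
    (integrable_shiftedWeight hτ0 (hε0 k).le ((hεδ k).trans hδ1) hg hig).mono'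
      ((hg.pow_const 2).mul (hVm k)).aestronglyMeasurable (.of_forall fun x => by
        rw [Real.norm_of_nonneg (mul_nonneg (sq_nonneg _) (hV0 k x))]
        exact mul_le_mul_of_nonneg_left (hVle k x) (sq_nonneg _))
  have hGS : ∀ k, ∫ x in {x | ρ₂ ≤ ‖x‖}, mollify g (η k) x ^ 2 * weight τ x ≤
      ∫ x, g x ^ 2 * V k x := by
    intro k
    have := (integral_mollify_sq_le hg (hη k).continuous (hη0 k) (hηi k) (hη1 k) (hηs k)
        (hgs k).continuous (W := {x | ρ₂ ≤ ‖x‖}.indicator (weight τ)) (W' := V k)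
        ((continuous_weight τ).measurable.indicator hS)
        (fun x => Set.indicator_nonneg (fun y _ => (weight_pos _ y).le) x)
        (hV0 k) (fun x y h => ?_) (hgV k)).2
    · rw [← integral_indicator hS]
      refine le_of_eq_of_le (integral_congr_ae (.of_forall fun x => ?_)) this
      exact Set.indicator_mul_right _ (fun x => mollify g (η k) x ^ 2) (weight τ)
    · refine Set.indicator_apply_le' (fun hx => ?_) fun _ => hV0 k y
      have hx' : ρ₂ ≤ ‖x‖ := hx
      have hy : y ∈ {x : EuclideanSpace ℝ (Fin n) | ρ₂ - ε k ≤ ‖x‖} := by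
        have := norm_sub_norm_le x y
        change ρ₂ - ε k ≤ ‖y‖
        linarith
      simp only [V]
      rw [Set.indicator_of_mem hy]
      exact weight_le_shiftedWeight hτ0.le h
  have hVlim : Filter.Tendsto (fun k => ∫ x, g x ^ 2 * V k x) Filter.atTop
      (𝓝 (∫ x in {x | ρ₂ ≤ ‖x‖}, g x ^ 2 * weight τ x)) := by
    rw [← integral_indicator hS]
    refine tendsto_integral_of_dominated_convergence
      (fun x => exp (8 * τ) * (g x ^ 2 * weight (4 * τ) x)) (fun k => (hgV k).1)
      ((hig _ (by positivity)).const_mul _) (fun k => .of_forall fun x => ?_)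
      (.of_forall fun x => ?_)
    · rw [Real.norm_of_nonneg (mul_nonneg (sq_nonneg _) (hV0 k x))]
      have := mul_le_mul_of_nonneg_left ((hVle k x).trans (shiftedWeight_le hτ0.le (hε0 k).le
        ((hεδ k).trans hδ1) x)) (sq_nonneg (g x))
      linarith
    · by_cases hx : ρ₂ ≤ ‖x‖
      · rw [Set.indicator_of_mem (show x ∈ {x | ρ₂ ≤ ‖x‖} from hx)]
        have hVk : ∀ k, V k x = shiftedWeight τ (ε k) x := fun k =>
          Set.indicator_of_mem (show x ∈ {x : EuclideanSpace ℝ (Fin n) | ρ₂ - ε k ≤ ‖x‖} from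
            (sub_le_self _ (hε0 k).le).trans hx) _
        simp only [hVk]
        refine Filter.Tendsto.const_mul _ ?_
        have hcont : Continuous fun e : ℝ => exp (2 * τ * (‖x‖ + e) ^ ((4 : ℝ) / 3)) := by
          have : Continuous fun e : ℝ => (‖x‖ + e) ^ ((4 : ℝ) / 3) :=
            (continuous_const.add continuous_id).rpow_const fun _ => Or.inr (by norm_num)
          fun_prop
        have := (hcont.tendsto 0).comp hεlim
        rw [add_zero] at this
        exact this
      · rw [Set.indicator_of_notMem (show x ∉ {x | ρ₂ ≤ ‖x‖} from hx)]
        refine tendsto_const_nhds.congr' ?_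
        filter_upwards [hεlim.eventually (gt_mem_nhds (show 0 < ρ₂ - ‖x‖ by linarith))] with k hk
        have : x ∉ {x : EuclideanSpace ℝ (Fin n) | ρ₂ - ε k ≤ ‖x‖} :=
          fun h : ρ₂ - ε k ≤ ‖x‖ => by linarith
        simp only [V]
        rw [Set.indicator_of_notMem this, mul_zero]
  have hae : ∀ᵐ x, Filter.Tendsto (fun k => mollify a (η k) x) Filter.atTop (𝓝 (a x)) := by
    have := ContDiffBump.ae_convolution_tendsto_right_of_locallyIntegrable (φ := β) (K := 2)
      (l := Filter.atTop) (μ := volume) hεlim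
      (.of_forall fun k => by simp only [β]; linarith) hal
    filter_upwards [this] with x hx
    refine hx.congr fun k => ?_
    rw [convolution_eq_swap]
    exact integral_congr_ae (.of_forall fun t => mul_comm _ _)
  set B := (∫ x, a x ^ 2) + ∫ x, g x ^ 2 with hB
  set K := C * exp (2 * τ * ρ₂ ^ ((4 : ℝ) / 3)) with hK
  have hK0 : 0 ≤ K := by positivity
  have hbound : ∀ k, ∫ x in {x | ρ₂ ≤ ‖x‖}, τ ^ 3 * (mollify a (η k) x ^ 2 * weight τ x) ≤
      9 * (∫ x, g x ^ 2 * V k x) + K * B := by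
    intro k
    rw [integral_const_mul]
    refine (hext τ hτ _ _ (hfs k) (hgs k).continuous (hlap k) (hwint ha hal hia k)
      (hwint hg hgl hig k)).trans ?_
    have h1 := hGS k
    have h2 := mul_le_mul_of_nonneg_left (add_le_add (hsq ha hal hia2 k) (hsq hg hgl hig2 k)) hK0
    linarith
  rw [← integral_const_mul]
  refine integral_le_of_tendsto_ae (fun k x => ?_)
    (fun k => ((hwint ha hal hia k τ hτ0).const_mul _).integrableOn)
    ((hia τ hτ0).const_mul _).integrableOn (ae_restrict_of_ae ?_) hbound
    ((hVlim.const_mul 9).add_const _)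
  · have := weight_pos τ x
    positivity
  · filter_upwards [hae] with x hx
    exact ((hx.pow 2).mul_const _).const_mul _

end

section

theorem laplacian_ofReal {n : ℕ} {φ : EuclideanSpace ℝ (Fin n) → ℝ} (hφ : ContDiff ℝ ∞ φ)
    (x : EuclideanSpace ℝ (Fin n)) :
    laplacian (fun y => (φ y : ℂ)) x = (lap φ x : ℂ) := by
  have key : ∀ {ψ : EuclideanSpace ℝ (Fin n) → ℝ}, ContDiff ℝ ∞ ψ →
      ∀ y (i : Fin n), fderiv ℝ (fun y => (ψ y : ℂ)) y (EuclideanSpace.single i 1)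
        = (pderiv i ψ y : ℂ) := by
    intro ψ hψ y i
    have h : HasFDerivAt (fun y => (ψ y : ℂ)) (Complex.ofRealCLM.comp (fderiv ℝ ψ y)) y :=
      Complex.ofRealCLM.hasFDerivAt.comp y ((hψ.differentiable (by simp)) y).hasFDerivAt
    rw [h.fderiv]
    rfl
  simp only [laplacian, lap, key hφ, Complex.ofReal_sum]
  exact Finset.sum_congr rfl fun i _ => key (contDiff_pderiv hφ i) x i

/-- A square-integrable distributional solution of `Δ w = Q w` outside a ball, with `Q` bounded
and `w` decaying faster than every weight `exp (-τ |x| ^ (4/3))`, vanishes outside every larger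
ball. -/
theorem ae_eq_zero_of_decay {n : ℕ} {ρ ρ₂ M : ℝ} (hρ : 0 < ρ) (h02 : ρ < ρ₂)
    {Q w : EuclideanSpace ℝ (Fin n) → ℂ} (hQ : Measurable Q) (hw : Measurable w)
    (hM : ∀ x, ‖Q x‖ ≤ M)
    (heq : ∀ φ : EuclideanSpace ℝ (Fin n) → ℝ, ContDiff ℝ ∞ φ → HasCompactSupport φ →
      tsupport φ ⊆ {x | ρ < ‖x‖} → ∫ x, w x * (lap φ x : ℂ) = ∫ x, Q x * w x * (φ x : ℂ))
    (hdecay : ∀ σ, 0 < σ → Integrable fun x => ‖w x‖ ^ 2 * weight σ x) :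
    ∀ᵐ x, ρ₂ ≤ ‖x‖ → w x = 0 := by
  obtain ⟨τ₀, C, hτ₀, hC, hcarl⟩ := weak_exterior_carleman_inequality n hρ h02
  have hQw : Measurable fun x => Q x * w x := hQ.mul hw
  have hM0 : 0 ≤ M := (norm_nonneg _).trans (hM 0)
  have hQw_le : ∀ x, ‖Q x * w x‖ ^ 2 ≤ M ^ 2 * ‖w x‖ ^ 2 := fun x => by
    rw [norm_mul, mul_pow]
    gcongr
    exact hM x
  have hdecayQ : ∀ σ, 0 < σ → Integrable fun x => ‖Q x * w x‖ ^ 2 * weight σ x := fun σ hσ =>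
    ((hdecay σ hσ).const_mul (M ^ 2)).mono'
      ((hQw.norm.pow_const 2).mul (continuous_weight σ).measurable).aestronglyMeasurable
      (.of_forall fun x => by
        have hW := weight_pos σ x
        rw [Real.norm_of_nonneg (by positivity), ← mul_assoc]
        exact mul_le_mul_of_nonneg_right (hQw_le x) hW.le)
  have hpart : ∀ {z : EuclideanSpace ℝ (Fin n) → ℂ}, Measurable z →
      (∀ σ, 0 < σ → Integrable fun x => ‖z x‖ ^ 2 * weight σ x) →
      (∀ σ, 0 < σ → Integrable fun x => (z x).re ^ 2 * weight σ x) ∧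
      (∀ σ, 0 < σ → Integrable fun x => (z x).im ^ 2 * weight σ x) := by
    intro z hz hi
    constructor
    all_goals
      intro σ hσ
      have hW := continuous_weight (n := n) σ
      refine (hi σ hσ).mono' (Measurable.aestronglyMeasurable (by fun_prop))
        (.of_forall fun x => ?_)
      rw [Real.norm_of_nonneg (mul_nonneg (sq_nonneg _) (weight_pos _ _).le)]
      refine mul_le_mul_of_nonneg_right ?_ (weight_pos _ _).le
      rw [Complex.sq_norm, Complex.normSq_apply]
      nlinarith [sq_nonneg (z x).re, sq_nonneg (z x).im]
  have hloc : ∀ {z : EuclideanSpace ℝ (Fin n) → ℂ}, Measurable z →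
      (∀ σ, 0 < σ → Integrable fun x => ‖z x‖ ^ 2 * weight σ x) → LocallyIntegrable z := by
    intro z hz hi
    exact ((memLp_two_iff_integrable_sq_norm hz.aestronglyMeasurable).2 (integrable_sq_of_weight
      hz.norm.aestronglyMeasurable (hi 1 one_pos))).locallyIntegrable one_le_two
  have hint : ∀ {z : EuclideanSpace ℝ (Fin n) → ℂ} {ψ : EuclideanSpace ℝ (Fin n) → ℝ},
      LocallyIntegrable z → Continuous ψ → HasCompactSupport ψ →
      Integrable fun x => z x * (ψ x : ℂ) := by
    intro z ψ hz hψ hψc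
    refine (hz.integrable_smul_left_of_hasCompactSupport hψ hψc).congr (.of_forall fun x => ?_)
    simp [mul_comm]
  have hlapc : ∀ {φ : EuclideanSpace ℝ (Fin n) → ℝ}, HasCompactSupport φ →
      HasCompactSupport (lap φ) := fun hφ => HasCompactSupport.intro hφ fun x hx => lap_eq_zero hx
  have hre : ∀ φ : EuclideanSpace ℝ (Fin n) → ℝ, ContDiff ℝ ∞ φ → HasCompactSupport φ →
      tsupport φ ⊆ {x | ρ < ‖x‖} →
      ∫ x, (w x).re * lap φ x = ∫ x, (Q x * w x).re * φ x := by
    intro φ hφ hφc hφs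
    have h := congrArg Complex.reCLM (heq φ hφ hφc hφs)
    rw [← Complex.reCLM.integral_comp_comm (hint (hloc hw hdecay) (by fun_prop) (hlapc hφc)),
      ← Complex.reCLM.integral_comp_comm (hint (hloc hQw hdecayQ) hφ.continuous hφc)] at h
    simpa only [Complex.reCLM_apply, Complex.re_mul_ofReal] using h
  have him : ∀ φ : EuclideanSpace ℝ (Fin n) → ℝ, ContDiff ℝ ∞ φ → HasCompactSupport φ →
      tsupport φ ⊆ {x | ρ < ‖x‖} →
      ∫ x, (w x).im * lap φ x = ∫ x, (Q x * w x).im * φ x := by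
    intro φ hφ hφc hφs
    have h := congrArg Complex.imCLM (heq φ hφ hφc hφs)
    rw [← Complex.imCLM.integral_comp_comm (hint (hloc hw hdecay) (by fun_prop) (hlapc hφc)),
      ← Complex.imCLM.integral_comp_comm (hint (hloc hQw hdecayQ) hφ.continuous hφc)] at h
    simpa only [Complex.imCLM_apply, Complex.im_mul_ofReal] using h
  set S := {x : EuclideanSpace ℝ (Fin n) | ρ₂ ≤ ‖x‖} with hSdef
  have hS : MeasurableSet S := (isClosed_le continuous_const continuous_norm).measurableSet
  set J := ∫ x in S, ‖w x‖ ^ 2 with hJ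
  set B := ((∫ x, (w x).re ^ 2) + ∫ x, (Q x * w x).re ^ 2)
    + ((∫ x, (w x).im ^ 2) + ∫ x, (Q x * w x).im ^ 2) with hB
  have hJi : IntegrableOn (fun x => ‖w x‖ ^ 2) S :=
    (integrable_sq_of_weight hw.norm.aestronglyMeasurable (hdecay 1 one_pos)).integrableOn
  have hsplit : ∀ {z : EuclideanSpace ℝ (Fin n) → ℂ}, Measurable z →
      (∀ σ, 0 < σ → Integrable fun x => ‖z x‖ ^ 2 * weight σ x) → ∀ τ, 0 < τ →
      ∫ x in S, ‖z x‖ ^ 2 * weight τ x =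
        (∫ x in S, (z x).re ^ 2 * weight τ x) + ∫ x in S, (z x).im ^ 2 * weight τ x := by
    intro z hz hi τ hτ
    rw [← integral_add ((hpart hz hi).1 τ hτ).integrableOn ((hpart hz hi).2 τ hτ).integrableOn]
    congr 1
    funext x
    rw [Complex.sq_norm, Complex.normSq_apply]
    ring
  have hmain : ∀ τ, τ₀ ≤ τ → 9 * M ^ 2 ≤ τ ^ 3 → (τ ^ 3 - 9 * M ^ 2) * J ≤ C * B := by
    intro τ hτ hτM
    have hτ0 : 0 < τ := by linarith
    have h1 := hcarl τ hτ (fun x => (w x).re) (fun x => (Q x * w x).re) (by fun_prop)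
      (by fun_prop) (hpart hw hdecay).1 (hpart hQw hdecayQ).1 hre
    have h2 := hcarl τ hτ (fun x => (w x).im) (fun x => (Q x * w x).im) (by fun_prop)
      (by fun_prop) (hpart hw hdecay).2 (hpart hQw hdecayQ).2 him
    set K := exp (2 * τ * ρ₂ ^ ((4 : ℝ) / 3)) with hK
    have hK0 : 0 < K := exp_pos _
    have hQle : ∫ x in S, ‖Q x * w x‖ ^ 2 * weight τ x ≤
        M ^ 2 * ∫ x in S, ‖w x‖ ^ 2 * weight τ x := by
      rw [← integral_const_mul]
      refine integral_mono (hdecayQ τ hτ0).integrableOn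
        ((hdecay τ hτ0).const_mul _).integrableOn fun x => ?_
      simp only [← mul_assoc]
      exact mul_le_mul_of_nonneg_right (hQw_le x) (weight_pos _ _).le
    have hKJ : K * J ≤ ∫ x in S, ‖w x‖ ^ 2 * weight τ x := by
      rw [hJ, ← integral_const_mul]
      refine setIntegral_mono_on (hJi.const_mul _) (hdecay τ hτ0).integrableOn hS fun x hx => ?_
      rw [mul_comm]
      refine mul_le_mul_of_nonneg_left ?_ (sq_nonneg _)
      have hx' : ρ₂ ≤ ‖x‖ := hx
      rw [hK]
      unfold weight
      have : (0 : ℝ) ≤ ρ₂ := by linarith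
      gcongr
    rw [hsplit hw hdecay τ hτ0] at hQle hKJ
    rw [hsplit hQw hdecayQ τ hτ0] at hQle
    have h3 := mul_le_mul_of_nonneg_left hKJ (sub_nonneg.2 hτM)
    refine le_of_mul_le_mul_left ?_ hK0
    rw [hB]
    linarith
  have hJ0 : J = 0 := by
    have hJnn : 0 ≤ J := integral_nonneg fun x => sq_nonneg _
    by_contra hne
    have hJpos : 0 < J := lt_of_le_of_ne hJnn (Ne.symm hne)
    have hB0 : 0 ≤ B := by
      have h : ∀ F : EuclideanSpace ℝ (Fin n) → ℝ, 0 ≤ ∫ x, F x ^ 2 := fun F =>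
        integral_nonneg fun x => sq_nonneg _
      exact add_nonneg (add_nonneg (h _) (h _)) (add_nonneg (h _) (h _))
    set τ := max τ₀ (9 * M ^ 2 + C * B / J + 1) with hτ
    have hτ1 : τ₀ ≤ τ := le_max_left _ _
    have hτ2 : 9 * M ^ 2 + C * B / J + 1 ≤ τ := le_max_right _ _
    have hτ3 : τ ≤ τ ^ 3 := le_self_pow₀ (hτ₀.trans hτ1) (by norm_num)
    have hq : 0 ≤ C * B / J := by positivity
    have h4 := hmain τ hτ1 (by linarith)
    have h5 : (C * B / J + 1) * J ≤ (τ ^ 3 - 9 * M ^ 2) * J :=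
      mul_le_mul_of_nonneg_right (by linarith) hJnn
    rw [add_mul, div_mul_cancel₀ _ hne] at h5
    linarith
  have := (setIntegral_eq_zero_iff_of_nonneg_ae (.of_forall fun x => sq_nonneg _) hJi).1 hJ0
  have h0 := (ae_restrict_iff' hS).1 this
  filter_upwards [h0] with x hx hxS
  simpa using hx hxS

end

end CarlemanInfinity

/-- **Meshkov's qualitative unique continuation theorem at infinity.**
If `u ∈ H²_loc(Ω_ρ)` (formalized distributionally: `u` is locally integrable on
`Ω_ρ = {|x| > ρ}` and satisfies `Δu = q u` against all test functions supported in `Ω_ρ`),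
`q` is bounded and measurable on `Ω_ρ`, and
`∫_{Ω_ρ} |u|² exp(2τ|x|^{4/3}) dx < ∞` for all `τ > 0`, then `u ≡ 0` in `Ω_ρ`. -/
theorem meshkov_unique_continuation_at_infinity
    (n : ℕ) (hn : 1 ≤ n) (ρ : ℝ) (hρ : 0 < ρ)
    (q u : EuclideanSpace ℝ (Fin n) → ℂ)
    (hqmeas : Measurable q)
    (hqbdd : ∃ M : ℝ, ∀ x, ρ < ‖x‖ → ‖q x‖ ≤ M)
    (hu : LocallyIntegrableOn u {x | ρ < ‖x‖})
    (heq : ∀ φ : EuclideanSpace ℝ (Fin n) → ℂ, ContDiff ℝ (⊤ : ℕ∞) φ → HasCompactSupport φ →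
      tsupport φ ⊆ {x | ρ < ‖x‖} →
      ∫ x, u x * laplacian φ x = ∫ x, q x * u x * φ x)
    (hdecay : ∀ τ : ℝ, 0 < τ → IntegrableOn
      (fun x => ‖u x‖ ^ 2 * Real.exp (2 * τ * ‖x‖ ^ ((4 : ℝ) / 3))) {x | ρ < ‖x‖}) :
    ∀ᵐ x, ρ < ‖x‖ → u x = 0 := by
  obtain ⟨M, hM⟩ := hqbdd
  set Ω := {x : EuclideanSpace ℝ (Fin n) | ρ < ‖x‖} with hΩdef
  have hΩ : MeasurableSet Ω := (isOpen_lt continuous_const continuous_norm).measurableSet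
  have hum := hu.aestronglyMeasurable
  set w : EuclideanSpace ℝ (Fin n) → ℂ := Ω.indicator (hum.mk u) with hwdef
  have hw : Measurable w := hum.stronglyMeasurable_mk.measurable.indicator hΩ
  have huw : ∀ᵐ x, x ∈ Ω → u x = w x := by
    filter_upwards [(ae_restrict_iff' hΩ).1 hum.ae_eq_mk] with x hx hxΩ
    rw [hwdef, Set.indicator_of_mem hxΩ, hx hxΩ]
  have hw0 : ∀ x, x ∉ Ω → w x = 0 := fun x hx => Set.indicator_of_notMem hx _
  have hQM : ∀ x, ‖Ω.indicator q x‖ ≤ max M 0 := fun x => by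
    by_cases hx : x ∈ Ω
    · rw [Set.indicator_of_mem hx]; exact (hM x hx).trans (le_max_left _ _)
    · rw [Set.indicator_of_notMem hx, norm_zero]; exact le_max_right _ _
  have hwdecay : ∀ σ, 0 < σ → Integrable fun x => ‖w x‖ ^ 2 * CarlemanInfinity.weight σ x := fun σ hσ => by
    refine ((integrable_indicator_iff hΩ).2 (hdecay σ hσ)).congr ?_
    filter_upwards [huw] with x hx
    by_cases hxΩ : x ∈ Ω
    · rw [Set.indicator_of_mem hxΩ, hx hxΩ]; rfl
    · rw [Set.indicator_of_notMem hxΩ, hw0 x hxΩ]; simp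
  have hweq : ∀ φ : EuclideanSpace ℝ (Fin n) → ℝ, ContDiff ℝ (⊤ : ℕ∞) φ → HasCompactSupport φ →
      tsupport φ ⊆ Ω →
      ∫ x, w x * (CarlemanInfinity.lap φ x : ℂ) = ∫ x, Ω.indicator q x * w x * (φ x : ℂ) := by
    intro φ hφ hφc hφs
    have hsub : tsupport (fun x => (φ x : ℂ)) ⊆ tsupport φ :=
      closure_mono fun x hx => by
        intro h0
        exact hx (by simp [h0])
    have h := heq (fun x => (φ x : ℂ)) (Complex.ofRealCLM.contDiff.comp hφ)
      (hφc.of_isClosed_subset (isClosed_tsupport _) hsub) (hsub.trans hφs)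
    simp only [CarlemanInfinity.laplacian_ofReal hφ] at h
    convert h using 1
    · refine integral_congr_ae ?_
      filter_upwards [huw] with x hx
      by_cases hxΩ : x ∈ Ω
      · rw [hx hxΩ]
      · simp [CarlemanInfinity.lap_eq_zero fun h => hxΩ (hφs h)]
    · refine integral_congr_ae ?_
      filter_upwards [huw] with x hx
      by_cases hxΩ : x ∈ Ω
      · rw [hx hxΩ, Set.indicator_of_mem hxΩ]
      · simp [image_eq_zero_of_notMem_tsupport fun h => hxΩ (hφs h)]
  have hzero : ∀ᵐ x, ∀ k : ℕ, ρ + 1 / ((k : ℝ) + 1) ≤ ‖x‖ → w x = 0 :=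
    ae_all_iff.2 fun k => CarlemanInfinity.ae_eq_zero_of_decay hρ (lt_add_of_pos_right _ (by positivity))
      (hqmeas.indicator hΩ) hw hQM hweq hwdecay
  filter_upwards [hzero, huw] with x h1 h2 hx
  obtain ⟨k, hk⟩ := exists_nat_one_div_lt (sub_pos.2 hx)
  rw [h2 hx]
  exact h1 k (by linarith)
end

section
/- Let n ≥ 1 and let 2/3 < α ≤ 2. Then there exist a number τ₀ > 0 and a constant C = C_α > 0 such that for every smooth compactly supported function v on ℝⁿ whose support is contained in {x ∈ ℝⁿ : |x| > 1} and every τ > τ₀, one has τ³ ∫_{ℝⁿ} |v(x)|² |x|^{3α−2−n} exp(2τ|x|^α) dx ≤ C ∫_{ℝⁿ} |Δv(x)|² |x|^{2−n} exp(2τ|x|^α) dx. -/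
open MeasureTheory Real

open scoped ContDiff

namespace HasLineDerivAt

variable {E : Type*} [NormedAddCommGroup E] [NormedSpace ℝ E]
  {f g : E → ℝ} {f' g' : ℝ} {x v : E}

theorem congr_deriv (hf : HasLineDerivAt ℝ f f' x v) (h : f' = g') :
    HasLineDerivAt ℝ f g' x v :=
  h ▸ hf

theorem mul (hf : HasLineDerivAt ℝ f f' x v) (hg : HasLineDerivAt ℝ g g' x v) :
    HasLineDerivAt ℝ (fun y => f y * g y) (f' * g x + f x * g') x v := by
  simpa [HasLineDerivAt] using HasDerivAt.fun_mul (𝕜 := ℝ) hf hg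

theorem add (hf : HasLineDerivAt ℝ f f' x v) (hg : HasLineDerivAt ℝ g g' x v) :
    HasLineDerivAt ℝ (fun y => f y + g y) (f' + g') x v :=
  HasDerivAt.fun_add (𝕜 := ℝ) hf hg

theorem sub (hf : HasLineDerivAt ℝ f f' x v) (hg : HasLineDerivAt ℝ g g' x v) :
    HasLineDerivAt ℝ (fun y => f y - g y) (f' - g') x v :=
  HasDerivAt.fun_sub (𝕜 := ℝ) hf hg

theorem const_mul (c : ℝ) (hf : HasLineDerivAt ℝ f f' x v) :
    HasLineDerivAt ℝ (fun y => c * f y) (c * f') x v :=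
  HasDerivAt.const_mul (𝕜 := ℝ) c hf

theorem sub_const (c : ℝ) (hf : HasLineDerivAt ℝ f f' x v) :
    HasLineDerivAt ℝ (fun y => f y - c) f' x v :=
  HasDerivAt.sub_const (𝕜 := ℝ) c hf

theorem pow_two (hf : HasLineDerivAt ℝ f f' x v) :
    HasLineDerivAt ℝ (fun y => f y ^ 2) (2 * f x * f') x v := by
  simpa [HasLineDerivAt] using HasDerivAt.fun_pow (𝕜 := ℝ) hf 2

theorem exp (hf : HasLineDerivAt ℝ f f' x v) :
    HasLineDerivAt ℝ (fun y => Real.exp (f y)) (Real.exp (f x) * f') x v := by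
  simpa [HasLineDerivAt] using HasDerivAt.exp (f := fun t : ℝ => f (x + t • v)) hf

theorem rpow_const (p : ℝ) (hf : HasLineDerivAt ℝ f f' x v) (hx : f x ≠ 0) :
    HasLineDerivAt ℝ (fun y => f y ^ p) (f' * p * f x ^ (p - 1)) x v := by
  simpa [HasLineDerivAt] using
    HasDerivAt.rpow_const (p := p) (f := fun t : ℝ => f (x + t • v)) hf (by simp [hx])

theorem sum {ι : Type*} {s : Finset ι} {F : ι → E → ℝ} {F' : ι → ℝ}
    (h : ∀ i ∈ s, HasLineDerivAt ℝ (F i) (F' i) x v) :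
    HasLineDerivAt ℝ (fun y => ∑ i ∈ s, F i y) (∑ i ∈ s, F' i) x v :=
  HasDerivAt.fun_sum (𝕜 := ℝ) h

end HasLineDerivAt

namespace MeshkovCarleman

variable {n : ℕ}

/-- The `i`-th partial derivative. -/
noncomputable def pderiv {F : Type*} [NormedAddCommGroup F] [NormedSpace ℝ F] (i : Fin n)
    (u : EuclideanSpace ℝ (Fin n) → F) (x : EuclideanSpace ℝ (Fin n)) : F :=
  fderiv ℝ u x (EuclideanSpace.single i 1)

section pderiv

variable {F : Type*} [NormedAddCommGroup F] [NormedSpace ℝ F]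

theorem contDiff_pderiv {u : EuclideanSpace ℝ (Fin n) → F} (hu : ContDiff ℝ ∞ u) (i : Fin n) :
    ContDiff ℝ ∞ (pderiv i u) :=
  (hu.fderiv_right (m := ∞) (by simp)).clm_apply contDiff_const

theorem hasLineDerivAt_pderiv {u : EuclideanSpace ℝ (Fin n) → ℝ} {x : EuclideanSpace ℝ (Fin n)}
    (hu : DifferentiableAt ℝ u x) (i : Fin n) :
    HasLineDerivAt ℝ u (pderiv i u x) x (EuclideanSpace.single i 1) :=
  hu.hasFDerivAt.hasLineDerivAt _

theorem pderiv_comm {u : EuclideanSpace ℝ (Fin n) → ℝ} (hu : ContDiff ℝ ∞ u) (i j : Fin n)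
    (x : EuclideanSpace ℝ (Fin n)) :
    pderiv i (pderiv j u) x = pderiv j (pderiv i u) x := by
  have hd : DifferentiableAt ℝ (fderiv ℝ u) x :=
    ((hu.fderiv_right (m := ∞) (by simp)).differentiable (by simp)) x
  have h : ∀ i j : Fin n, pderiv i (pderiv j u) x =
      fderiv ℝ (fderiv ℝ u) x (EuclideanSpace.single i 1) (EuclideanSpace.single j 1) := by
    intro i j
    change fderiv ℝ (fun y => fderiv ℝ u y (EuclideanSpace.single j 1)) x _ = _
    rw [fderiv_clm_apply hd (differentiableAt_const _)]
    simp
  rw [h, h]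
  exact (hu.contDiffAt.isSymmSndFDerivAt (by
    rw [minSmoothness_of_isRCLikeNormedField]
    exact WithTop.coe_le_coe.2 le_top)) _ _

theorem pderiv_eq_zero {u : EuclideanSpace ℝ (Fin n) → F} {x : EuclideanSpace ℝ (Fin n)}
    (i : Fin n) (hx : x ∉ tsupport u) :
    pderiv i u x = 0 := by
  have : u =ᶠ[nhds x] fun _ => 0 := notMem_tsupport_iff_eventuallyEq.1 hx
  simp [pderiv, this.fderiv_eq]

theorem tsupport_pderiv_subset (u : EuclideanSpace ℝ (Fin n) → F) (i : Fin n) :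
    tsupport (pderiv i u) ⊆ tsupport u :=
  closure_minimal (fun x hx => by
    by_contra h
    exact hx (pderiv_eq_zero i h)) (isClosed_tsupport u)

theorem pderiv_pderiv_eq_zero {u : EuclideanSpace ℝ (Fin n) → F} {x : EuclideanSpace ℝ (Fin n)}
    (i j : Fin n) (hx : x ∉ tsupport u) :
    pderiv i (pderiv j u) x = 0 :=
  pderiv_eq_zero i fun h => hx (tsupport_pderiv_subset u j h)

end pderiv

theorem integral_pderiv_eq_zero {f : EuclideanSpace ℝ (Fin n) → ℝ} (hf : ContDiff ℝ ∞ f)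
    (hc : HasCompactSupport f)
    (i : Fin n) : ∫ x, pderiv i f x = 0 := by
  have hf' : Integrable (pderiv i f) :=
    (contDiff_pderiv hf i).continuous.integrable_of_hasCompactSupport
      (hc.mono' (subset_tsupport _ |>.trans (tsupport_pderiv_subset f i)))
  have hfi : Integrable f := hf.continuous.integrable_of_hasCompactSupport hc
  have := integral_mul_fderiv_eq_neg_fderiv_mul_of_integrable
    (μ := (volume : Measure (EuclideanSpace ℝ (Fin n))))
    (f := fun _ : EuclideanSpace ℝ (Fin n) => (1 : ℝ)) (g := f) (v := EuclideanSpace.single i 1)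
    (by simp) (by simpa using! hf') (by simpa using hfi)
    (fun x _ => differentiableAt_const _) (fun x _ => hf.differentiable (by simp) x)
  simpa using! this

/-- Smoothness away from the origin suffices for functions supported away from the origin. -/
theorem contDiff_of_eq_zero_off {f : EuclideanSpace ℝ (Fin n) → ℝ}
    {K : Set (EuclideanSpace ℝ (Fin n))} (hK : IsClosed K) (h0 : (0 : EuclideanSpace ℝ (Fin n)) ∉ K)
    (hf : ∀ x ≠ 0, ContDiffAt ℝ ∞ f x) (hz : ∀ x ∉ K, f x = 0) : ContDiff ℝ ∞ f := by
  rw [contDiff_iff_contDiffAt]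
  intro x
  by_cases hx : x ∈ K
  · exact hf x fun h => h0 (h ▸ hx)
  · have : f =ᶠ[nhds x] fun _ => 0 := by
      filter_upwards [hK.isOpen_compl.mem_nhds hx] with y hy using hz y hy
    exact contDiffAt_const.congr_of_eventuallyEq this

theorem integrable_of_eq_zero_off {f : EuclideanSpace ℝ (Fin n) → ℝ}
    {K : Set (EuclideanSpace ℝ (Fin n))} (hK : IsCompact K)
    (h0 : (0 : EuclideanSpace ℝ (Fin n)) ∉ K)
    (hf : ∀ x ≠ 0, ContDiffAt ℝ ∞ f x) (hz : ∀ x ∉ K, f x = 0) : Integrable f :=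
  (contDiff_of_eq_zero_off hK.isClosed h0 hf hz).continuous.integrable_of_hasCompactSupport
    (HasCompactSupport.intro hK hz)

theorem contDiffAt_normSq_rpow (p : ℝ) {x : EuclideanSpace ℝ (Fin n)} (hx : x ≠ 0) :
    ContDiffAt ℝ ∞ (fun y : EuclideanSpace ℝ (Fin n) => (‖y‖ ^ 2) ^ p) x :=
  (contDiff_norm_sq ℝ).contDiffAt.rpow_const_of_ne (by simpa using hx)

theorem hasLineDerivAt_coord (i j : Fin n) (x : EuclideanSpace ℝ (Fin n)) :
    HasLineDerivAt ℝ (fun y : EuclideanSpace ℝ (Fin n) => y i) (if i = j then 1 else 0) x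
      (EuclideanSpace.single j 1) := by
  have h := ((EuclideanSpace.proj i : EuclideanSpace ℝ (Fin n) →L[ℝ] ℝ).hasFDerivAt
    (x := x)).hasLineDerivAt (EuclideanSpace.single j 1)
  simpa [Pi.single_apply] using h

theorem hasLineDerivAt_normSq (j : Fin n) (x : EuclideanSpace ℝ (Fin n)) :
    HasLineDerivAt ℝ (fun y : EuclideanSpace ℝ (Fin n) => ‖y‖ ^ 2) (2 * x j) x
      (EuclideanSpace.single j 1) := by
  simpa [EuclideanSpace.inner_single_right] using ((hasFDerivAt_id x).norm_sq).hasLineDerivAt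
    (EuclideanSpace.single j 1)

theorem hasLineDerivAt_normSq_rpow (p : ℝ) (j : Fin n) {x : EuclideanSpace ℝ (Fin n)} (hx : x ≠ 0) :
    HasLineDerivAt ℝ (fun y : EuclideanSpace ℝ (Fin n) => (‖y‖ ^ 2) ^ p)
      (2 * p * (‖x‖ ^ 2) ^ p * (x j / ‖x‖ ^ 2)) x
      (EuclideanSpace.single j 1) := by
  have hs : ‖x‖ ^ 2 ≠ 0 := by simpa using hx
  refine ((hasLineDerivAt_normSq j x).rpow_const p hs).congr_deriv ?_
  rw [rpow_sub_one hs]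
  ring

/-- The radial derivative `x · ∇w`. -/
noncomputable def euler (w : EuclideanSpace ℝ (Fin n) → ℝ) (x : EuclideanSpace ℝ (Fin n)) : ℝ :=
  ∑ i, x i * pderiv i w x

/-- The squared length of the gradient. -/
noncomputable def gradSq (w : EuclideanSpace ℝ (Fin n) → ℝ) (x : EuclideanSpace ℝ (Fin n)) : ℝ :=
  ∑ i, pderiv i w x ^ 2

/-- The Laplacian of a real-valued function. -/
noncomputable def lap (w : EuclideanSpace ℝ (Fin n) → ℝ) (x : EuclideanSpace ℝ (Fin n)) : ℝ :=
  ∑ i, pderiv i (pderiv i w) x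

section smoothness

variable {w : EuclideanSpace ℝ (Fin n) → ℝ}

theorem contDiff_euler (hw : ContDiff ℝ ∞ w) : ContDiff ℝ ∞ (euler w) :=
  ContDiff.sum fun i _ =>
    (EuclideanSpace.proj i : EuclideanSpace ℝ (Fin n) →L[ℝ] ℝ).contDiff.mul (contDiff_pderiv hw i)

theorem contDiff_gradSq (hw : ContDiff ℝ ∞ w) : ContDiff ℝ ∞ (gradSq w) :=
  ContDiff.sum fun i _ => (contDiff_pderiv hw i).pow 2

theorem contDiff_lap (hw : ContDiff ℝ ∞ w) : ContDiff ℝ ∞ (lap w) :=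
  ContDiff.sum fun i _ => contDiff_pderiv (contDiff_pderiv hw i) i

theorem hasLineDerivAt_euler (hw : ContDiff ℝ ∞ w) (j : Fin n) (x : EuclideanSpace ℝ (Fin n)) :
    HasLineDerivAt ℝ (euler w) (pderiv j w x + ∑ i, x i * pderiv j (pderiv i w) x) x
      (EuclideanSpace.single j 1) := by
  have h := HasLineDerivAt.sum (s := Finset.univ) fun i _ => (hasLineDerivAt_coord i j x).mul
    (hasLineDerivAt_pderiv ((contDiff_pderiv hw i).differentiable (by simp) x) j)
  simpa [Finset.sum_add_distrib] using! h

theorem hasLineDerivAt_gradSq (hw : ContDiff ℝ ∞ w) (j : Fin n) (x : EuclideanSpace ℝ (Fin n)) :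
    HasLineDerivAt ℝ (gradSq w) (2 * ∑ i, pderiv i w x * pderiv j (pderiv i w) x) x
      (EuclideanSpace.single j 1) := by
  have h := HasLineDerivAt.sum (s := Finset.univ) fun i _ =>
    (hasLineDerivAt_pderiv ((contDiff_pderiv hw i).differentiable (by simp) x) j).pow_two
  simpa [Finset.mul_sum, mul_assoc] using! h

end smoothness

section vanishing

variable {w : EuclideanSpace ℝ (Fin n) → ℝ} {x : EuclideanSpace ℝ (Fin n)}

theorem euler_eq_zero (hx : x ∉ tsupport w) : euler w x = 0 := by simp [euler, pderiv_eq_zero _ hx]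

theorem gradSq_eq_zero (hx : x ∉ tsupport w) : gradSq w x = 0 := by
  simp [gradSq, pderiv_eq_zero _ hx]

theorem lap_eq_zero (hx : x ∉ tsupport w) : lap w x = 0 := by
  simp [lap, pderiv_pderiv_eq_zero _ _ hx]

end vanishing

/-- The derivative `ατ|x|^α` of the phase `τ|x|^α` with respect to `log |x|`. -/
noncomputable def phase (α τ : ℝ) (x : EuclideanSpace ℝ (Fin n)) : ℝ := α * τ * (‖x‖ ^ 2) ^ (α / 2)

/-- The zeroth order coefficient of the symmetric part of the conjugated Laplacian. -/
noncomputable def symCoeff (α τ : ℝ) (x : EuclideanSpace ℝ (Fin n)) : ℝ :=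
  ((2 * phase α τ x - n) ^ 2 - ((n : ℝ) - 2) ^ 2) / 4

/-- The operator `|x|² e^ψ Δ e^{-ψ}` with `ψ = τ|x|^α - log |x|`. -/
noncomputable def conjLap (α τ : ℝ) (w : EuclideanSpace ℝ (Fin n) → ℝ)
    (x : EuclideanSpace ℝ (Fin n)) : ℝ :=
  ‖x‖ ^ 2 * lap w x - 2 * (phase α τ x - 1) * euler w x +
    (symCoeff α τ x - α * phase α τ x) * w x

/-- The vector field of Pohozaev type whose divergence produces the commutator of the symmetric
and antisymmetric parts of the conjugated Laplacian. -/
noncomputable def flux (α τ : ℝ) (w : EuclideanSpace ℝ (Fin n) → ℝ) (j : Fin n)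
    (x : EuclideanSpace ℝ (Fin n)) : ℝ :=
  (‖x‖ ^ 2) ^ (-(n : ℝ) / 2) *
    (x j * ((2 * phase α τ x - n) * (‖x‖ ^ 2 * gradSq w x) +
        (α ^ 2 * phase α τ x - symCoeff α τ x * (2 * phase α τ x - n)) * w x ^ 2) -
      ‖x‖ ^ 2 * ((2 * ((2 * phase α τ x - n) * euler w x) + 2 * α * (phase α τ x * w x)) *
        pderiv j w x))

section identities

variable {α τ : ℝ} {w : EuclideanSpace ℝ (Fin n) → ℝ}

theorem contDiffAt_phase {x : EuclideanSpace ℝ (Fin n)} (hx : x ≠ 0) :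
    ContDiffAt ℝ ∞ (phase (n := n) α τ) x :=
  contDiffAt_const.mul (contDiffAt_normSq_rpow _ hx)

theorem contDiffAt_symCoeff {x : EuclideanSpace ℝ (Fin n)} (hx : x ≠ 0) :
    ContDiffAt ℝ ∞ (symCoeff (n := n) α τ) x :=
  ((((contDiffAt_const.mul (contDiffAt_phase hx)).sub contDiffAt_const).pow 2).sub
    contDiffAt_const).div_const 4

theorem hasLineDerivAt_phase (j : Fin n) {x : EuclideanSpace ℝ (Fin n)} (hx : x ≠ 0) :
    HasLineDerivAt ℝ (phase α τ) (α * phase α τ x * (x j / ‖x‖ ^ 2)) x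
      (EuclideanSpace.single j 1) := by
  refine ((hasLineDerivAt_normSq_rpow (α / 2) j hx).const_mul (α * τ)).congr_deriv ?_
  simp only [phase]
  ring

theorem contDiffAt_conjLap (hw : ContDiff ℝ ∞ w) {x : EuclideanSpace ℝ (Fin n)} (hx : x ≠ 0) :
    ContDiffAt ℝ ∞ (conjLap α τ w) x := by
  have h₁ := (contDiff_lap hw).contDiffAt (x := x)
  have h₂ := (contDiff_euler hw).contDiffAt (x := x)
  have h₃ := contDiffAt_phase (α := α) (τ := τ) hx
  have h₄ := contDiffAt_symCoeff (α := α) (τ := τ) hx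
  have h₅ : ContDiffAt ℝ ∞ (fun y : EuclideanSpace ℝ (Fin n) => ‖y‖ ^ 2) x :=
    (contDiff_norm_sq ℝ).contDiffAt
  have h₆ := hw.contDiffAt (x := x)
  unfold conjLap
  fun_prop

theorem contDiffAt_flux (hw : ContDiff ℝ ∞ w) (j : Fin n) {x : EuclideanSpace ℝ (Fin n)}
    (hx : x ≠ 0) :
    ContDiffAt ℝ ∞ (flux α τ w j) x := by
  have h₁ := (contDiff_gradSq hw).contDiffAt (x := x)
  have h₂ := (contDiff_euler hw).contDiffAt (x := x)
  have h₃ := contDiffAt_phase (α := α) (τ := τ) hx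
  have h₄ := contDiffAt_symCoeff (α := α) (τ := τ) hx
  have h₅ : ContDiffAt ℝ ∞ (fun y : EuclideanSpace ℝ (Fin n) => ‖y‖ ^ 2) x :=
    (contDiff_norm_sq ℝ).contDiffAt
  have h₆ := hw.contDiffAt (x := x)
  have h₇ := (contDiff_pderiv hw j).contDiffAt (x := x)
  have h₈ := contDiffAt_normSq_rpow (-(n : ℝ) / 2) hx
  have h₉ : ContDiffAt ℝ ∞ (fun y : EuclideanSpace ℝ (Fin n) => y j) x :=
    (EuclideanSpace.proj j : EuclideanSpace ℝ (Fin n) →L[ℝ] ℝ).contDiff.contDiffAt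
  unfold flux
  fun_prop

theorem pderiv_flux (hw : ContDiff ℝ ∞ w) (j : Fin n) {x : EuclideanSpace ℝ (Fin n)} (hx : x ≠ 0) :
    pderiv j (flux α τ w j) x = (‖x‖ ^ 2) ^ (-(n : ℝ) / 2) *
      (((2 * phase α τ x - n) * (‖x‖ ^ 2 * gradSq w x) +
          (α ^ 2 * phase α τ x - symCoeff α τ x * (2 * phase α τ x - n)) * w x ^ 2) *
          (1 - n * x j ^ 2 / ‖x‖ ^ 2)
        + x j ^ 2 / ‖x‖ ^ 2 * ((2 * α * phase α τ x + 2 * (2 * phase α τ x - n)) *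
          (‖x‖ ^ 2 * gradSq w x) + (α ^ 3 * phase α τ x -
            α * phase α τ x * (2 * phase α τ x - n) ^ 2
            - 2 * α * phase α τ x * symCoeff α τ x) * w x ^ 2)
        + 2 * (2 * phase α τ x - n) * ‖x‖ ^ 2 *
          (x j * ∑ i, pderiv i w x * pderiv j (pderiv i w) x)
        + 2 * (α ^ 2 * phase α τ x - symCoeff α τ x * (2 * phase α τ x - n)) * w x *
          (x j * pderiv j w x)
        + (n - 2) * (2 * (2 * phase α τ x - n) * euler w x + 2 * α * phase α τ x * w x) *
          (x j * pderiv j w x)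
        - (4 * α * phase α τ x * euler w x + 2 * α ^ 2 * phase α τ x * w x) *
          (x j * pderiv j w x)
        - ‖x‖ ^ 2 * (2 * (2 * phase α τ x - n) + 2 * α * phase α τ x) * pderiv j w x ^ 2
        - 2 * ‖x‖ ^ 2 * (2 * phase α τ x - n) *
          (pderiv j w x * ∑ i, x i * pderiv j (pderiv i w) x)
        - ‖x‖ ^ 2 * (2 * (2 * phase α τ x - n) * euler w x + 2 * α * phase α τ x * w x) *
          pderiv j (pderiv j w) x) := by
  have hs : ‖x‖ ^ 2 ≠ 0 := by simpa using hx
  have hP := hasLineDerivAt_phase (α := α) (τ := τ) j hx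
  have hb := (hP.const_mul 2).sub_const (n : ℝ)
  have hq : HasLineDerivAt ℝ (symCoeff (n := n) α τ)
      (1 / 4 * (2 * (2 * phase α τ x - n) * (2 * (α * phase α τ x * (x j / ‖x‖ ^ 2))))) x
      (EuclideanSpace.single j 1) := by
    have := (hb.pow_two.sub_const (((n : ℝ) - 2) ^ 2)).const_mul (1 / 4)
    have he : symCoeff (n := n) α τ =
        fun y => 1 / 4 * ((2 * phase α τ y - n) ^ 2 - ((n : ℝ) - 2) ^ 2) := by
      funext y
      simp only [symCoeff]
      ring
    rw [he]
    exact this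
  have hx₁ := hasLineDerivAt_coord j j x
  have hn := hasLineDerivAt_normSq j x
  have hw₁ := hasLineDerivAt_pderiv (hw.differentiable (by simp) x) j
  have hwj := hasLineDerivAt_pderiv ((contDiff_pderiv hw j).differentiable (by simp) x) j
  have hD := hasLineDerivAt_euler hw j x
  have hN := hasLineDerivAt_gradSq hw j x
  have hρ := hasLineDerivAt_normSq_rpow (-(n : ℝ) / 2) j hx
  have h := hρ.mul ((hx₁.mul ((hb.mul (hn.mul hN)).add
    (((hP.const_mul (α ^ 2)).sub (hq.mul hb)).mul hw₁.pow_two))).sub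
    (hn.mul ((((hb.mul hD).const_mul 2).add ((hP.mul hw₁).const_mul (2 * α))).mul hwj)))
  rw [(hasLineDerivAt_pderiv ((contDiffAt_flux hw j hx).differentiableAt (by simp)) j).unique h]
  simp only [if_true]
  field_simp
  ring

theorem sum_coord_sq (x : EuclideanSpace ℝ (Fin n)) : ∑ j, x j ^ 2 = ‖x‖ ^ 2 := by
  simp [EuclideanSpace.norm_sq_eq]

/-- The divergence identity behind the Carleman estimate. -/
theorem sum_pderiv_flux (hw : ContDiff ℝ ∞ w) {x : EuclideanSpace ℝ (Fin n)} (hx : x ≠ 0) :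
    ∑ j, pderiv j (flux α τ w j) x = (‖x‖ ^ 2) ^ (-(n : ℝ) / 2) *
      (-(2 * (2 * phase α τ x - n) * euler w x + 2 * α * phase α τ x * w x) *
          (‖x‖ ^ 2 * lap w x - (n - 2) * euler w x + symCoeff α τ x * w x)
        - 4 * α * phase α τ x * euler w x ^ 2
        - α * phase α τ x * ((2 * phase α τ x - n) ^ 2 - α ^ 2) * w x ^ 2) := by
  have hs : ‖x‖ ^ 2 ≠ 0 := by simpa using hx
  have hR : ∑ j, x j * ∑ i, pderiv i w x * pderiv j (pderiv i w) x =
      ∑ j, pderiv j w x * ∑ i, x i * pderiv j (pderiv i w) x := by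
    simp only [Finset.mul_sum]
    rw [Finset.sum_comm]
    refine Finset.sum_congr rfl fun i _ => Finset.sum_congr rfl fun j _ => ?_
    rw [pderiv_comm hw i j]
    ring
  simp only [pderiv_flux hw _ hx]
  simp only [← Finset.mul_sum, Finset.sum_add_distrib, Finset.sum_sub_distrib, ← Finset.sum_mul,
    ← Finset.sum_div, sum_coord_sq, hR]
  rw [← euler, ← gradSq, ← lap]
  simp only [Finset.sum_const, Finset.card_univ, Fintype.card_fin, nsmul_eq_mul]
  field_simp
  ring

theorem pointwise_estimate (hα : 0 < α) (hτ : n + α ≤ α * τ) (hw : ContDiff ℝ ∞ w)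
    {x : EuclideanSpace ℝ (Fin n)}
    (hx : 1 < ‖x‖) :
    2 * α ^ 4 * τ ^ 3 * ((‖x‖ ^ 2) ^ (-(n : ℝ) / 2) * (‖x‖ ^ 2) ^ (3 * α / 2) * w x ^ 2) +
        2 * ∑ j, pderiv j (flux α τ w j) x ≤
      (‖x‖ ^ 2) ^ (-(n : ℝ) / 2) * conjLap α τ w x ^ 2 := by
  have hx0 : x ≠ 0 := by
    rintro rfl
    norm_num at hx
  have hs : 1 ≤ ‖x‖ ^ 2 := one_le_pow₀ hx.le
  have hρ : 0 ≤ (‖x‖ ^ 2) ^ (-(n : ℝ) / 2) := by positivity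
  have hατ : 0 ≤ α * τ := by linarith [n.cast_nonneg (α := ℝ)]
  have hP : n + α ≤ phase α τ x :=
    hτ.trans (le_mul_of_one_le_right hατ (one_le_rpow hs (by positivity)))
  have hP0 : 0 ≤ phase α τ x := by linarith [n.cast_nonneg (α := ℝ)]
  have hcube : phase α τ x ^ 3 = α ^ 3 * τ ^ 3 * (‖x‖ ^ 2) ^ (3 * α / 2) := by
    rw [phase, mul_pow, mul_pow, ← rpow_mul_natCast (by positivity)]
    congr 2
    push_cast
    ring
  have hquad : phase α τ x ^ 2 ≤ (2 * phase α τ x - n) ^ 2 - α ^ 2 := by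
    nlinarith [n.cast_nonneg (α := ℝ)]
  have hmain : 2 * α ^ 4 * τ ^ 3 * (‖x‖ ^ 2) ^ (3 * α / 2) * w x ^ 2 ≤
      2 * α * phase α τ x * ((2 * phase α τ x - n) ^ 2 - α ^ 2) * w x ^ 2 := by
    calc _ = 2 * α * phase α τ x * phase α τ x ^ 2 * w x ^ 2 := by
          linear_combination -2 * α * w x ^ 2 * hcube
      _ ≤ _ := by gcongr
  have hsq : 0 ≤ 8 * α * phase α τ x * euler w x ^ 2 := by positivity
  rw [sum_pderiv_flux hw hx0]
  calc _ = (‖x‖ ^ 2) ^ (-(n : ℝ) / 2) *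
        (2 * α ^ 4 * τ ^ 3 * (‖x‖ ^ 2) ^ (3 * α / 2) * w x ^ 2 + 2 *
        (-(2 * (2 * phase α τ x - n) * euler w x + 2 * α * phase α τ x * w x) *
          (‖x‖ ^ 2 * lap w x - (n - 2) * euler w x + symCoeff α τ x * w x)
        - 4 * α * phase α τ x * euler w x ^ 2
        - α * phase α τ x * ((2 * phase α τ x - n) ^ 2 - α ^ 2) * w x ^ 2)) := by ring
    _ ≤ _ := by
      refine mul_le_mul_of_nonneg_left ?_ hρ
      have := sq_nonneg (‖x‖ ^ 2 * lap w x - (n - 2) * euler w x + symCoeff α τ x * w x +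
        ((2 * phase α τ x - n) * euler w x + α * phase α τ x * w x))
      simp only [conjLap]
      linarith

theorem conjugated_estimate (hα : 0 < α) (hτ : n + α ≤ α * τ) (hw : ContDiff ℝ ∞ w)
    (hc : HasCompactSupport w) (hsupp : tsupport w ⊆ {x | 1 < ‖x‖}) :
    2 * α ^ 4 * τ ^ 3 *
        ∫ x, (‖x‖ ^ 2) ^ (-(n : ℝ) / 2) * (‖x‖ ^ 2) ^ (3 * α / 2) * w x ^ 2 ≤
      ∫ x, (‖x‖ ^ 2) ^ (-(n : ℝ) / 2) * conjLap α τ w x ^ 2 := by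
  have h0 : (0 : EuclideanSpace ℝ (Fin n)) ∉ tsupport w := fun h => by
    have := hsupp h
    norm_num at this
  have hflux : ∀ j, ∀ x ∉ tsupport w, flux α τ w j x = 0 := fun j x hx => by
    simp [flux, gradSq_eq_zero hx, pderiv_eq_zero j hx, image_eq_zero_of_notMem_tsupport hx]
  have hfluxc : ∀ j, ContDiff ℝ ∞ (flux α τ w j) := fun j =>
    contDiff_of_eq_zero_off (isClosed_tsupport w) h0 (fun x hx => contDiffAt_flux hw j hx) (hflux j)
  have hfluxs : ∀ j, HasCompactSupport (flux α τ w j) := fun j =>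
    HasCompactSupport.intro hc (hflux j)
  have hfluxi : ∀ j, Integrable (pderiv j (flux α τ w j)) := fun j =>
    (contDiff_pderiv (hfluxc j) j).continuous.integrable_of_hasCompactSupport
      ((hfluxs j).mono' (subset_tsupport _ |>.trans (tsupport_pderiv_subset _ j)))
  have hdiv : ∫ x, ∑ j, pderiv j (flux α τ w j) x = 0 := by
    rw [integral_finsetSum _ fun j _ => hfluxi j]
    exact Finset.sum_eq_zero fun j _ => integral_pderiv_eq_zero (hfluxc j) (hfluxs j) j
  have hl : Integrable fun x : EuclideanSpace ℝ (Fin n) =>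
      (‖x‖ ^ 2) ^ (-(n : ℝ) / 2) * (‖x‖ ^ 2) ^ (3 * α / 2) * w x ^ 2 :=
    integrable_of_eq_zero_off hc h0
      (fun x hx => ((contDiffAt_normSq_rpow _ hx).mul (contDiffAt_normSq_rpow _ hx)).mul
        (hw.contDiffAt.pow 2))
      (fun x hx => by simp [image_eq_zero_of_notMem_tsupport hx])
  have hzero : ∀ x ∉ tsupport w, conjLap α τ w x = 0 := fun x hx => by
    simp [conjLap, lap_eq_zero hx, euler_eq_zero hx, image_eq_zero_of_notMem_tsupport hx]
  have hr : Integrable fun x : EuclideanSpace ℝ (Fin n) =>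
      (‖x‖ ^ 2) ^ (-(n : ℝ) / 2) * conjLap α τ w x ^ 2 :=
    integrable_of_eq_zero_off hc h0
      (fun x hx => (contDiffAt_normSq_rpow _ hx).mul ((contDiffAt_conjLap hw hx).pow 2))
      (fun x hx => by simp [hzero x hx])
  have hd : Integrable fun x => ∑ j, pderiv j (flux α τ w j) x :=
    integrable_finsetSum _ fun j _ => hfluxi j
  have hle := integral_mono ((hl.const_mul (2 * α ^ 4 * τ ^ 3)).add (hd.const_mul 2)) hr
    fun x => by
      by_cases hx : x ∈ tsupport w
      · exact pointwise_estimate hα hτ hw (hsupp hx)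
      · have hd0 : ∀ j, pderiv j (flux α τ w j) x = 0 := fun j =>
          pderiv_eq_zero j fun h => hx
            (closure_minimal (Function.support_subset_iff'.2 (hflux j)) (isClosed_tsupport w) h)
        simp [hd0, hzero x hx, image_eq_zero_of_notMem_tsupport hx]
  simp only [Pi.add_apply] at hle
  rw [integral_add (hl.const_mul _) (hd.const_mul 2), integral_const_mul, integral_const_mul,
    hdiv] at hle
  simpa using hle

end identities

section conjugation

variable {α τ : ℝ} {u : EuclideanSpace ℝ (Fin n) → ℝ}

/-- The factor `e^ψ` with `ψ = τ|x|^α - log |x|`. -/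
noncomputable def weight (α τ : ℝ) (x : EuclideanSpace ℝ (Fin n)) : ℝ :=
  Real.exp (τ * (‖x‖ ^ 2) ^ (α / 2)) * (‖x‖ ^ 2) ^ (-1 / 2 : ℝ)

theorem contDiffAt_weight {x : EuclideanSpace ℝ (Fin n)} (hx : x ≠ 0) :
    ContDiffAt ℝ ∞ (weight (n := n) α τ) x :=
  (contDiffAt_const.mul (contDiffAt_normSq_rpow _ hx)).exp.mul (contDiffAt_normSq_rpow _ hx)

theorem hasLineDerivAt_weight (j : Fin n) {x : EuclideanSpace ℝ (Fin n)} (hx : x ≠ 0) :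
    HasLineDerivAt ℝ (weight α τ) (weight α τ x * (phase α τ x - 1) * (x j / ‖x‖ ^ 2)) x
      (EuclideanSpace.single j 1) := by
  refine (((hasLineDerivAt_normSq_rpow (α / 2) j hx).const_mul τ).exp.mul
    (hasLineDerivAt_normSq_rpow (-1 / 2) j hx)).congr_deriv ?_
  simp only [weight, phase]
  ring

theorem pderiv_weight_mul (hu : ContDiff ℝ ∞ u) (j : Fin n) {x : EuclideanSpace ℝ (Fin n)}
    (hx : x ≠ 0) :
    pderiv j (fun y => weight α τ y * u y) x =
      weight α τ x * (pderiv j u x + (phase α τ x - 1) * (x j * (‖x‖ ^ 2) ^ (-1 : ℝ)) * u x) := by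
  have h := (hasLineDerivAt_weight (α := α) (τ := τ) j hx).mul
    (hasLineDerivAt_pderiv (hu.differentiable (by simp) x) j)
  have hd : DifferentiableAt ℝ (fun y => weight α τ y * u y) x :=
    ((contDiffAt_weight hx).mul hu.contDiffAt).differentiableAt (by simp)
  rw [(hasLineDerivAt_pderiv hd j).unique h, rpow_neg_one]
  ring

theorem pderiv_pderiv_weight_mul (hu : ContDiff ℝ ∞ u)
    (hwu : ContDiff ℝ ∞ fun y => weight α τ y * u y) (j : Fin n)
    {x : EuclideanSpace ℝ (Fin n)} (hx : x ≠ 0) :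
    pderiv j (pderiv j fun y => weight α τ y * u y) x =
      weight α τ x * (pderiv j (pderiv j u) x
        + 2 * (phase α τ x - 1) / ‖x‖ ^ 2 * (x j * pderiv j u x)
        + (phase α τ x - 1) / ‖x‖ ^ 2 * u x
        + ((phase α τ x - 1) ^ 2 + α * phase α τ x - 2 * (phase α τ x - 1)) / (‖x‖ ^ 2) ^ 2 *
          u x * x j ^ 2) := by
  have hs : ‖x‖ ^ 2 ≠ 0 := by simpa using hx
  have hd := (contDiff_pderiv hwu j).differentiable (by simp) x
  have he : (pderiv j fun y => weight α τ y * u y) =ᶠ[nhds x] fun y => weight α τ y *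
      (pderiv j u y + (phase α τ y - 1) * (y j * (‖y‖ ^ 2) ^ (-1 : ℝ)) * u y) := by
    filter_upwards [isOpen_ne.mem_nhds hx] with y hy using pderiv_weight_mul hu j hy
  have h := (hasLineDerivAt_weight (α := α) (τ := τ) j hx).mul
    ((hasLineDerivAt_pderiv ((contDiff_pderiv hu j).differentiable (by simp) x) j).add
      ((((hasLineDerivAt_phase (α := α) (τ := τ) j hx).sub_const 1).mul
        ((hasLineDerivAt_coord j j x).mul (hasLineDerivAt_normSq_rpow (-1) j hx))).mul
        (hasLineDerivAt_pderiv (hu.differentiable (by simp) x) j)))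
  rw [(hasLineDerivAt_pderiv hd j).unique (h.congr_of_eventuallyEq he), rpow_neg_one]
  simp only [if_true]
  field_simp
  ring

theorem conjLap_weight_mul (hu : ContDiff ℝ ∞ u)
    (hwu : ContDiff ℝ ∞ fun y => weight α τ y * u y)
    {x : EuclideanSpace ℝ (Fin n)} (hx : x ≠ 0) :
    conjLap α τ (fun y => weight α τ y * u y) x = weight α τ x * (‖x‖ ^ 2 * lap u x) := by
  have hs : ‖x‖ ^ 2 ≠ 0 := by simpa using hx
  have hD : euler (fun y => weight α τ y * u y) x =
      weight α τ x * (euler u x + (phase α τ x - 1) * u x) := by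
    have : ∀ j, x j * pderiv j (fun y => weight α τ y * u y) x = weight α τ x *
        (x j * pderiv j u x + (phase α τ x - 1) * (‖x‖ ^ 2)⁻¹ * u x * x j ^ 2) := fun j => by
      rw [pderiv_weight_mul hu j hx, rpow_neg_one]
      ring
    simp only [euler, this, ← Finset.mul_sum, Finset.sum_add_distrib, sum_coord_sq]
    field_simp
  have hL : lap (fun y => weight α τ y * u y) x = weight α τ x * (lap u x
        + 2 * (phase α τ x - 1) / ‖x‖ ^ 2 * euler u x
        + n * ((phase α τ x - 1) / ‖x‖ ^ 2 * u x)
        + ((phase α τ x - 1) ^ 2 + α * phase α τ x - 2 * (phase α τ x - 1)) / (‖x‖ ^ 2) ^ 2 *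
          u x * ‖x‖ ^ 2) := by
    simp only [lap, pderiv_pderiv_weight_mul hu hwu _ hx, ← Finset.mul_sum,
      Finset.sum_add_distrib, sum_coord_sq, euler, Finset.sum_const, Finset.card_univ,
      Fintype.card_fin, nsmul_eq_mul]
    ring
  simp only [conjLap, hD, hL, symCoeff]
  field_simp
  ring

end conjugation

theorem real_estimate {α τ : ℝ} {u : EuclideanSpace ℝ (Fin n) → ℝ} (hα : 0 < α)
    (hτ : n + α ≤ α * τ) (hu : ContDiff ℝ ∞ u) (hc : HasCompactSupport u)
    (hsupp : tsupport u ⊆ {x | 1 < ‖x‖}) :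
    2 * α ^ 4 * τ ^ 3 *
        ∫ x, u x ^ 2 * ‖x‖ ^ (3 * α - 2 - (n : ℝ)) * Real.exp (2 * τ * ‖x‖ ^ α) ≤
      ∫ x, lap u x ^ 2 * ‖x‖ ^ (2 - (n : ℝ)) * Real.exp (2 * τ * ‖x‖ ^ α) := by
  have h0 : (0 : EuclideanSpace ℝ (Fin n)) ∉ tsupport u := fun h => by
    have := hsupp h
    norm_num at this
  set w : EuclideanSpace ℝ (Fin n) → ℝ := fun x => weight α τ x * u x with hwdef
  have hw : ContDiff ℝ ∞ w := contDiff_of_eq_zero_off (isClosed_tsupport u) h0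
    (fun x hx => (contDiffAt_weight hx).mul hu.contDiffAt)
    (fun x hx => by simp [w, image_eq_zero_of_notMem_tsupport hx])
  have hwu : tsupport w ⊆ tsupport u := tsupport_mul_subset_right
  have hpow : ∀ (x : EuclideanSpace ℝ (Fin n)) (p : ℝ), (‖x‖ ^ 2) ^ p = ‖x‖ ^ (2 * p) :=
    fun x p => by
      rw [← rpow_natCast, ← rpow_mul (norm_nonneg x)]
      norm_num
  have hweight : ∀ x : EuclideanSpace ℝ (Fin n),
      weight α τ x ^ 2 = Real.exp (2 * τ * ‖x‖ ^ α) * ‖x‖ ^ (-2 : ℝ) := fun x => by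
    rw [weight, mul_pow, ← Real.exp_nat_mul, ← rpow_mul_natCast (by positivity), hpow, hpow]
    push_cast
    ring_nf
  have h := conjugated_estimate hα hτ hw (hc.mono' ((subset_tsupport _).trans hwu))
    (hwu.trans hsupp)
  have hpos : ∀ x ∈ tsupport u, x ≠ 0 := fun x hx h => h0 (h ▸ hx)
  refine (le_of_eq ?_).trans (h.trans (le_of_eq ?_))
  · congr 2
    funext x
    by_cases hx : x ∈ tsupport u
    · have hx' : 0 < ‖x‖ := norm_pos_iff.2 (hpos x hx)
      rw [hwdef, mul_pow, hweight, hpow, hpow,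
        show 3 * α - 2 - (n : ℝ) = 2 * (-(n : ℝ) / 2) + 2 * (3 * α / 2) + (-2) by ring,
        rpow_add hx', rpow_add hx']
      ring
    · simp [w, image_eq_zero_of_notMem_tsupport hx]
  · congr 1
    funext x
    by_cases hx : x ∈ tsupport u
    · have hx' : 0 < ‖x‖ := norm_pos_iff.2 (hpos x hx)
      rw [conjLap_weight_mul hu hw (hpos x hx), mul_pow, hweight, hpow,
        show 2 - (n : ℝ) = 2 * (-(n : ℝ) / 2) + (-2) + (4 : ℕ) by push_cast; ring,
        rpow_add hx', rpow_add hx', rpow_natCast]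
      ring
    · have hx' : x ∉ tsupport w := fun h => hx (hwu h)
      simp [conjLap, lap_eq_zero hx', euler_eq_zero hx', lap_eq_zero hx,
        image_eq_zero_of_notMem_tsupport hx']

theorem apply_laplacian {v : EuclideanSpace ℝ (Fin n) → ℂ} (hv : ContDiff ℝ ∞ v) (L : ℂ →L[ℝ] ℝ)
    (x : EuclideanSpace ℝ (Fin n)) : L (laplacian v x) = lap (fun y => L (v y)) x := by
  have h : ∀ {f : EuclideanSpace ℝ (Fin n) → ℂ}, ContDiff ℝ ∞ f → ∀ i y,
      pderiv i (fun y => L (f y)) y = L (pderiv i f y) := fun {f} hf i y => by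
    change fderiv ℝ (L ∘ f) y _ = _
    rw [(L.hasFDerivAt.comp y (hf.differentiable (by simp) y).hasFDerivAt).fderiv]
    rfl
  have hL : laplacian v x = ∑ i, pderiv i (pderiv i v) x := rfl
  rw [hL, map_sum, lap]
  refine Finset.sum_congr rfl fun i _ => ?_
  rw [show (pderiv i fun y => L (v y)) = fun y => L (pderiv i v y) from funext (h hv i),
    h (contDiff_pderiv hv i)]

theorem integrable_sq_weight {f : EuclideanSpace ℝ (Fin n) → ℝ} {α τ p : ℝ}
    {K : Set (EuclideanSpace ℝ (Fin n))} (hK : IsCompact K) (h0 : 0 ∉ K) (hf : ContDiff ℝ ∞ f)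
    (hz : ∀ x ∉ K, f x = 0) :
    Integrable fun x => f x ^ 2 * ‖x‖ ^ p * Real.exp (2 * τ * ‖x‖ ^ α) := by
  refine integrable_of_eq_zero_off hK h0 (fun x hx => ?_) (fun x hx => by simp [hz x hx])
  have hn : ∀ q : ℝ, ContDiffAt ℝ ∞ (fun y : EuclideanSpace ℝ (Fin n) => ‖y‖ ^ q) x := fun q =>
    (contDiffAt_norm ℝ hx).rpow_const_of_ne (norm_ne_zero_iff.2 hx)
  exact ((hf.contDiffAt.pow 2).mul (hn p)).mul (contDiffAt_const.mul (hn α)).exp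

end MeshkovCarleman

open MeshkovCarleman

/-- **Meshkov's Carleman inequality** (Lemma 1 of Meshkov, 1991).
For `2/3 < α ≤ 2` there exist `τ₀ > 0` and `C = C_α > 0` such that for all smooth `v`
compactly supported in `{|x| > 1}` and all `τ > τ₀`,
`τ³ ∫ |v|² |x|^{3α−2−n} e^{2τ|x|^α} dx ≤ C ∫ |Δv|² |x|^{2−n} e^{2τ|x|^α} dx`. -/
theorem meshkov_carleman_inequality (n : ℕ) (hn : 1 ≤ n) (α : ℝ)
    (hα₁ : 2 / 3 < α) (hα₂ : α ≤ 2) :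
    ∃ τ₀ : ℝ, 0 < τ₀ ∧ ∃ C : ℝ, 0 < C ∧
      ∀ v : EuclideanSpace ℝ (Fin n) → ℂ,
        ContDiff ℝ (⊤ : ℕ∞) v → HasCompactSupport v → tsupport v ⊆ {x | 1 < ‖x‖} →
        ∀ τ : ℝ, τ₀ < τ →
        τ ^ 3 * ∫ x, ‖v x‖ ^ 2 * ‖x‖ ^ (3 * α - 2 - (n : ℝ)) * Real.exp (2 * τ * ‖x‖ ^ α)
          ≤ C * ∫ x, ‖laplacian v x‖ ^ 2 * ‖x‖ ^ (2 - (n : ℝ)) * Real.exp (2 * τ * ‖x‖ ^ α) := by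
  have hα : 0 < α := by linarith
  refine ⟨(n + α) / α, by positivity, 1 / (2 * α ^ 4), by positivity, ?_⟩
  intro v hv hc hsupp τ hτ
  have hτ' : n + α ≤ α * τ := by
    rw [div_lt_iff₀ hα] at hτ
    linarith
  have h0 : (0 : EuclideanSpace ℝ (Fin n)) ∉ tsupport v := fun h => by
    have := hsupp h
    norm_num at this
  have hsub : ∀ L : ℂ →L[ℝ] ℝ, tsupport (fun x => L (v x)) ⊆ tsupport v := fun L =>
    tsupport_comp_subset (map_zero L) v
  have hcd : ∀ L : ℂ →L[ℝ] ℝ, ContDiff ℝ ∞ fun x => L (v x) := fun L => L.contDiff.comp hv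
  have hest : ∀ L : ℂ →L[ℝ] ℝ, _ := fun L => real_estimate hα hτ' (hcd L)
    (hc.mono' ((subset_tsupport _).trans (hsub L))) ((hsub L).trans hsupp)
  have hint : ∀ L : ℂ →L[ℝ] ℝ, Integrable fun x => L (v x) ^ 2 *
      ‖x‖ ^ (3 * α - 2 - (n : ℝ)) * Real.exp (2 * τ * ‖x‖ ^ α) := fun L =>
    integrable_sq_weight hc h0 (hcd L) fun x hx => by
      simp [image_eq_zero_of_notMem_tsupport hx]
  have hint' : ∀ L : ℂ →L[ℝ] ℝ, Integrable fun x => lap (fun y => L (v y)) x ^ 2 *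
      ‖x‖ ^ (2 - (n : ℝ)) * Real.exp (2 * τ * ‖x‖ ^ α) := fun L =>
    integrable_sq_weight hc h0 (contDiff_lap (hcd L)) fun x hx =>
      lap_eq_zero fun h => hx (hsub L h)
  have hsq : ∀ z : ℂ, ‖z‖ ^ 2 = Complex.reCLM z ^ 2 + Complex.imCLM z ^ 2 := fun z => by
    rw [Complex.sq_norm, Complex.normSq_apply, Complex.reCLM_apply, Complex.imCLM_apply]
    ring
  simp only [hsq, apply_laplacian hv, add_mul]
  rw [integral_add (hint _) (hint _), integral_add (hint' _) (hint' _), one_div,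
    ← div_eq_inv_mul, le_div_iff₀ (by positivity)]
  linarith [hest Complex.reCLM, hest Complex.imCLM]
end

section
/- For every dimension n ≥ 1 there are positive constants C₁, C₂, C₃ (depending only on n) and an increasing function w : (0,10) → (0,∞) satisfying 1/C₁ ≤ w(r)/r ≤ C₁ for all 0 < r < 10, such that for every smooth function f compactly supported in B(0,10) ∖ {0} ⊂ ℝⁿ and every a > C₂ one has a³ ∫_{ℝⁿ} w(|x|)^{−1−2a} |f(x)|² dx ≤ C₃ ∫_{ℝⁿ} w(|x|)^{2−2a} |Δf(x)|² dx. -/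
open MeasureTheory Real

/-- The `i`-th partial derivative of a real-valued function on `ℝⁿ`. -/
noncomputable def partialDeriv {n : ℕ} (i : Fin n) (u : EuclideanSpace ℝ (Fin n) → ℝ)
    (x : EuclideanSpace ℝ (Fin n)) : ℝ :=
  fderiv ℝ u x (EuclideanSpace.single i 1)

section PartialDeriv

variable {n : ℕ} {i : Fin n} {u v : EuclideanSpace ℝ (Fin n) → ℝ} {x : EuclideanSpace ℝ (Fin n)}

theorem partialDeriv_mul (hu : DifferentiableAt ℝ u x) (hv : DifferentiableAt ℝ v x) :
    partialDeriv i (fun y => u y * v y) x = u x * partialDeriv i v x + partialDeriv i u x * v x := by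
  simp [partialDeriv, fderiv_fun_mul hu hv, mul_comm]

theorem partialDeriv_add (hu : DifferentiableAt ℝ u x) (hv : DifferentiableAt ℝ v x) :
    partialDeriv i (fun y => u y + v y) x = partialDeriv i u x + partialDeriv i v x := by
  simp [partialDeriv, fderiv_fun_add hu hv]

theorem partialDeriv_sub (hu : DifferentiableAt ℝ u x) (hv : DifferentiableAt ℝ v x) :
    partialDeriv i (fun y => u y - v y) x = partialDeriv i u x - partialDeriv i v x := by
  simp [partialDeriv, fderiv_fun_sub hu hv]

theorem partialDeriv_const_mul (c : ℝ) (hu : DifferentiableAt ℝ u x) :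
    partialDeriv i (fun y => c * u y) x = c * partialDeriv i u x := by
  simp [partialDeriv, fderiv_const_mul hu]

theorem partialDeriv_sum {ι : Type*} {s : Finset ι} {A : ι → EuclideanSpace ℝ (Fin n) → ℝ}
    (hA : ∀ j ∈ s, DifferentiableAt ℝ (A j) x) :
    partialDeriv i (fun y => ∑ j ∈ s, A j y) x = ∑ j ∈ s, partialDeriv i (A j) x := by
  simp [partialDeriv, fderiv_fun_sum hA]

theorem partialDeriv_coord (j : Fin n) :
    partialDeriv i (fun y => y j) x = if j = i then 1 else 0 := by
  have h : HasFDerivAt (fun y : EuclideanSpace ℝ (Fin n) => y j)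
      (EuclideanSpace.proj j : EuclideanSpace ℝ (Fin n) →L[ℝ] ℝ) x :=
    (EuclideanSpace.proj j : EuclideanSpace ℝ (Fin n) →L[ℝ] ℝ).hasFDerivAt
  simp [partialDeriv, h.fderiv]

theorem partialDeriv_norm (hx : x ≠ 0) : partialDeriv i (fun y => ‖y‖) x = x i / ‖x‖ := by
  have h1 : partialDeriv i (fun y => ‖y‖ ^ 2) x = 2 * x i := by
    simp [partialDeriv, EuclideanSpace.inner_single_right]
  have hd : DifferentiableAt ℝ (fun y : EuclideanSpace ℝ (Fin n) => ‖y‖) x :=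
    (contDiffAt_norm ℝ (n := 1) hx).differentiableAt (by simp)
  have h2 := partialDeriv_mul (i := i) hd hd
  simp only [← sq] at h2
  rw [h1] at h2
  field_simp [norm_ne_zero_iff.2 hx]
  linarith

theorem differentiableAt_radial {g : ℝ → ℝ} (hx : x ≠ 0) (hg : DifferentiableAt ℝ g ‖x‖) :
    DifferentiableAt ℝ (fun y : EuclideanSpace ℝ (Fin n) => g ‖y‖) x :=
  hg.comp (f := fun y : EuclideanSpace ℝ (Fin n) => ‖y‖) x
    ((contDiffAt_norm ℝ (n := 1) hx).differentiableAt (by simp))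

theorem partialDeriv_radial {g : ℝ → ℝ} {g' : ℝ} (hx : x ≠ 0) (hg : HasDerivAt g g' ‖x‖) :
    partialDeriv i (fun y => g ‖y‖) x = g' * (x i / ‖x‖) := by
  have hd : DifferentiableAt ℝ (fun y : EuclideanSpace ℝ (Fin n) => ‖y‖) x :=
    (contDiffAt_norm ℝ (n := 1) hx).differentiableAt (by simp)
  have h := hg.comp_hasFDerivAt x hd.hasFDerivAt
  rw [← partialDeriv_norm hx, partialDeriv]
  change fderiv ℝ (g ∘ fun y => ‖y‖) x _ = _
  rw [h.fderiv]
  simp [partialDeriv]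

theorem partialDeriv_congr (h : u =ᶠ[nhds x] v) :
    partialDeriv i u x = partialDeriv i v x := by
  rw [partialDeriv, h.fderiv_eq, partialDeriv]

theorem partialDeriv_eventuallyEq (h : u =ᶠ[nhds x] v) :
    partialDeriv i u =ᶠ[nhds x] partialDeriv i v :=
  h.eventually_nhds.mono fun _ hy => partialDeriv_congr hy

theorem partialDeriv_of_notMem_tsupport (hx : x ∉ tsupport u) : partialDeriv i u x = 0 := by
  rw [partialDeriv, fderiv_of_notMem_tsupport ℝ hx]
  simp

theorem contDiff_partialDeriv (hu : ContDiff ℝ (⊤ : ℕ∞) u) :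
    ContDiff ℝ (⊤ : ℕ∞) (partialDeriv i u) :=
  (hu.fderiv_right (m := (⊤ : ℕ∞)) (by simp)).clm_apply contDiff_const

theorem partialDeriv_comm (hu : ContDiff ℝ (⊤ : ℕ∞) u) (j : Fin n) :
    partialDeriv i (partialDeriv j u) x = partialDeriv j (partialDeriv i u) x := by
  have hs : IsSymmSndFDerivAt ℝ u x :=
    hu.contDiffAt.isSymmSndFDerivAt (by simpa using WithTop.coe_le_coe.2 (le_top : (2 : ℕ∞) ≤ ⊤))
  have hd : DifferentiableAt ℝ (fderiv ℝ u) x :=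
    (hu.fderiv_right (m := (⊤ : ℕ∞)) (by simp)).differentiable (by simp) x
  have key : ∀ k l : Fin n, partialDeriv k (partialDeriv l u) x =
      fderiv ℝ (fderiv ℝ u) x (EuclideanSpace.single k 1) (EuclideanSpace.single l 1) := by
    intro k l
    have h := hd.hasFDerivAt.clm_apply
      (hasFDerivAt_const (EuclideanSpace.single l (1 : ℝ)) x)
    rw [partialDeriv]
    change fderiv ℝ (fun y => fderiv ℝ u y (EuclideanSpace.single l 1)) x _ = _
    rw [h.fderiv]
    simp
  rw [key, key, hs.eq]

theorem integrable_partialDeriv (hu : ContDiff ℝ (⊤ : ℕ∞) u) (hc : HasCompactSupport u) :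
    Integrable (partialDeriv i u) :=
  (contDiff_partialDeriv hu).continuous.integrable_of_hasCompactSupport
    (HasCompactSupport.intro hc fun _ hy => partialDeriv_of_notMem_tsupport hy)

theorem integral_partialDeriv_eq_zero (hu : ContDiff ℝ (⊤ : ℕ∞) u) (hc : HasCompactSupport u) :
    ∫ x, partialDeriv i u x = 0 := by
  have h := integral_mul_fderiv_eq_neg_fderiv_mul_of_integrable (μ := volume)
    (f := fun _ : EuclideanSpace ℝ (Fin n) => (1 : ℝ)) (g := u) (v := EuclideanSpace.single i 1)
    (by simp) (by simpa [partialDeriv] using! integrable_partialDeriv (i := i) hu hc)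
    (by simpa using! hu.continuous.integrable_of_hasCompactSupport hc)
    (fun _ _ => by fun_prop) (fun y _ => hu.differentiable (by simp) y)
  simpa [partialDeriv] using! h

end PartialDeriv

/-- A function smooth away from the origin times a smooth function vanishing near the origin
is smooth. -/
theorem contDiff_mul_of_zero_notMem_tsupport {E F : Type*} [NormedAddCommGroup E] [NormedSpace ℝ E]
    [NormedAddCommGroup F] [NormedSpace ℝ F]
    {g : E → ℝ} {u : E → F} (hg : ∀ x ≠ 0, ContDiffAt ℝ (⊤ : ℕ∞) g x)
    (hu : ContDiff ℝ (⊤ : ℕ∞) u) (h0 : (0 : E) ∉ tsupport u) :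
    ContDiff ℝ (⊤ : ℕ∞) (fun x => g x • u x) := by
  refine contDiff_iff_contDiffAt.2 fun x => ?_
  by_cases hx : x ∈ tsupport u
  · exact (hg x (fun h => h0 (h ▸ hx))).smul hu.contDiffAt
  · have h := notMem_tsupport_iff_eventuallyEq.1 hx
    refine (contDiffAt_const (c := (0 : F))).congr_of_eventuallyEq ?_
    filter_upwards [h] with y hy
    simp [hy]

/-- The algebraic identity behind the divergence of the Carleman vector field, where `d` and `H` are
the gradient and the Hessian of `v` at `x`. -/
theorem sum_divergence_identity {n : ℕ} (x d : Fin n → ℝ) (H : Fin n → Fin n → ℝ)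
    (hH : ∀ i j, H i j = H j i) (v Q R ρ : ℝ) (hρ : ∑ i, x i ^ 2 = ρ) :
    ∑ i, (d i * (d i + ∑ j, x j * H i j) + H i i * (∑ j, x j * d j)
        - (x i * (∑ j, d j * H i j) + 1 / 2 * ∑ j, d j ^ 2)
        + ((n : ℝ) - 2) / 2 * (v * H i i + d i * d i)
        + (x i * ((Q * v) * d i + (Q * d i + R * x i * v) * v) + (Q * v) * v) / 2) =
      ((∑ i, H i i) + Q * v) * ((∑ j, x j * d j) + ((n : ℝ) - 2) / 2 * v)
        + (Q + R * ρ / 2) * v ^ 2 := by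
  have e1 : ∑ i, d i * ∑ j, x j * H i j = ∑ i, x i * ∑ j, d j * H i j := by
    simp only [Finset.mul_sum]
    rw [Finset.sum_comm]
    refine Finset.sum_congr rfl fun i _ => Finset.sum_congr rfl fun j _ => ?_
    rw [hH]; ring
  have e2 : ∀ i, (d i * (d i + ∑ j, x j * H i j) + H i i * (∑ j, x j * d j)
        - (x i * (∑ j, d j * H i j) + 1 / 2 * ∑ j, d j ^ 2)
        + ((n : ℝ) - 2) / 2 * (v * H i i + d i * d i)
        + (x i * ((Q * v) * d i + (Q * d i + R * x i * v) * v) + (Q * v) * v) / 2) =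
      d i ^ 2 * (n / 2) + d i * ∑ j, x j * H i j - x i * (∑ j, d j * H i j)
       + H i i * ((∑ j, x j * d j) + ((n : ℝ) - 2) / 2 * v)
       + (x i * d i) * (Q * v) + x i ^ 2 * (R * v ^ 2 / 2) + (Q * v ^ 2 - ∑ j, d j ^ 2) / 2 := by
    intro i; ring
  simp only [e2, Finset.sum_add_distrib, Finset.sum_sub_distrib, ← Finset.sum_mul, e1, hρ]
  simp
  ring

/-- The vector field whose divergence produces the Carleman estimate: the Pohozaev field of `v`
plus a zeroth order term with radial coefficient `Q`. -/
noncomputable def carlemanField {n : ℕ} (Q : ℝ → ℝ) (v : EuclideanSpace ℝ (Fin n) → ℝ) (i : Fin n)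
    (y : EuclideanSpace ℝ (Fin n)) : ℝ :=
  partialDeriv i v y * (∑ j, y j * partialDeriv j v y)
    - y i * (1 / 2 * ∑ j, partialDeriv j v y * partialDeriv j v y)
    + ((n : ℝ) - 2) / 2 * (v y * partialDeriv i v y)
    + 1 / 2 * (y i * ((Q ‖y‖ * v y) * v y))

section CarlemanField

variable {n : ℕ} {v : EuclideanSpace ℝ (Fin n) → ℝ} {x : EuclideanSpace ℝ (Fin n)} {Q : ℝ → ℝ}

theorem contDiff_carlemanField (hQ : ∀ r > 0, ContDiffAt ℝ (⊤ : ℕ∞) Q r)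
    (hv : ContDiff ℝ (⊤ : ℕ∞) v) (h0 : 0 ∉ tsupport v) (i : Fin n) :
    ContDiff ℝ (⊤ : ℕ∞) (carlemanField Q v i) := by
  have hd : ∀ j, ContDiff ℝ (⊤ : ℕ∞) (partialDeriv j v) := fun j => contDiff_partialDeriv hv
  have hP : ContDiff ℝ (⊤ : ℕ∞) (fun y => Q ‖y‖ * v y) :=
    contDiff_mul_of_zero_notMem_tsupport (g := fun y => Q ‖y‖)
      (fun y hy => (hQ _ (norm_pos_iff.2 hy)).comp y (contDiffAt_norm ℝ hy)) hv h0
  have hc : ∀ j, ContDiff ℝ (⊤ : ℕ∞) (fun y : EuclideanSpace ℝ (Fin n) => y j) :=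
    fun j => by fun_prop
  unfold carlemanField
  refine (((hd i).mul (ContDiff.sum fun j _ => (hc j).mul (hd j))).sub ((hc i).mul
    (contDiff_const.mul (ContDiff.sum fun j _ => (hd j).mul (hd j))))).add
    (contDiff_const.mul (hv.mul (hd i))) |>.add (contDiff_const.mul ((hc i).mul (hP.mul hv)))

theorem tsupport_carlemanField_subset (i : Fin n) : tsupport (carlemanField Q v i) ⊆ tsupport v := by
  refine closure_minimal (fun y hy => ?_) (isClosed_tsupport v)
  by_contra h
  refine hy ?_
  simp [carlemanField, partialDeriv_of_notMem_tsupport h, image_eq_zero_of_notMem_tsupport h]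

theorem divergence_carlemanField (hv : ContDiff ℝ (⊤ : ℕ∞) v) (hx : x ≠ 0) {Q' : ℝ}
    (hQ : HasDerivAt Q Q' ‖x‖) :
    ∑ i, partialDeriv i (carlemanField Q v i) x =
      ((∑ i, partialDeriv i (partialDeriv i v) x) + Q ‖x‖ * v x) *
        ((∑ j, x j * partialDeriv j v x) + ((n : ℝ) - 2) / 2 * v x)
        + (Q ‖x‖ + Q' * ‖x‖ / 2) * v x ^ 2 := by
  have hr : ‖x‖ ≠ 0 := norm_ne_zero_iff.2 hx
  have key := sum_divergence_identity (fun i => x i) (fun i => partialDeriv i v x)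
    (fun i j => partialDeriv i (partialDeriv j v) x) (fun i j => partialDeriv_comm hv j)
    (v x) (Q ‖x‖) (Q' / ‖x‖) (‖x‖ ^ 2) (EuclideanSpace.real_norm_sq_eq x).symm
  have hR : Q' / ‖x‖ * ‖x‖ ^ 2 / 2 = Q' * ‖x‖ / 2 := by field_simp
  rw [hR] at key
  rw [← key]
  refine Finset.sum_congr rfl fun i _ => ?_
  have hvx : DifferentiableAt ℝ v x := hv.differentiable (by simp) x
  have hd : ∀ j, DifferentiableAt ℝ (partialDeriv j v) x :=
    fun j => (contDiff_partialDeriv hv).differentiable (by simp) x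
  have hc : ∀ j, DifferentiableAt ℝ (fun y : EuclideanSpace ℝ (Fin n) => y j) x :=
    fun j => by fun_prop
  have hQx : DifferentiableAt ℝ (fun y : EuclideanSpace ℝ (Fin n) => Q ‖y‖) x :=
    differentiableAt_radial hx hQ.differentiableAt
  have hP := hQx.fun_mul hvx
  have hS1 : DifferentiableAt ℝ (fun y => ∑ j, y j * partialDeriv j v y) x :=
    DifferentiableAt.fun_sum fun j _ => (hc j).fun_mul (hd j)
  have hS2 : DifferentiableAt ℝ (fun y => ∑ j, partialDeriv j v y * partialDeriv j v y) x :=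
    DifferentiableAt.fun_sum fun j _ => (hd j).fun_mul (hd j)
  have hT1 := (hd i).fun_mul hS1
  have hT2 := (hc i).fun_mul (hS2.const_mul (1 / 2))
  have hT3 := (hvx.fun_mul (hd i)).const_mul (((n : ℝ) - 2) / 2)
  have hT4 := ((hc i).fun_mul (hP.fun_mul hvx)).const_mul (1 / 2)
  have e1 : partialDeriv i (fun y => ∑ j, y j * partialDeriv j v y) x =
      partialDeriv i v x + ∑ j, x j * partialDeriv i (partialDeriv j v) x := by
    rw [partialDeriv_sum fun j _ => (hc j).fun_mul (hd j)]
    simp_rw [fun j => partialDeriv_mul (i := i) (hc j) (hd j), partialDeriv_coord,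
      Finset.sum_add_distrib]
    simp [add_comm]
  have e2 : partialDeriv i (fun y => ∑ j, partialDeriv j v y * partialDeriv j v y) x =
      2 * ∑ j, partialDeriv j v x * partialDeriv i (partialDeriv j v) x := by
    rw [partialDeriv_sum fun j _ => (hd j).fun_mul (hd j), Finset.mul_sum]
    refine Finset.sum_congr rfl fun j _ => ?_
    rw [partialDeriv_mul (hd j) (hd j)]
    ring
  unfold carlemanField
  rw [partialDeriv_add ((hT1.fun_sub hT2).fun_add hT3) hT4, partialDeriv_add (hT1.fun_sub hT2) hT3,
    partialDeriv_sub hT1 hT2, partialDeriv_mul (hd i) hS1,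
    partialDeriv_mul (hc i) (hS2.const_mul (1 / 2)), partialDeriv_const_mul _ hS2,
    partialDeriv_const_mul _ (hvx.fun_mul (hd i)), partialDeriv_mul hvx (hd i),
    partialDeriv_const_mul _ ((hc i).fun_mul (hP.fun_mul hvx)), partialDeriv_mul (hc i) (hP.fun_mul hvx),
    partialDeriv_mul hP hvx, partialDeriv_mul hQx hvx, partialDeriv_radial hx hQ, e1, e2,
    partialDeriv_coord]
  simp only [if_true, sq]
  field_simp

end CarlemanField

theorem hasDerivAt_weight_rpow {r : ℝ} (hr : 0 < r) (a : ℝ) :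
    HasDerivAt (fun s : ℝ => (s / (1 + s)) ^ a) ((r / (1 + r)) ^ a * (a / (r * (1 + r)))) r := by
  have hw : 0 < r / (1 + r) := by positivity
  have h := ((hasDerivAt_id' r).fun_div ((hasDerivAt_id' r).const_add 1)
    (by positivity)).rpow_const (p := a) (Or.inl hw.ne')
  convert h using 1
  rw [rpow_sub_one hw.ne']
  field_simp
  ring

/-- The Laplacian conjugated by the radial weight `w ^ a` with `w(r) = r / (1 + r)`. -/
theorem laplacian_weight_rpow_mul {n : ℕ} {v : EuclideanSpace ℝ (Fin n) → ℝ}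
    {x : EuclideanSpace ℝ (Fin n)} (hv : ContDiff ℝ (⊤ : ℕ∞) v) (hx : x ≠ 0) (a : ℝ) :
    ∑ i, partialDeriv i (partialDeriv i (fun y => (‖y‖ / (1 + ‖y‖)) ^ a * v y)) x =
      (‖x‖ / (1 + ‖x‖)) ^ a * ((∑ i, partialDeriv i (partialDeriv i v) x)
        + 2 * (a / (‖x‖ ^ 2 * (1 + ‖x‖))) *
          ((∑ j, x j * partialDeriv j v x) + ((n : ℝ) - 2) / 2 * v x)
        + (a ^ 2 - a * ‖x‖) / (‖x‖ ^ 2 * (1 + ‖x‖) ^ 2) * v x) := by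
  have hr : 0 < ‖x‖ := norm_pos_iff.2 hx
  have hvd : ∀ y, DifferentiableAt ℝ v y := fun y => hv.differentiable (by simp) y
  have hd : ∀ j, DifferentiableAt ℝ (partialDeriv j v) x :=
    fun j => (contDiff_partialDeriv hv).differentiable (by simp) x
  have hc : ∀ j, DifferentiableAt ℝ (fun y : EuclideanSpace ℝ (Fin n) => y j) x :=
    fun j => by fun_prop
  have hK : ∀ y : EuclideanSpace ℝ (Fin n), y ≠ 0 →
      DifferentiableAt ℝ (fun y : EuclideanSpace ℝ (Fin n) => (‖y‖ / (1 + ‖y‖)) ^ a) y := fun y hy =>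
    differentiableAt_radial hy (hasDerivAt_weight_rpow (norm_pos_iff.2 hy) a).differentiableAt
  have hKi : ∀ (i : Fin n) (y : EuclideanSpace ℝ (Fin n)), y ≠ 0 →
      partialDeriv i (fun y : EuclideanSpace ℝ (Fin n) => (‖y‖ / (1 + ‖y‖)) ^ a) y =
      (‖y‖ / (1 + ‖y‖)) ^ a * (a / (‖y‖ * (1 + ‖y‖))) * (y i / ‖y‖) := fun i y hy =>
    partialDeriv_radial hy (hasDerivAt_weight_rpow (norm_pos_iff.2 hy) a)
  have hm : HasDerivAt (fun s : ℝ => a / (s ^ 2 * (1 + s)))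
      (-a * (2 + 3 * ‖x‖) / (‖x‖ ^ 3 * (1 + ‖x‖) ^ 2)) ‖x‖ := by
    have h := (hasDerivAt_const ‖x‖ a).fun_div (((hasDerivAt_id' ‖x‖).fun_pow 2).fun_mul
      ((hasDerivAt_id' ‖x‖).const_add 1)) (by positivity)
    refine h.congr_deriv ?_
    rw [div_eq_div_iff (by positivity) (by positivity)]
    push_cast
    ring
  have hmd : DifferentiableAt ℝ
      (fun y : EuclideanSpace ℝ (Fin n) => a / (‖y‖ ^ 2 * (1 + ‖y‖))) x :=
    differentiableAt_radial hx hm.differentiableAt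
  have hfirst : ∀ i, partialDeriv i (fun y => (‖y‖ / (1 + ‖y‖)) ^ a * v y) =ᶠ[nhds x]
      fun y => (‖y‖ / (1 + ‖y‖)) ^ a *
        (a / (‖y‖ ^ 2 * (1 + ‖y‖)) * (y i * v y) + partialDeriv i v y) := by
    intro i
    filter_upwards [isOpen_ne.mem_nhds hx] with y hy
    rw [partialDeriv_mul (hK y hy) (hvd y), hKi i y hy]
    have := norm_pos_iff.2 hy
    field_simp
    ring
  have hsecond : ∀ i, partialDeriv i (partialDeriv i (fun y => (‖y‖ / (1 + ‖y‖)) ^ a * v y)) x =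
      (‖x‖ / (1 + ‖x‖)) ^ a * (partialDeriv i (partialDeriv i v) x
        + 2 * (a / (‖x‖ ^ 2 * (1 + ‖x‖))) * (x i * partialDeriv i v x)
        + a / (‖x‖ ^ 2 * (1 + ‖x‖)) * v x
        + x i ^ 2 * ((a ^ 2 / (‖x‖ ^ 4 * (1 + ‖x‖) ^ 2)
          - a * (2 + 3 * ‖x‖) / (‖x‖ ^ 4 * (1 + ‖x‖) ^ 2)) * v x)) := by
    intro i
    have hxv := (hc i).fun_mul (hvd x)
    rw [partialDeriv_congr (hfirst i), partialDeriv_mul (hK x hx) ((hmd.fun_mul hxv).fun_add (hd i)),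
      partialDeriv_add (hmd.fun_mul hxv) (hd i), partialDeriv_mul hmd hxv,
      partialDeriv_mul (hc i) (hvd x), partialDeriv_radial hx hm, hKi i x hx, partialDeriv_coord]
    simp only [if_true]
    field_simp
    ring
  simp only [hsecond, ← Finset.mul_sum, Finset.sum_add_distrib, ← Finset.sum_mul,
    ← EuclideanSpace.real_norm_sq_eq]
  congr 1
  simp
  field_simp
  ring

/-- The zeroth order coefficient of the Laplacian conjugated by `(r / (1 + r)) ^ a`. -/
noncomputable def carlemanPotential (a r : ℝ) : ℝ :=
  (a ^ 2 - a * r) / (r ^ 2 * (1 + r) ^ 2)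

theorem hasDerivAt_carlemanPotential (a : ℝ) {r : ℝ} (hr : 0 < r) :
    HasDerivAt (carlemanPotential a)
      (-(2 * a ^ 2 + a - a * r) / (r ^ 2 * (1 + r) ^ 3)
        - 2 * (a ^ 2 - a * r) / (r ^ 3 * (1 + r) ^ 2)) r := by
  have h := (((hasDerivAt_id' r).const_mul a).const_sub (a ^ 2)).fun_div
    (((hasDerivAt_id' r).fun_pow 2).fun_mul (((hasDerivAt_id' r).const_add 1).fun_pow 2))
    (by positivity)
  refine h.congr_deriv ?_
  field_simp
  push_cast
  ring

theorem contDiffAt_carlemanPotential (a : ℝ) {r : ℝ} (hr : 0 < r) :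
    ContDiffAt ℝ (⊤ : ℕ∞) (carlemanPotential a) r := by
  unfold carlemanPotential
  refine ContDiffAt.div (by fun_prop) (by fun_prop) (by positivity)

theorem carleman_pointwise {a r : ℝ} (ha : 10 < a) (hr : 0 < r) (hr' : r < 10) (D Y v : ℝ) :
    a ^ 3 * ((r / (1 + r))⁻¹ * v ^ 2) ≤
      11 ^ 7 / 4 * ((r / (1 + r)) ^ 2 *
        (D + 2 * (a / (r ^ 2 * (1 + r))) * Y + carlemanPotential a r * v) ^ 2)
      - 2 * 11 ^ 4 * a * ((D + carlemanPotential a r * v) * Y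
        + (carlemanPotential a r + (-(2 * a ^ 2 + a - a * r) / (r ^ 2 * (1 + r) ^ 3)
          - 2 * (a ^ 2 - a * r) / (r ^ 3 * (1 + r) ^ 2)) * r / 2) * v ^ 2) := by
  set m := a / (r ^ 2 * (1 + r)) with hm
  have hmpos : 0 < m := by positivity
  set Φ := D + 2 * m * Y + carlemanPotential a r * v with hΦ
  have hS : carlemanPotential a r + (-(2 * a ^ 2 + a - a * r) / (r ^ 2 * (1 + r) ^ 3)
      - 2 * (a ^ 2 - a * r) / (r ^ 3 * (1 + r) ^ 2)) * r / 2
      = -((2 * a ^ 2 + a - a * r) / (2 * r * (1 + r) ^ 3)) := by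
    unfold carlemanPotential
    field_simp
    ring
  have hD : D + carlemanPotential a r * v = Φ - 2 * m * Y := by rw [hΦ]; ring
  rw [hS, hD]
  have hcs : (Φ - 2 * m * Y) * Y ≤ Φ ^ 2 / (8 * m) := by
    rw [le_div_iff₀ (by positivity)]
    nlinarith [sq_nonneg (Φ - 4 * m * Y)]
  have h1 : a * (Φ ^ 2 / (8 * m)) ≤ 11 ^ 3 / 8 * ((r / (1 + r)) ^ 2 * Φ ^ 2) := by
    have e : a * (Φ ^ 2 / (8 * m)) = (1 + r) ^ 3 / 8 * ((r / (1 + r)) ^ 2 * Φ ^ 2) := by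
      rw [hm]; field_simp
    rw [e]
    gcongr
    linarith
  have h2 : a ^ 3 * ((r / (1 + r))⁻¹ * v ^ 2) ≤
      2 * 11 ^ 4 * a * ((2 * a ^ 2 + a - a * r) / (2 * r * (1 + r) ^ 3) * v ^ 2) := by
    have e : a ^ 3 * ((r / (1 + r))⁻¹ * v ^ 2) =
        2 * (1 + r) ^ 4 * a * (a ^ 2 / (2 * r * (1 + r) ^ 3) * v ^ 2) := by
      field_simp
    rw [e]
    gcongr
    · linarith
    · nlinarith
  nlinarith [mul_le_mul_of_nonneg_left hcs (by positivity : 0 ≤ a)]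

theorem contDiffAt_weight_rpow {n : ℕ} {x : EuclideanSpace ℝ (Fin n)} (hx : x ≠ 0) (b : ℝ) :
    ContDiffAt ℝ (⊤ : ℕ∞) (fun y : EuclideanSpace ℝ (Fin n) => (‖y‖ / (1 + ‖y‖)) ^ b) x := by
  have hr := norm_pos_iff.2 hx
  have hn : ContDiffAt ℝ (⊤ : ℕ∞) (fun y : EuclideanSpace ℝ (Fin n) => ‖y‖) x :=
    contDiffAt_norm ℝ hx
  have h1 : 1 + ‖x‖ ≠ 0 := by positivity
  have hw : ‖x‖ / (1 + ‖x‖) ≠ 0 := by positivity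
  exact (hn.fun_div (contDiffAt_const.add hn) h1).rpow_const_of_ne hw

/-- The Carleman inequality holds pointwise up to a remainder `G` of integral zero, which is a
multiple of the divergence of the Carleman vector field. -/
theorem exists_carleman_remainder {n : ℕ} {f : EuclideanSpace ℝ (Fin n) → ℝ}
    (hf : ContDiff ℝ (⊤ : ℕ∞) f) (hc : HasCompactSupport f)
    (hsupp : tsupport f ⊆ Metric.ball 0 10 \ {0}) {a : ℝ} (ha : 10 < a) :
    ∃ G : EuclideanSpace ℝ (Fin n) → ℝ, Integrable G ∧ ∫ x, G x = 0 ∧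
      ∀ x, a ^ 3 * ((‖x‖ / (1 + ‖x‖)) ^ (-1 - 2 * a) * f x ^ 2) ≤
        11 ^ 7 / 4 * ((‖x‖ / (1 + ‖x‖)) ^ (2 - 2 * a) *
          (∑ i, partialDeriv i (partialDeriv i f) x) ^ 2) + G x := by
  have h0 : (0 : EuclideanSpace ℝ (Fin n)) ∉ tsupport f := fun h => (hsupp h).2 rfl
  set v : EuclideanSpace ℝ (Fin n) → ℝ := fun y => (‖y‖ / (1 + ‖y‖)) ^ (-a) * f y with hvdef
  have hv : ContDiff ℝ (⊤ : ℕ∞) v := by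
    refine contDiff_mul_of_zero_notMem_tsupport
      (g := fun y : EuclideanSpace ℝ (Fin n) => (‖y‖ / (1 + ‖y‖)) ^ (-a))
      (fun _ hy => contDiffAt_weight_rpow hy _) hf h0
  have hsub : tsupport v ⊆ tsupport f := closure_mono fun y hy hfy => hy (by simp [hvdef, hfy])
  have hF := contDiff_carlemanField (Q := carlemanPotential a)
    (fun r hr => contDiffAt_carlemanPotential a hr) hv (fun h => h0 (hsub h))
  have hFc : ∀ i, HasCompactSupport (carlemanField (carlemanPotential a) v i) := fun i =>
    hc.mono' ((subset_tsupport _).trans ((tsupport_carlemanField_subset i).trans hsub))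
  refine ⟨fun x => -(2 * 11 ^ 4 * a) *
    ∑ i, partialDeriv i (carlemanField (carlemanPotential a) v i) x, ?_, ?_, fun x => ?_⟩
  · exact (integrable_finsetSum _ fun i _ => integrable_partialDeriv (hF i) (hFc i)).const_mul _
  · rw [integral_const_mul, integral_finsetSum _ fun i _ => integrable_partialDeriv (hF i) (hFc i)]
    simp [integral_partialDeriv_eq_zero (hF _) (hFc _)]
  · by_cases hx : x ∈ tsupport f
    · have hx0 : x ≠ 0 := fun h => h0 (h ▸ hx)
      have hr : 0 < ‖x‖ := norm_pos_iff.2 hx0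
      have hr' : ‖x‖ < 10 := by simpa using (hsupp hx).1
      have hw : 0 < ‖x‖ / (1 + ‖x‖) := by positivity
      have hfv : f =ᶠ[nhds x] fun y => (‖y‖ / (1 + ‖y‖)) ^ a * v y := by
        filter_upwards [isOpen_ne.mem_nhds hx0] with y hy
        have : 0 < ‖y‖ := norm_pos_iff.2 hy
        rw [hvdef, ← mul_assoc, ← rpow_add (by positivity)]
        simp
      clear_value v
      have hlap : ∑ i, partialDeriv i (partialDeriv i f) x = _ :=
        (Finset.sum_congr rfl fun i _ => partialDeriv_congr (partialDeriv_eventuallyEq hfv)).trans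
          (laplacian_weight_rpow_mul hv hx0 a)
      have hpow : ∀ b : ℝ, (‖x‖ / (1 + ‖x‖)) ^ (b - 2 * a) * ((‖x‖ / (1 + ‖x‖)) ^ a) ^ 2 =
          (‖x‖ / (1 + ‖x‖)) ^ b := by
        intro b
        rw [sq, ← rpow_add hw, ← rpow_add hw]
        ring_nf
      have h := carleman_pointwise ha hr hr' (∑ i, partialDeriv i (partialDeriv i v) x)
        ((∑ j, x j * partialDeriv j v x) + ((n : ℝ) - 2) / 2 * v x) (v x)
      rw [hlap, hfv.eq_of_nhds, mul_pow, mul_pow, ← mul_assoc (_ ^ (-1 - 2 * a)), hpow,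
        ← mul_assoc (_ ^ (2 - 2 * a)), hpow, rpow_neg_one, rpow_two]
      beta_reduce
      rw [divergence_carlemanField hv hx0 (hasDerivAt_carlemanPotential a hr)]
      refine h.trans (le_of_eq ?_)
      rw [carlemanPotential]
      ring
    · have hz : ∀ i, partialDeriv i (carlemanField (carlemanPotential a) v i) x = 0 := fun i =>
        partialDeriv_of_notMem_tsupport fun h => hx (hsub (tsupport_carlemanField_subset i h))
      simp only [image_eq_zero_of_notMem_tsupport hx, hz]
      simp
      positivity

theorem laplacian_eq_sum_partialDeriv {n : ℕ} {f : EuclideanSpace ℝ (Fin n) → ℂ}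
    (hf : ContDiff ℝ (⊤ : ℕ∞) f) (L : ℂ →L[ℝ] ℝ) (x : EuclideanSpace ℝ (Fin n)) :
    L (laplacian f x) = ∑ i, partialDeriv i (partialDeriv i (fun y => L (f y))) x := by
  rw [laplacian, map_sum]
  refine Finset.sum_congr rfl fun i _ => ?_
  have h1 : partialDeriv i (fun y => L (f y)) =
      fun y => L (fderiv ℝ f y (EuclideanSpace.single i 1)) := by
    funext y
    rw [partialDeriv, 
      fderiv_fun_comp y L.differentiableAt (hf.differentiable (by simp) y), L.fderiv]
    rfl
  have hd : DifferentiableAt ℝ (fun y => fderiv ℝ f y (EuclideanSpace.single i 1)) x :=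
    ((hf.fderiv_right (m := (⊤ : ℕ∞)) (by simp)).clm_apply contDiff_const).differentiable
      (by simp) x
  rw [h1, partialDeriv, fderiv_fun_comp x L.differentiableAt hd, L.fderiv]
  rfl

theorem contDiff_laplacian {n : ℕ} {f : EuclideanSpace ℝ (Fin n) → ℂ}
    (hf : ContDiff ℝ (⊤ : ℕ∞) f) : ContDiff ℝ (⊤ : ℕ∞) (laplacian f) := by
  unfold laplacian
  refine ContDiff.sum fun i _ => ?_
  have h := (hf.fderiv_right (m := (⊤ : ℕ∞)) (by simp)).clm_apply
    (contDiff_const (c := EuclideanSpace.single i (1 : ℝ)))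
  exact (h.fderiv_right (m := (⊤ : ℕ∞)) (by simp)).clm_apply contDiff_const

theorem tsupport_laplacian_subset {n : ℕ} (f : EuclideanSpace ℝ (Fin n) → ℂ) :
    tsupport (laplacian f) ⊆ tsupport f := by
  refine closure_minimal (fun y hy => ?_) (isClosed_tsupport f)
  by_contra h
  refine hy (Finset.sum_eq_zero fun i _ => ?_)
  have h' : (fun z => fderiv ℝ f z (EuclideanSpace.single i 1)) =ᶠ[nhds y] fun _ => 0 :=
    (notMem_tsupport_iff_eventuallyEq.1 h).eventually_nhds.mono fun z hz => by
      simp [Filter.EventuallyEq.fderiv_eq hz]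
  rw [h'.fderiv_eq]
  simp

theorem integrable_weight_rpow_mul_norm_laplacian_sq {n : ℕ} {f : EuclideanSpace ℝ (Fin n) → ℂ}
    (hf : ContDiff ℝ (⊤ : ℕ∞) f) (hc : HasCompactSupport f) (h0 : 0 ∉ tsupport f) (b : ℝ) :
    Integrable (fun x => (‖x‖ / (1 + ‖x‖)) ^ b * ‖laplacian f x‖ ^ 2) := by
  have hsub := tsupport_laplacian_subset f
  have h : ContDiff ℝ (⊤ : ℕ∞) (fun x => (‖x‖ / (1 + ‖x‖)) ^ b • laplacian f x) := by
    refine contDiff_mul_of_zero_notMem_tsupport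
      (g := fun y : EuclideanSpace ℝ (Fin n) => (‖y‖ / (1 + ‖y‖)) ^ b)
      (fun _ hy => contDiffAt_weight_rpow hy _)
      (contDiff_laplacian hf) (fun h => h0 (hsub h))
  have hcont := h.continuous.norm.fun_mul (contDiff_laplacian hf).continuous.norm
  refine (hcont.integrable_of_hasCompactSupport (HasCompactSupport.intro hc fun x hx => ?_)).congr
    (Filter.Eventually.of_forall fun x => ?_)
  · simp [image_eq_zero_of_notMem_tsupport fun h => hx (hsub h)]
  · have : 0 ≤ (‖x‖ / (1 + ‖x‖)) ^ b := by positivity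
    simp only [norm_smul, Real.norm_eq_abs, abs_of_nonneg this]
    ring

/-- **The Bourgain–Kenig Carleman-type inequality** (Lemma 3.15 of Bourgain–Kenig, 2005).
There are dimensional constants `C₁, C₂, C₃ > 0` and an increasing weight `w` on `(0,10)`
with `1/C₁ ≤ w(r)/r ≤ C₁` such that for all smooth `f` compactly supported in
`B(0,10) ∖ {0}` and all `a > C₂`,
`a³ ∫ w(|x|)^{−1−2a} |f|² ≤ C₃ ∫ w(|x|)^{2−2a} |Δf|²`. -/
theorem bourgain_kenig_carleman (n : ℕ) (hn : 1 ≤ n) :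
    ∃ C₁ C₂ C₃ : ℝ, 0 < C₁ ∧ 0 < C₂ ∧ 0 < C₃ ∧
      ∃ w : ℝ → ℝ, StrictMonoOn w (Set.Ioo 0 10) ∧
        (∀ r ∈ Set.Ioo (0 : ℝ) 10, 1 / C₁ ≤ w r / r ∧ w r / r ≤ C₁) ∧
        ∀ f : EuclideanSpace ℝ (Fin n) → ℂ,
          ContDiff ℝ (⊤ : ℕ∞) f → HasCompactSupport f →
          tsupport f ⊆ Metric.ball 0 10 \ {0} →
          ∀ a : ℝ, C₂ < a →
            a ^ 3 * ∫ x, w ‖x‖ ^ (-1 - 2 * a) * ‖f x‖ ^ 2 ≤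
              C₃ * ∫ x, w ‖x‖ ^ (2 - 2 * a) * ‖laplacian f x‖ ^ 2 := by
  refine ⟨11, 10, 11 ^ 7 / 4, by norm_num, by norm_num, by norm_num, fun r => r / (1 + r),
    fun r hr s hs hrs => ?_, fun r hr => ?_, fun f hf hc hsupp a ha => ?_⟩
  · have := hr.1
    have := hs.1
    rw [div_lt_div_iff₀ (by positivity) (by positivity)]
    linarith
  · obtain ⟨h1, h2⟩ := hr
    have e : r / (1 + r) / r = 1 / (1 + r) := by field_simp
    rw [e]
    constructor
    · gcongr
      linarith
    · rw [div_le_iff₀ (by positivity)]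
      linarith
  have h0 : (0 : EuclideanSpace ℝ (Fin n)) ∉ tsupport f := fun h => (hsupp h).2 rfl
  have hproj : ∀ L : ℂ →L[ℝ] ℝ, ∃ G : EuclideanSpace ℝ (Fin n) → ℝ, Integrable G ∧
      ∫ x, G x = 0 ∧ ∀ x, a ^ 3 * ((‖x‖ / (1 + ‖x‖)) ^ (-1 - 2 * a) * L (f x) ^ 2) ≤
        11 ^ 7 / 4 * ((‖x‖ / (1 + ‖x‖)) ^ (2 - 2 * a) * L (laplacian f x) ^ 2) + G x := by
    intro L
    have hsub : tsupport (fun x => L (f x)) ⊆ tsupport f :=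
      closure_mono fun y hy hfy => hy (by simp [hfy])
    simp only [laplacian_eq_sum_partialDeriv hf L]
    exact exists_carleman_remainder (L.contDiff.comp hf)
      (hc.mono' ((subset_tsupport _).trans hsub)) (hsub.trans hsupp) ha
  obtain ⟨G₁, hG₁, hG₁0, h₁⟩ := hproj Complex.reCLM
  obtain ⟨G₂, hG₂, hG₂0, h₂⟩ := hproj Complex.imCLM
  have hlap_int := (integrable_weight_rpow_mul_norm_laplacian_sq hf hc h0 (2 - 2 * a)).const_mul
    (11 ^ 7 / 4)
  have ha0 : 0 < a := by linarith
  calc a ^ 3 * ∫ x, (‖x‖ / (1 + ‖x‖)) ^ (-1 - 2 * a) * ‖f x‖ ^ 2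
      = ∫ x, a ^ 3 * ((‖x‖ / (1 + ‖x‖)) ^ (-1 - 2 * a) * ‖f x‖ ^ 2) :=
        (integral_const_mul _ _).symm
    _ ≤ ∫ x, (11 ^ 7 / 4 * ((‖x‖ / (1 + ‖x‖)) ^ (2 - 2 * a) * ‖laplacian f x‖ ^ 2)
          + (G₁ x + G₂ x)) := by
        refine integral_mono_of_nonneg (Filter.Eventually.of_forall fun x => ?_)
          (hlap_int.add (hG₁.add hG₂)) (Filter.Eventually.of_forall fun x => ?_)
        · simp only [Pi.zero_apply]
          positivity
        · have e1 := h₁ x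
          have e2 := h₂ x
          simp only [Complex.reCLM_apply, Complex.imCLM_apply] at e1 e2
          simp only [Complex.sq_norm, Complex.normSq_apply]
          linarith
    _ = 11 ^ 7 / 4 * ∫ x, (‖x‖ / (1 + ‖x‖)) ^ (2 - 2 * a) * ‖laplacian f x‖ ^ 2 := by
        rw [integral_add hlap_int (hG₁.fun_add hG₂), integral_add hG₁ hG₂, hG₁0, hG₂0,
          integral_const_mul]
        simp
end
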